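/- For each sign ε ∈ {+, −}, as X → ∞ the ratio (Σ over integral binary cubic forms f that are irreducible over ℚ, have discriminant of sign ε, and have height H(f) < X, of #I(R_f)[2]) / #{such forms f with H(f) < X} tends to ζ(2)/ζ(4). -/

import Mathlib

open scoped TensorProduct

/-- The discriminant of a commutative ring that is finite and free as a `ℤ`-module:
the discriminant of the trace form with respect to a `ℤ`-basis (independent of the basis). -/
noncomputable def ringDisc (O : Type*) [CommRing O] [Module.Free ℤ O] [Module.Finite ℤ O] : ℤ :=
  Algebra.discr ℤ (Module.Free.chooseBasis ℤ O)

/-- The number of `2`-torsion elements of the class group (the group of invertible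
fractional ideals modulo principal fractional ideals) of a domain `O`
(junk value `0` if `O` is not a domain). -/
noncomputable def classGroupTwoTorsion (O : Type*) [CommRing O] : ℕ := by
  classical exact
    if h : IsDomain O then
      letI := h
      Nat.card {x : ClassGroup O // x ^ 2 = 1}
    else 0

/-- The number of `2`-torsion elements of the group of invertible fractional ideals of `O`,
i.e. the number of invertible fractional ideals `I` with `I² = O`. -/
noncomputable def idealGroupTwoTorsion (O : Type*) [CommRing O] : ℕ :=
  Nat.card {I : (FractionalIdeal (nonZeroDivisors O) (FractionRing O))ˣ // I ^ 2 = 1}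

/-- `O` is an irreducible cubic order: free of rank `3` over `ℤ` with `ℚ ⊗ O` a field. -/
def IsIrredCubicOrder (O : Type*) [CommRing O] [Module.Free ℤ O] [Module.Finite ℤ O] : Prop :=
  Module.finrank ℤ O = 3 ∧ IsField (ℚ ⊗[ℤ] O)

/-- The dehomogenization `f(x,1) = a x³ + b x² + c x + d` over `ℚ` of the integral binary
cubic form `f(x,y) = a x³ + b x² y + c x y² + d y³`. -/
noncomputable def cubicPolyQ (a b c d : ℤ) : Polynomial ℚ :=
  Polynomial.C (a : ℚ) * Polynomial.X ^ 3 + Polynomial.C (b : ℚ) * Polynomial.X ^ 2 +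
    Polynomial.C (c : ℚ) * Polynomial.X + Polynomial.C (d : ℚ)

/-- The discriminant of the binary cubic form `a x³ + b x² y + c x y² + d y³`. -/
def cubicDisc (a b c d : ℤ) : ℤ :=
  18*a*b*c*d - 4*b^3*d + b^2*c^2 - 4*a*c^3 - 27*a^2*d^2

/-- The height of the binary cubic form `a x³ + b x² y + c x y² + d y³`: the maximum of the
absolute values of its coefficients. -/
def cubicHeight (a b c d : ℤ) : ℤ := max (max |a| |b|) (max |c| |d|)

/-- The binary cubic form `a x³ + b x² y + c x y² + d y³` is irreducible over `ℚ`. -/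
def IsIrredCubicForm (a b c d : ℤ) : Prop :=
  a ≠ 0 ∧ Irreducible (cubicPolyQ a b c d)

/-- The cubic field `K_f = ℚ[x]/(f(x,1))` attached to an (irreducible) integral binary
cubic form `f = a x³ + b x² y + c x y² + d y³`. -/
noncomputable abbrev cubicField (a b c d : ℤ) : Type := AdjoinRoot (cubicPolyQ a b c d)

/-- The Delone–Faddeev ring `R_f` of the integral binary cubic form
`f = a x³ + b x² y + c x y² + d y³` (for `f` irreducible): the cubic order
`ℤ + ℤ·aθ + ℤ·(aθ² + bθ) ⊆ K_f` (`θ` the root of `f(x,1)` in `K_f`), realized as the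
subring of `K_f` generated by `aθ` and `aθ² + bθ`; it has `ℤ`-basis `1, ω, θ'` with
multiplication table `ωθ' = -ad`, `ω² = -ac - bω + aθ'`, `θ'² = -bd - dω + cθ'`. -/
noncomputable def DFring (a b c d : ℤ) : Subring (cubicField a b c d) :=
  Subring.closure
    {(a : cubicField a b c d) * AdjoinRoot.root _,
     (a : cubicField a b c d) * AdjoinRoot.root _ ^ 2 +
       (b : cubicField a b c d) * AdjoinRoot.root _}

/-- `ω, θ` together with `1` multiply by the Delone–Faddeev table of the binary cubic form
with coefficients `a, b, c, d`, and `1, ω, θ` are linearly independent over `ℤ`. -/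
structure IsCubicBasis {K : Type*} [Field K] (ω θ : K) (a b c d : ℤ) : Prop where
  mul_eq : ω * θ = -((a : K) * d)
  sq_left : ω ^ 2 = -((a : K) * c) - b * ω + a * θ
  sq_right : θ ^ 2 = -((b : K) * d) - d * ω + c * θ
  indep : ∀ x y z : ℤ, (x : K) + y * ω + z * θ = 0 → x = 0 ∧ y = 0 ∧ z = 0

/-- The `ℤ`-lattice spanned by `1, ω, θ`. -/
def cubicLattice {K : Type*} [Field K] (ω θ : K) : Submodule ℤ K := Submodule.span ℤ {1, ω, θ}

/-- `I` is a module over `R` and satisfies `I² = R`. -/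
def IsTwoTorsionLattice {K : Type*} [Field K] (R I : Submodule ℤ K) : Prop :=
  I * I = R ∧ R * I ≤ I

/-- The lattice spanned by `n`, `ω / n + r` and `θ`. -/
def torsionLattice {K : Type*} [Field K] (n : ℕ) (r : ℤ) (ω θ : K) : Submodule ℤ K :=
  Submodule.span ℤ {(n : K), ω / n + r, θ}

/-- The coefficients of `f(px + ry, qx + sy)`. -/
def formAct {R : Type*} [CommRing R] (p q r s : R) (f : R × R × R × R) : R × R × R × R :=
  (f.1 * p ^ 3 + f.2.1 * p ^ 2 * q + f.2.2.1 * p * q ^ 2 + f.2.2.2 * q ^ 3,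
   3 * f.1 * p ^ 2 * r + f.2.1 * (p ^ 2 * s + 2 * p * q * r) +
     f.2.2.1 * (2 * p * q * s + q ^ 2 * r) + 3 * f.2.2.2 * q ^ 2 * s,
   3 * f.1 * p * r ^ 2 + f.2.1 * (2 * p * r * s + q * r ^ 2) +
     f.2.2.1 * (p * s ^ 2 + 2 * q * r * s) + 3 * f.2.2.2 * q * s ^ 2,
   f.1 * r ^ 3 + f.2.1 * r ^ 2 * s + f.2.2.1 * r * s ^ 2 + f.2.2.2 * s ^ 3)

/-- The integer normalizing the first basis vector after a change of basis. -/
def shiftFst (p q r s : ℤ) (f : ℤ × ℤ × ℤ × ℤ) : ℤ :=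
  -q * (p * r * f.2.1 + q * s * f.2.2.2) - p * (p * r * f.1 + q * s * f.2.2.1)

/-- The integer normalizing the second basis vector after a change of basis. -/
def shiftSnd (p q r s : ℤ) (f : ℤ × ℤ × ℤ × ℤ) : ℤ :=
  s * (p * r * f.2.1 + q * s * f.2.2.2) + r * (p * r * f.1 + q * s * f.2.2.1)

/-- The congruence condition on a form under which `torsionLattice n r ω θ` squares to
`cubicLattice ω θ`. -/
def TorsionCond (n : ℕ) (r : ℤ) (f : ℤ × ℤ × ℤ × ℤ) : Prop :=
  (n : ℤ) ^ 2 ∣ f.1 ∧ (n : ℤ) ^ 2 ∣ f.2.1 - 2 * n * r ∧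
    IsCoprime (r ^ 2 - f.1 / (n : ℤ) ^ 2 * f.2.2.1) (n : ℤ)

section Lattice

variable {K : Type*} [Field K]

theorem mem_cubicLattice {ω θ v : K} :
    v ∈ cubicLattice ω θ ↔ ∃ x y z : ℤ, v = x + y * ω + z * θ := by
  rw [cubicLattice, Submodule.mem_span_triple]
  simp only [zsmul_eq_mul, mul_one]
  exact ⟨fun ⟨x, y, z, h⟩ => ⟨x, y, z, h.symm⟩, fun ⟨x, y, z, h⟩ => ⟨x, y, z, h.symm⟩⟩

theorem mem_torsionLattice {n : ℕ} {r : ℤ} {ω θ v : K} :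
    v ∈ torsionLattice n r ω θ ↔ ∃ x y z : ℤ, v = x * n + y * (ω / n + r) + z * θ := by
  rw [torsionLattice, Submodule.mem_span_triple]
  simp only [zsmul_eq_mul]
  exact ⟨fun ⟨x, y, z, h⟩ => ⟨x, y, z, h.symm⟩, fun ⟨x, y, z, h⟩ => ⟨x, y, z, h.symm⟩⟩

theorem IsCubicBasis.change {ω θ : K} {a b c d : ℤ} (h : IsCubicBasis ω θ a b c d)
    {p q r s : ℤ} (hdet : p * s - q * r = 1) :
    IsCubicBasis (p * ω + q * θ + (shiftFst p q r s (a, b, c, d) : ℤ))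
      (r * ω + s * θ + (shiftSnd p q r s (a, b, c, d) : ℤ))
      (formAct p q r s (a, b, c, d)).1 (formAct p q r s (a, b, c, d)).2.1
      (formAct p q r s (a, b, c, d)).2.2.1 (formAct p q r s (a, b, c, d)).2.2.2 := by
  have hK : (p : K) * s - q * r = 1 := by exact_mod_cast congrArg (Int.cast : ℤ → K) hdet
  have h1 := h.mul_eq
  have h2 := h.sq_left
  have h3 := h.sq_right
  refine ⟨?_, ?_, ?_, ?_⟩
  · simp only [formAct, shiftFst, shiftSnd]; push_cast; clear h; grind
  · simp only [formAct, shiftFst, shiftSnd]; push_cast; clear h; grind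
  · simp only [formAct, shiftFst, shiftSnd]; push_cast; clear h; grind
  · intro x y z hx
    simp only [shiftFst, shiftSnd] at hx
    have := h.indep (x + y * (-q * (p * r * b + q * s * d) - p * (p * r * a + q * s * c)) +
      z * (s * (p * r * b + q * s * d) + r * (p * r * a + q * s * c))) (y * p + z * r)
      (y * q + z * s) (by push_cast at hx ⊢; linear_combination hx)
    obtain ⟨e1, e2, e3⟩ := this
    have hy : y = 0 := by linear_combination s * e2 - r * e3 - y * hdet
    have hz : z = 0 := by linear_combination -q * e2 + p * e3 - z * hdet
    subst hy hz
    simpa using e1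

theorem cubicLattice_change (ω θ : K) {p q r s : ℤ} (hdet : p * s - q * r = 1) (i j : ℤ) :
    cubicLattice (p * ω + q * θ + i) (r * ω + s * θ + j) = cubicLattice ω θ := by
  have hK : (p : K) * s - q * r = 1 := by exact_mod_cast congrArg (Int.cast : ℤ → K) hdet
  ext v
  rw [mem_cubicLattice, mem_cubicLattice]
  constructor
  · rintro ⟨x, y, z, rfl⟩
    exact ⟨x + y * i + z * j, y * p + z * r, y * q + z * s, by push_cast; ring⟩
  · rintro ⟨x, y, z, rfl⟩
    refine ⟨x - (y * s - z * r) * i - (z * p - y * q) * j, y * s - z * r, z * p - y * q, ?_⟩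
    push_cast
    linear_combination -(y * ω + z * θ) * hK

theorem cubicLattice_mul_self {ω θ : K} {a b c d : ℤ} (h : IsCubicBasis ω θ a b c d) :
    cubicLattice ω θ * cubicLattice ω θ = cubicLattice ω θ := by
  apply le_antisymm
  · rw [Submodule.mul_le]
    intro v hv w hw
    rw [mem_cubicLattice] at *
    obtain ⟨x, y, z, rfl⟩ := hv
    obtain ⟨x', y', z', rfl⟩ := hw
    refine ⟨x * x' - y * y' * a * c - (y * z' + z * y') * a * d - z * z' * b * d,
      x * y' + y * x' - y * y' * b - z * z' * d, x * z' + z * x' + y * y' * a + z * z' * c, ?_⟩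
    push_cast
    linear_combination (y * y' : K) * h.sq_left + (y * z' + z * y' : K) * h.mul_eq +
      (z * z' : K) * h.sq_right
  · intro v hv
    rw [← one_mul v]
    exact Submodule.mul_mem_mul (mem_cubicLattice.2 ⟨1, 0, 0, by simp⟩) hv

theorem isTwoTorsionLattice_torsionLattice [CharZero K] {ω θ : K} {a b c d : ℤ}
    (h : IsCubicBasis ω θ a b c d) {n : ℕ} (hn : n ≠ 0) {r : ℤ}
    (hc : TorsionCond n r (a, b, c, d)) :
    IsTwoTorsionLattice (cubicLattice ω θ) (torsionLattice n r ω θ) := by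
  obtain ⟨⟨a', rfl⟩, ⟨m, hm⟩, hu⟩ := hc
  simp only at hm hu
  obtain ⟨k, hk⟩ : ∃ k, k = -m := ⟨_, rfl⟩
  obtain rfl : b = 2 * n * r - n ^ 2 * k := by subst hk; linear_combination hm
  have hnZ : (n : ℤ) ≠ 0 := by exact_mod_cast hn
  have hn0 : (n : K) ≠ 0 := by exact_mod_cast hn
  rw [Int.mul_ediv_cancel_left _ (pow_ne_zero 2 hnZ)] at hu
  obtain ⟨α, β, hαβ⟩ := hu
  have hαβK : (α : K) * (r ^ 2 - a' * c) + β * n = 1 := by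
    exact_mod_cast congrArg (Int.cast : ℤ → K) hαβ
  obtain ⟨w, rfl⟩ : ∃ w, ω = n * w := ⟨ω / n, by field_simp⟩
  have h1 : w * θ = -(n * a' * d) := by
    have := h.mul_eq
    push_cast at this
    apply mul_left_cancel₀ hn0
    linear_combination this
  have h2 : w ^ 2 = -(a' * c) - (2 * r - n * k) * w + a' * θ := by
    have := h.sq_left
    push_cast at this
    apply mul_left_cancel₀ (pow_ne_zero 2 hn0)
    linear_combination this
  have h3 : θ ^ 2 = -((2 * n * r - n ^ 2 * k) * d) - d * (n * w) + c * θ := by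
    have := h.sq_right
    push_cast at this
    linear_combination this
  have hmem : ∀ v, v ∈ torsionLattice n r (n * w) θ ↔
      ∃ x y z : ℤ, v = x * n + y * (w + r) + z * θ := by
    intro v
    rw [mem_torsionLattice, mul_div_cancel_left₀ _ hn0]
  constructor
  · apply le_antisymm
    · rw [Submodule.mul_le]
      intro v hv v' hv'
      rw [hmem] at hv hv'
      obtain ⟨x, y, z, rfl⟩ := hv
      obtain ⟨x', y', z', rfl⟩ := hv'
      rw [mem_cubicLattice]
      refine ⟨x * x' * n ^ 2 + (x * y' + y * x') * (n * r) + y * y' * (r ^ 2 - a' * c)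
        - (y * z' + z * y') * (n * a' * d) - z * z' * (2 * n * r - n ^ 2 * k) * d,
        x * y' + y * x' + y * y' * k - z * z' * d,
        (x * z' + z * x') * n + y * y' * a' + (y * z' + z * y') * r + z * z' * c, ?_⟩
      push_cast
      linear_combination (y * y' : K) * h2 + (y * z' + z * y' : K) * h1 + (z * z' : K) * h3
    · set M := torsionLattice n r (n * w) θ * torsionLattice n r (n * w) θ with hM
      have i1 : (n : K) ∈ torsionLattice n r (n * w) θ := (hmem _).2 ⟨1, 0, 0, by simp⟩
      have i2 : w + r ∈ torsionLattice n r (n * w) θ := (hmem _).2 ⟨0, 1, 0, by simp⟩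
      have i3 : θ ∈ torsionLattice n r (n * w) θ := (hmem _).2 ⟨0, 0, 1, by simp⟩
      have m11 : (n : K) * n ∈ M := Submodule.mul_mem_mul i1 i1
      have m12 : (n : K) * (w + r) ∈ M := Submodule.mul_mem_mul i1 i2
      have m13 : (n : K) * θ ∈ M := Submodule.mul_mem_mul i1 i3
      have m22 : (w + r) * (w + r) ∈ M := Submodule.mul_mem_mul i2 i2
      have m23 : (w + r) * θ ∈ M := Submodule.mul_mem_mul i2 i3
      have m33 : θ * θ ∈ M := Submodule.mul_mem_mul i3 i3
      have smul_mem : ∀ (k : ℤ) {v : K}, v ∈ M → (k : K) * v ∈ M := fun k v hv => by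
        simpa [zsmul_eq_mul] using M.smul_mem k hv
      have hθ : θ ∈ M := by
        have e : θ = (α * r : ℤ) * ((w + r) * θ) + (-(α * a') : ℤ) * (θ * θ) +
            (-(α * a' * d) : ℤ) * (n * (w + r)) + (α * a' * d * k : ℤ) * ((n : K) * n)
            + (β : ℤ) * (n * θ) := by
          push_cast
          linear_combination -θ * hαβK - (α * r : K) * h1 + (α * a' : K) * h3
        rw [e]
        exact M.add_mem (M.add_mem (M.add_mem (M.add_mem (smul_mem _ m23) (smul_mem _ m33))
          (smul_mem _ m12)) (smul_mem _ m11)) (smul_mem _ m13)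
      have he : ((r ^ 2 - a' * c - k * n * r : ℤ) : K) ∈ M := by
        have e : ((r ^ 2 - a' * c - k * n * r : ℤ) : K) = (w + r) * (w + r) +
            (-k : ℤ) * (n * (w + r)) + (-a' : ℤ) * θ := by
          push_cast
          linear_combination -h2
        rw [e]
        exact M.add_mem (M.add_mem m22 (smul_mem _ m12)) (smul_mem _ hθ)
      have hone : (1 : K) ∈ M := by
        have e : (1 : K) = (2 * α - α ^ 2 * (r ^ 2 - a' * c - k * n * r) : ℤ) *
            ((r ^ 2 - a' * c - k * n * r : ℤ) : K) + ((α * k * r + β) ^ 2 : ℤ) * ((n : K) * n) := by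
          push_cast
          have : (1 : K) - α * (r ^ 2 - a' * c - k * n * r) = (α * k * r + β) * n := by
            linear_combination -hαβK
          linear_combination (1 - α * (r ^ 2 - a' * c - k * n * r) + (α * k * r + β) * n) * this
        rw [e]
        exact M.add_mem (smul_mem _ he) (smul_mem _ m11)
      have hω : (n : K) * w ∈ M := by
        have e : (n : K) * w = n * (w + r) + (-(n * r) : ℤ) * 1 := by push_cast; ring
        rw [e]
        exact M.add_mem m12 (smul_mem _ hone)
      rw [cubicLattice, Submodule.span_le]
      rintro v (rfl | rfl | rfl)
      exacts [hone, hω, hθ]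
  · rw [Submodule.mul_le]
    intro v hv v' hv'
    rw [mem_cubicLattice] at hv
    rw [hmem] at hv' ⊢
    obtain ⟨x, y, z, rfl⟩ := hv
    obtain ⟨x', y', z', rfl⟩ := hv'
    refine ⟨x * x' - y * x' * n * r + y * y' * (r ^ 2 - a' * c) - y * y' * k * n * r
        - y * z' * n * a' * d
        - z * y' * a' * d
        + z * z' * (-(2 * r - n * k) * d + d * r),
      x * y' + y * x' * n ^ 2 + y * y' * (k * n ^ 2 - n * r) - z * z' * d * n,
      x * z' + y * y' * n * a' + z * x' * n + z * y' * r + z * z' * c, ?_⟩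
    push_cast
    linear_combination (y * y' * n : K) * h2 + (y * z' * n + z * y' : K) * h1 + (z * z' : K) * h3

end Lattice

section Lattice

variable {K : Type*} [Field K]

theorem IsCubicBasis.ext_iff {ω θ : K} {a b c d : ℤ} (h : IsCubicBasis ω θ a b c d)
    {x y z x' y' z' : ℤ} :
    (x : K) + y * ω + z * θ = x' + y' * ω + z' * θ ↔ x = x' ∧ y = y' ∧ z = z' := by
  constructor
  · intro hx
    have := h.indep (x - x') (y - y') (z - z') (by push_cast; linear_combination hx)
    omega
  · rintro ⟨rfl, rfl, rfl⟩
    rfl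

theorem mem_torsionLattice' [CharZero K] {n : ℕ} (hn : n ≠ 0) {r : ℤ} {ω θ : K} {v : K} :
    v ∈ torsionLattice n r ω θ ↔
      ∃ x y z : ℤ, n * v = ((x * n ^ 2 + y * (n * r) : ℤ) : K) + y * ω + ((z * n : ℤ) : K) * θ := by
  have hn0 : (n : K) ≠ 0 := by exact_mod_cast hn
  rw [mem_torsionLattice]
  refine exists_congr fun x => exists_congr fun y => exists_congr fun z => ?_
  rw [← mul_right_inj' hn0]
  have : (n : K) * (x * n + y * (ω / n + r) + z * θ) =
      ((x * n ^ 2 + y * (n * r) : ℤ) : K) + y * ω + ((z * n : ℤ) : K) * θ := by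
    push_cast
    field_simp
    ring
  rw [this]

theorem intCast_mem_torsionLattice [CharZero K] {ω θ : K} {a b c d : ℤ}
    (h : IsCubicBasis ω θ a b c d) {n : ℕ} (hn : n ≠ 0) {r m : ℤ} :
    (m : K) ∈ torsionLattice n r ω θ ↔ (n : ℤ) ∣ m := by
  rw [mem_torsionLattice' hn]
  have hnZ : (n : ℤ) ≠ 0 := by exact_mod_cast hn
  constructor
  · rintro ⟨x, y, z, hx⟩
    have := (h.ext_iff (x := n * m) (y := 0) (z := 0) (x' := x * n ^ 2 + y * (n * r))
      (y' := y) (z' := z * n)).1 (by push_cast at hx ⊢; linear_combination hx)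
    obtain ⟨e1, e2, e3⟩ := this
    subst e2
    exact ⟨x, mul_left_cancel₀ hnZ (by linear_combination e1)⟩
  · rintro ⟨x, rfl⟩
    exact ⟨x, 0, 0, by push_cast; ring⟩

theorem torsionLattice_injective [CharZero K] {ω θ : K} {a b c d : ℤ}
    (h : IsCubicBasis ω θ a b c d) {n n' : ℕ} (hn : n ≠ 0) (hn' : n' ≠ 0)
    {p q r s t i j p' q' r' s' t' i' j' a₁ b₁ c₁ d₁ a₂ b₂ c₂ d₂ : ℤ}
    (hdet : p * s - q * r = 1)
    (hb : IsCubicBasis (p * ω + q * θ + (i : K)) (r * ω + s * θ + (j : K)) a₁ b₁ c₁ d₁)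
    (hb' : IsCubicBasis (p' * ω + q' * θ + (i' : K)) (r' * ω + s' * θ + (j' : K)) a₂ b₂ c₂ d₂)
    (hI : torsionLattice n t (p * ω + q * θ + (i : K)) (r * ω + s * θ + (j : K)) =
      torsionLattice n' t' (p' * ω + q' * θ + (i' : K)) (r' * ω + s' * θ + (j' : K))) :
    n = n' ∧ (n : ℤ) ∣ p * q' - q * p' := by
  have hnn : n = n' := by
    apply Nat.dvd_antisymm
    · rw [← Int.natCast_dvd_natCast, ← intCast_mem_torsionLattice hb hn (r := t), hI,
        intCast_mem_torsionLattice hb' hn']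
    · rw [← Int.natCast_dvd_natCast, ← intCast_mem_torsionLattice hb' hn' (r := t'), ← hI,
        intCast_mem_torsionLattice hb hn]
  refine ⟨hnn, ?_⟩
  subst hnn
  have hn0 : (n : K) ≠ 0 := by exact_mod_cast hn
  have hmem : (p' * ω + q' * θ + (i' : K)) / n + t' ∈
      torsionLattice n t (p * ω + q * θ + (i : K)) (r * ω + s * θ + (j : K)) := by
    rw [hI, mem_torsionLattice]
    exact ⟨0, 1, 0, by simp⟩
  rw [mem_torsionLattice' hn] at hmem
  obtain ⟨x, y, z, hx⟩ := hmem
  rw [mul_add, mul_div_cancel₀ _ hn0] at hx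
  obtain ⟨-, e2, e3⟩ := (h.ext_iff (x := i' + n * t') (y := p') (z := q')
    (x' := x * n ^ 2 + y * (n * t) + y * i + z * n * j)
    (y' := y * p + z * n * r) (z' := y * q + z * n * s)).1 (by
      push_cast at hx ⊢; linear_combination hx)
  exact ⟨z, by linear_combination p * e3 - q * e2 + z * n * hdet⟩

theorem torsionLattice_shift_injective [CharZero K] {ω θ : K} {a b c d : ℤ}
    (h : IsCubicBasis ω θ a b c d) {n : ℕ} (hn : n ≠ 0) {r r' : ℤ}
    (hI : torsionLattice n r ω θ = torsionLattice n r' ω θ) : (n : ℤ) ∣ r - r' := by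
  have h1 : ω / n + r ∈ torsionLattice n r' ω θ := by
    rw [← hI, mem_torsionLattice]
    exact ⟨0, 1, 0, by simp⟩
  have h2 : ω / n + r' ∈ torsionLattice n r' ω θ := by
    rw [mem_torsionLattice]
    exact ⟨0, 1, 0, by simp⟩
  rw [← intCast_mem_torsionLattice h hn (r := r')]
  convert Submodule.sub_mem _ h1 h2 using 1
  push_cast
  ring

/-- Coprime to `n` follows from the absence of common prime factors. -/
theorem isCoprime_of_forall_prime {u : ℤ} {n : ℕ}
    (h : ∀ p : ℕ, p.Prime → p ∣ n → ¬ (p : ℤ) ∣ u) : IsCoprime u (n : ℤ) := by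
  rw [Int.isCoprime_iff_gcd_eq_one, Int.gcd]
  by_contra hne
  obtain ⟨p, hp, hpd⟩ := Nat.exists_prime_and_dvd hne
  exact h p hp (by simpa using hpd.trans (Nat.gcd_dvd_right _ _))
    (Int.natCast_dvd.2 (hpd.trans (Nat.gcd_dvd_left _ _)))

theorem exists_eq_torsionLattice_of_mem [CharZero K] {ω θ : K} {a b c d : ℤ}
    (h : IsCubicBasis ω θ a b c d) {I : Submodule ℤ K}
    (hI : IsTwoTorsionLattice (cubicLattice ω θ) I) {n : ℕ} (hn : n ≠ 0)
    (hmem : ∀ m : ℤ, (m : K) ∈ I ↔ (n : ℤ) ∣ m) {t : ℤ} (ht : (ω + t) / n ∈ I) :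
    ∃ r : ℤ, TorsionCond n r (a, b, c, d) ∧ I = torsionLattice n r ω θ := by
  have hn0 : (n : K) ≠ 0 := by exact_mod_cast hn
  have hnZ : (n : ℤ) ≠ 0 := by exact_mod_cast hn
  obtain ⟨hsq, hmul⟩ := hI
  have prod : ∀ {v w : K}, v ∈ I → w ∈ I → ∃ x y z : ℤ, v * w = x + y * ω + z * θ := by
    intro v w hv hw
    rw [← mem_cubicLattice, ← hsq]
    exact Submodule.mul_mem_mul hv hw
  have hn_mem : (n : K) ∈ I := by simpa using (hmem n).2 dvd_rfl
  have zmul : ∀ (k : ℤ) {v : K}, v ∈ I → (k : K) * v ∈ I := fun k v hv => by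
    simpa [zsmul_eq_mul] using I.smul_mem k hv
  have ωmul : ∀ {v : K}, v ∈ I → ω * v ∈ I := fun {v} hv =>
    hmul (Submodule.mul_mem_mul (mem_cubicLattice.2 ⟨0, 1, 0, by simp⟩) hv)
  have θmul : ∀ {v : K}, v ∈ I → θ * v ∈ I := fun {v} hv =>
    hmul (Submodule.mul_mem_mul (mem_cubicLattice.2 ⟨0, 0, 1, by simp⟩) hv)
  -- squares of `ω + t`
  obtain ⟨a', k', u', ha, hk', hu'⟩ : ∃ a' k' u' : ℤ, a = n ^ 2 * a' ∧ 2 * t - b = n ^ 2 * k' ∧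
      t ^ 2 - a * c = n ^ 2 * u' := by
    obtain ⟨x, y, z, hx⟩ := prod ht ht
    have := (h.ext_iff (x := t ^ 2 - a * c) (y := 2 * t - b) (z := a) (x' := n ^ 2 * x)
      (y' := n ^ 2 * y) (z' := n ^ 2 * z)).1 (by
        field_simp at hx
        push_cast
        linear_combination hx - h.sq_left)
    exact ⟨z, y, x, this.2.2, this.2.1, this.1⟩
  obtain ⟨r, rfl⟩ : (n : ℤ) ∣ t := by
    rw [← Int.pow_dvd_pow_iff two_ne_zero]
    exact ⟨u' + a' * c, by linear_combination hu' + c * ha⟩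
  subst ha
  have hu : u' = r ^ 2 - a' * c := by
    apply mul_left_cancel₀ (pow_ne_zero 2 hnZ)
    linear_combination -hu'
  subst hu
  obtain rfl : b = 2 * n * r - n ^ 2 * k' := by linear_combination -hk'
  have ht' : ω / n + r ∈ I := by
    convert ht using 1
    push_cast
    field_simp
  clear ht hk' hu'
  -- the multiples of `θ`
  let E : Ideal ℤ :=
    { carrier := {e | ∃ x : ℤ, (x + e * θ) / n ∈ I}
      add_mem' := by
        rintro e e' ⟨x, hx⟩ ⟨x', hx'⟩
        exact ⟨x + x', by convert I.add_mem hx hx' using 1; push_cast; ring⟩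
      zero_mem' := ⟨0, by simp⟩
      smul_mem' := by
        rintro k e ⟨x, hx⟩
        exact ⟨k * x, by convert zmul k hx using 1; simp; ring⟩ }
  obtain ⟨e, he⟩ := (IsPrincipalIdealRing.principal E).principal
  have hEdvd : ∀ {e' x : ℤ}, (x + e' * θ) / n ∈ I → e ∣ e' := by
    intro e' x hx
    rw [← Ideal.mem_span_singleton]
    change e' ∈ Submodule.span ℤ {e}
    rw [← he]
    exact ⟨x, hx⟩
  obtain ⟨t₂, ht₂⟩ : e ∈ E := by rw [he]; exact Submodule.mem_span_singleton_self e
  have he2 : e ∣ (n : ℤ) ^ 2 := hEdvd (x := 0) (by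
    convert θmul hn_mem using 1
    push_cast
    field_simp
    ring)
  obtain ⟨w, rfl⟩ : ∃ w, ω = n * w := ⟨ω / n, by field_simp⟩
  rw [mul_div_cancel_left₀ _ hn0] at ht'
  have h1 : w * θ = -(n * a' * d) := by
    have := h.mul_eq
    push_cast at this
    apply mul_left_cancel₀ hn0
    linear_combination this
  have h2 : w ^ 2 = -(a' * c) - (2 * r - n * k') * w + a' * θ := by
    have := h.sq_left
    push_cast at this
    apply mul_left_cancel₀ (pow_ne_zero 2 hn0)
    linear_combination this
  have h3 : θ ^ 2 = -((2 * n * r - n ^ 2 * k') * d) - d * (n * w) + c * θ := by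
    have := h.sq_right
    push_cast at this
    linear_combination this
  obtain ⟨⟨t₃, rfl⟩, ⟨g, hg⟩⟩ : (n : ℤ) ^ 2 ∣ t₂ ∧ (n : ℤ) ^ 2 ∣ n * r * e := by
    obtain ⟨x, y, z, hx⟩ := prod ht' ht₂
    have := (h.ext_iff (x := -n^2 * e * a' * d + n * r * t₂) (y := t₂) (z := n * r * e)
      (x' := n ^ 2 * x) (y' := n ^ 2 * y) (z' := n ^ 2 * z)).1 (by
        field_simp at hx
        push_cast
        linear_combination n * hx - n * e * h1)
    exact ⟨⟨_, this.2.1⟩, ⟨_, this.2.2⟩⟩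
  have heθ : e * θ / n ∈ I := by
    convert I.sub_mem ht₂ (zmul t₃ hn_mem) using 1
    push_cast
    field_simp
    ring
  obtain ⟨⟨d', hd'⟩, ⟨c', hc'⟩⟩ : (n : ℤ) ^ 2 ∣ e ^ 2 * d ∧ (n : ℤ) ^ 2 ∣ e ^ 2 * c := by
    obtain ⟨x, y, z, hx⟩ := prod heθ heθ
    have := (h.ext_iff (x := -e ^ 2 * (2 * n * r - n ^ 2 * k') * d) (y := -e ^ 2 * d)
      (z := e ^ 2 * c) (x' := n ^ 2 * x) (y' := n ^ 2 * y) (z' := n ^ 2 * z)).1 (by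
        field_simp at hx
        push_cast
        linear_combination hx - e ^ 2 * h3)
    exact ⟨⟨-y, by linear_combination -this.2.1⟩, ⟨_, this.2.2⟩⟩
  clear ht₂
  -- description of `I`
  have hImem : ∀ {v : K}, v ∈ I → ∃ x y z : ℤ, v = x * n + y * (w + r) + z * (e * θ / n) := by
    intro v hv
    obtain ⟨x, y, z, hx⟩ := prod hv hn_mem
    have h5 : ((x - n * r * y : ℤ) + z * θ) / n ∈ I := by
      convert I.sub_mem hv (zmul y ht') using 1
      push_cast
      field_simp
      linear_combination -hx
    obtain ⟨z', rfl⟩ := hEdvd h5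
    have h6 : ((x - n * r * y : ℤ) : K) / n ∈ I := by
      convert I.sub_mem h5 (zmul z' heθ) using 1
      push_cast
      field_simp
      ring
    obtain ⟨x₁, y₁, z₁, hx₁⟩ := prod h6 hn_mem
    obtain ⟨x₂, y₂, z₂, hx₂⟩ := prod h6 h6
    have h7 := (h.ext_iff (x := (x - n * r * y) ^ 2) (y := 0) (z := 0)
      (x' := n ^ 2 * x₂) (y' := n ^ 2 * y₂) (z' := n ^ 2 * z₂)).1 (by
        field_simp at hx₂
        push_cast at hx₂ ⊢
        linear_combination hx₂)
    obtain ⟨m, hm⟩ : (n : ℤ) ∣ x - n * r * y := by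
      rw [← Int.pow_dvd_pow_iff two_ne_zero]
      exact ⟨x₂, h7.1⟩
    have h8 : (m : K) ∈ I := by
      convert h6 using 1
      rw [hm]
      push_cast
      field_simp
    obtain ⟨m', rfl⟩ := (hmem m).1 h8
    refine ⟨m', y, z', ?_⟩
    have hm' : (x : K) - n * r * y = n * (n * m') := by
      exact_mod_cast congrArg (Int.cast : ℤ → K) hm
    push_cast at hx
    field_simp
    linear_combination hx + hm'
  have functional : ∀ A B P : ℤ, P ∣ n → P ∣ B * e → P ∣ A * (r ^ 2 - a' * c) + B * a' →
      P ∣ -A * e * a' * d + B * g → P ∣ B * c' → ∀ x y z : ℤ, P ∣ A * x + B * z := by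
    intro A B P hP1 hP2 hP3 hP4 hP5
    have hreg : (r : K) * e = n * g := by
      have : r * e = n * g := mul_left_cancel₀ hnZ (by linear_combination hg)
      exact_mod_cast congrArg (Int.cast : ℤ → K) this
    have hdK : (e : K) ^ 2 * d = n ^ 2 * d' := by
      exact_mod_cast congrArg (Int.cast : ℤ → K) hd'
    have hcK : (e : K) ^ 2 * c = n ^ 2 * c' := by
      exact_mod_cast congrArg (Int.cast : ℤ → K) hc'
    let S : Submodule ℤ K :=
      { carrier := {v | ∃ x y z : ℤ, v = x + y * (n * w) + z * θ ∧ P ∣ A * x + B * z}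
        add_mem' := by
          rintro v v' ⟨x, y, z, rfl, hv⟩ ⟨x', y', z', rfl, hv'⟩
          refine ⟨x + x', y + y', z + z', by push_cast; ring, ?_⟩
          exact (dvd_add hv hv').trans (dvd_of_eq (by ring))
        zero_mem' := ⟨0, 0, 0, by simp⟩
        smul_mem' := by
          rintro k v ⟨x, y, z, rfl, hv⟩
          refine ⟨k * x, k * y, k * z, by push_cast [zsmul_eq_mul]; ring, ?_⟩
          exact (hv.mul_left k).trans (dvd_of_eq (by ring)) }
    have hS : I * I ≤ S := by
      rw [Submodule.mul_le]
      intro v hv v' hv'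
      obtain ⟨x, y, z, rfl⟩ := hImem hv
      obtain ⟨x', y', z', rfl⟩ := hImem hv'
      refine ⟨x * x' * n ^ 2 + (x * y' + y * x') * (n * r) + y * y' * (r ^ 2 - a' * c)
        - (y * z' + z * y') * (e * a' * d) - z * z' * d' * (2 * n * r - n ^ 2 * k'),
        x * y' + y * x' + y * y' * k' - z * z' * d',
        (x * z' + z * x') * e + y * y' * a' + (y * z' + z * y') * g + z * z' * c', ?_, ?_⟩
      · push_cast
        field_simp
        linear_combination (y * y' * n ^ 2 : K) * h2 + ((y * z' + z * y') * n * e : K) * h1 +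
          (z * z' * e ^ 2 : K) * h3 + ((y * z' + z * y') * n * θ : K) * hreg
          - (z * z' * (2 * n * r - n ^ 2 * k') + z * z' * n * w : K) * hdK
          + (z * z' * θ : K) * hcK
      · obtain ⟨n₁, hn₁⟩ := hP1
        have e1 : P ∣ A * (x * x' * n ^ 2 + (x * y' + y * x') * (n * r) -
            z * z' * d' * (2 * n * r - n ^ 2 * k')) :=
          ⟨A * n₁ * (x * x' * n + (x * y' + y * x') * r - z * z' * d' * (2 * r - n * k')), by
            linear_combination (A * (x * x' * n + (x * y' + y * x') * r -
              z * z' * d' * (2 * r - n * k'))) * hn₁⟩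
        refine (dvd_add (dvd_add (dvd_add (dvd_add e1 (hP2.mul_left (x * z' + z * x')))
          (hP3.mul_left (y * y'))) (hP4.mul_left (y * z' + z * y')))
          (hP5.mul_left (z * z'))).trans (dvd_of_eq ?_)
        ring
    intro x y z
    have hx : (x : K) + y * (n * w) + z * θ ∈ I * I := by
      rw [hsq, mem_cubicLattice]
      exact ⟨x, y, z, rfl⟩
    obtain ⟨x', y', z', hv, hP⟩ := hS hx
    obtain ⟨rfl, rfl, rfl⟩ := h.ext_iff.1 hv
    exact hP
  have hu : IsCoprime (r ^ 2 - a' * c) (n : ℤ) := by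
    refine isCoprime_of_forall_prime fun p hp hpn hpu => ?_
    have hpZ : Prime (p : ℤ) := Nat.prime_iff_prime_int.1 hp
    have hpn' : (p : ℤ) ∣ n := Int.natCast_dvd_natCast.2 hpn
    have hed : (p : ℤ) ∣ e * d := by
      have : (p : ℤ) ∣ e ^ 2 * d := hd' ▸ (hpn'.trans (dvd_pow_self _ two_ne_zero)).mul_right _
      rcases hpZ.dvd_or_dvd this with h | h
      · exact (hpZ.dvd_of_dvd_pow h).mul_right _
      · exact h.mul_left _
    have := functional 1 0 p hpn' (by simp) (by simpa using hpu) (by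
      exact (hed.mul_left (-a')).trans (dvd_of_eq (by ring))) (by simp) 1 0 0
    simp only [mul_one, mul_zero, add_zero] at this
    exact hpZ.not_dvd_one this
  have hne : (n : ℤ) ∣ e := by
    rw [← Int.pow_dvd_pow_iff two_ne_zero]
    have h5 : (n : ℤ) ^ 2 ∣ e ^ 2 * (r ^ 2 - a' * c) := by
      have : r * e = n * g := mul_left_cancel₀ hnZ (by linear_combination hg)
      exact ⟨g ^ 2 - a' * c', by linear_combination (r * e + n * g) * this - a' * hc'⟩
    exact (hu.symm.pow_left).dvd_of_dvd_mul_right h5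
  obtain ⟨e', rfl⟩ := hne
  have he' : IsUnit e' := by
    by_contra hnu
    have he'0 : e' ≠ 0 := by
      rintro rfl
      simp only [mul_zero, zero_dvd_iff] at he2
      exact pow_ne_zero 2 hnZ he2
    obtain ⟨p, hp, hpe⟩ := Nat.exists_prime_and_dvd (n := e'.natAbs)
      (fun h => hnu (Int.isUnit_iff_natAbs_eq.2 h))
    have hpe' : (p : ℤ) ∣ e' := Int.natCast_dvd.2 hpe
    have hpn : (p : ℤ) ∣ n := by
      have : (n : ℤ) * e' ∣ n * n := by rw [← sq]; exact he2
      exact hpe'.trans ((mul_dvd_mul_iff_left hnZ).1 this)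
    have hpZ : Prime (p : ℤ) := Nat.prime_iff_prime_int.1 hp
    have hg' : g = r * e' := by
      apply mul_left_cancel₀ (pow_ne_zero 2 hnZ)
      linear_combination -hg
    have hc'' : c' = e' ^ 2 * c := by
      apply mul_left_cancel₀ (pow_ne_zero 2 hnZ)
      linear_combination -hc'
    have := functional a' (-(r ^ 2 - a' * c)) p hpn
      (by exact (hpe'.mul_left _).mul_left _) (by ring_nf; simp)
      (by
        rw [hg']
        exact (hpe'.mul_left (-a' * n * a' * d - (r ^ 2 - a' * c) * r)).trans (dvd_of_eq (by ring)))
      (by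
        rw [hc'']
        exact (hpe'.mul_left (-(r ^ 2 - a' * c) * e' * c)).trans (dvd_of_eq (by ring))) 0 0 1
    obtain ⟨α, β, hαβ⟩ := hu
    apply hpZ.not_dvd_one
    rw [← hαβ]
    refine dvd_add (Dvd.dvd.mul_left ?_ _) (hpn.mul_left _)
    rw [← dvd_neg]
    simpa using this
  refine ⟨r, ⟨dvd_mul_right _ _, ⟨-k', by ring⟩, ?_⟩, ?_⟩
  · simp only
    rwa [Int.mul_ediv_cancel_left _ (pow_ne_zero 2 hnZ)]
  · have hθI : θ ∈ I := by
      rcases Int.isUnit_iff.1 he' with rfl | rfl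
      · convert heθ using 1
        push_cast
        field_simp
      · convert I.neg_mem heθ using 1
        push_cast
        field_simp
    apply le_antisymm
    · intro v hv
      rw [mem_torsionLattice, mul_div_cancel_left₀ _ hn0]
      obtain ⟨x, y, z, rfl⟩ := hImem hv
      exact ⟨x, y, z * e', by push_cast; field_simp⟩
    · intro v hv
      rw [mem_torsionLattice, mul_div_cancel_left₀ _ hn0] at hv
      obtain ⟨x, y, z, rfl⟩ := hv
      exact I.add_mem (I.add_mem (zmul x hn_mem) (zmul y ht')) (zmul z hθI)

end Lattice

theorem exists_isCoprime_add_mul {α β δ : ℤ} (hα : α ≠ 0)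
    (h : ∀ p : ℕ, p.Prime → (p : ℤ) ∣ α → (p : ℤ) ∣ β → ¬ (p : ℤ) ∣ δ) :
    ∃ k : ℤ, IsCoprime α (β + k * δ) := by
  classical
  refine ⟨∏ p ∈ α.natAbs.primeFactors.filter (fun p : ℕ => ¬ (p : ℤ) ∣ β), (p : ℤ), ?_⟩
  rw [Int.isCoprime_iff_gcd_eq_one, Int.gcd]
  by_contra hne
  obtain ⟨p, hp, hpd⟩ := Nat.exists_prime_and_dvd hne
  have hpZ : Prime (p : ℤ) := Nat.prime_iff_prime_int.1 hp
  have h1 : (p : ℤ) ∣ α := Int.natCast_dvd.2 (hpd.trans (Nat.gcd_dvd_left _ _))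
  have h2 := Int.natCast_dvd.2 (hpd.trans (Nat.gcd_dvd_right _ _))
  by_cases hβ : (p : ℤ) ∣ β
  · rcases hpZ.dvd_or_dvd ((dvd_add_right hβ).1 h2) with h3 | h3
    · obtain ⟨q, hq, hpq⟩ := (hpZ.dvd_finsetProd_iff _).1 h3
      simp only [Finset.mem_filter, Nat.mem_primeFactors] at hq
      have : p = q := (Nat.prime_dvd_prime_iff_eq hp hq.1.1).1 (Int.natCast_dvd_natCast.1 hpq)
      subst this
      exact hq.2 hβ
    · exact h p hp h1 hβ h3
  · apply hβ
    refine (dvd_add_left (Dvd.dvd.mul_right (Finset.dvd_prod_of_mem _ ?_) _)).1 h2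
    simp only [Finset.mem_filter, Nat.mem_primeFactors]
    exact ⟨⟨hp, Int.natCast_dvd.1 h1, by simpa using hα⟩, hβ⟩

section Lattice

variable {K : Type*} [Field K]

theorem IsTwoTorsionLattice.exists_intCast_mem {R I : Submodule ℤ K}
    (hI : IsTwoTorsionLattice R I) (h1 : (1 : K) ∈ R)
    (hfrac : ∀ v : K, ∃ D : ℤ, D ≠ 0 ∧ (D : K) * v ∈ R) : ∃ D : ℤ, D ≠ 0 ∧ (D : K) ∈ I := by
  have key : ∀ v ∈ I * I, ∃ D : ℤ, D ≠ 0 ∧ (D : K) * v ∈ I := by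
    intro v hv
    induction hv using Submodule.mul_induction_on' with
    | mem_mul_mem v hv w hw =>
      obtain ⟨D, hD, hDv⟩ := hfrac v
      refine ⟨D, hD, ?_⟩
      rw [← mul_assoc]
      exact hI.2 (Submodule.mul_mem_mul hDv hw)
    | add v _ w _ ihv ihw =>
      obtain ⟨D, hD, hDv⟩ := ihv
      obtain ⟨D', hD', hDw⟩ := ihw
      refine ⟨D * D', mul_ne_zero hD hD', ?_⟩
      convert I.add_mem (I.smul_mem D' hDv) (I.smul_mem D hDw) using 1
      simp only [zsmul_eq_mul]
      push_cast
      ring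
  rw [← hI.1] at h1
  simpa using key 1 h1

theorem exists_eq_torsionLattice [CharZero K] {ω θ : K} {a b c d : ℤ}
    (h : IsCubicBasis ω θ a b c d)
    (hfrac : ∀ v : K, ∃ D : ℤ, D ≠ 0 ∧ (D : K) * v ∈ cubicLattice ω θ) {I : Submodule ℤ K}
    (hI : IsTwoTorsionLattice (cubicLattice ω θ) I) :
    ∃ n : ℕ, n ≠ 0 ∧ ∃ p q : ℤ, IsCoprime p q ∧ ∀ p' q' r' s' : ℤ, p' * s' - q' * r' = 1 →
      (n : ℤ) ∣ p * q' - q * p' → ∃ t : ℤ, TorsionCond n t (formAct p' q' r' s' (a, b, c, d)) ∧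
        I = torsionLattice n t (p' * ω + q' * θ + (shiftFst p' q' r' s' (a, b, c, d) : ℤ))
          (r' * ω + s' * θ + (shiftSnd p' q' r' s' (a, b, c, d) : ℤ)) := by
  have hone : (1 : K) ∈ cubicLattice ω θ := mem_cubicLattice.2 ⟨1, 0, 0, by simp⟩
  have zmul : ∀ (k : ℤ) {v : K}, v ∈ I → (k : K) * v ∈ I := fun k v hv => by
    simpa [zsmul_eq_mul] using I.smul_mem k hv
  obtain ⟨n, hn, hmem⟩ : ∃ n : ℕ, n ≠ 0 ∧ ∀ m : ℤ, (m : K) ∈ I ↔ (n : ℤ) ∣ m := by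
    let E : Ideal ℤ :=
      { carrier := {m | (m : K) ∈ I}
        add_mem' := fun {m m'} hm hm' => by
          simp only [Set.mem_ofPred_eq, Int.cast_add] at *
          exact I.add_mem hm hm'
        zero_mem' := by simp
        smul_mem' := fun k m hm => by
          simp only [Set.mem_ofPred_eq, smul_eq_mul, Int.cast_mul] at *
          exact zmul k hm }
    obtain ⟨e, he⟩ := (IsPrincipalIdealRing.principal E).principal
    have hE : ∀ m : ℤ, (m : K) ∈ I ↔ e ∣ m := by
      intro m
      rw [← Ideal.mem_span_singleton]
      change m ∈ E ↔ m ∈ Submodule.span ℤ {e}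
      rw [he]
    refine ⟨e.natAbs, ?_, fun m => by rw [hE, Int.natAbs_dvd]⟩
    obtain ⟨D, hD, hDI⟩ := hI.exists_intCast_mem hone hfrac
    rw [Int.natAbs_ne_zero]
    rintro rfl
    exact hD (zero_dvd_iff.1 ((hE D).1 hDI))
  have hn0 : (n : K) ≠ 0 := by exact_mod_cast hn
  have hnZ : (n : ℤ) ≠ 0 := by exact_mod_cast hn
  have hn_mem : (n : K) ∈ I := by simpa using (hmem n).2 dvd_rfl
  have prod : ∀ {v w : K}, v ∈ I → w ∈ I → ∃ x y z : ℤ, v * w = x + y * ω + z * θ := by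
    intro v w hv hw
    rw [← mem_cubicLattice, ← hI.1]
    exact Submodule.mul_mem_mul hv hw
  have hnot : ∀ p : ℕ, p.Prime → p ∣ n →
      ¬ ∀ x y z : ℤ, (x + y * ω + z * θ) / n ∈ I → (p : ℤ) ∣ y ∧ (p : ℤ) ∣ z := by
    intro p hp hpn hall
    have hpZ : Prime (p : ℤ) := Nat.prime_iff_prime_int.1 hp
    obtain ⟨m, rfl⟩ := hpn
    have hp0 : (p : K) ≠ 0 := by exact_mod_cast hp.ne_zero
    have key : ∀ v ∈ I, ∃ ρ ∈ cubicLattice ω θ, ((p * m : ℕ) : K) * v = p * ρ := by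
      intro v hv
      obtain ⟨x, y, z, hx⟩ := prod hn_mem hv
      have hv' : (x + y * ω + z * θ) / ((p * m : ℕ) : K) ∈ I := by
        rw [← hx, mul_div_cancel_left₀ _ hn0]
        exact hv
      obtain ⟨⟨y, rfl⟩, ⟨z, rfl⟩⟩ := hall x y z hv'
      obtain ⟨x₂, y₂, z₂, hx₂⟩ := prod hv hv
      have hsq : ((p * m : ℕ) : K) ^ 2 * (v * v) = (x + p * (y * ω + z * θ)) ^ 2 := by
        push_cast at hx ⊢
        linear_combination (p * m * v + (x + p * (y * ω + z * θ))) * hx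
      have := (h.ext_iff (x := x ^ 2 + p ^ 2 * (-y ^ 2 * a * c - 2 * y * z * a * d
          - z ^ 2 * b * d)) (y := 2 * p * x * y + p ^ 2 * (-y ^ 2 * b - z ^ 2 * d))
        (z := 2 * p * x * z + p ^ 2 * (y ^ 2 * a + z ^ 2 * c))
        (x' := (p * m) ^ 2 * x₂) (y' := (p * m) ^ 2 * y₂) (z' := (p * m) ^ 2 * z₂)).1 (by
          rw [hx₂] at hsq
          push_cast at hsq ⊢
          linear_combination -hsq - p ^ 2 * (y ^ 2 * h.sq_left + 2 * y * z * h.mul_eq +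
            z ^ 2 * h.sq_right))
      have hpx : (p : ℤ) ∣ x := by
        apply hpZ.dvd_of_dvd_pow (n := 2)
        refine ⟨p * m ^ 2 * x₂ - p * (-y ^ 2 * a * c - 2 * y * z * a * d - z ^ 2 * b * d), ?_⟩
        linear_combination this.1
      obtain ⟨x, rfl⟩ := hpx
      refine ⟨x + y * ω + z * θ, mem_cubicLattice.2 ⟨x, y, z, rfl⟩, ?_⟩
      rw [hx]
      push_cast
      ring
    let S : Submodule ℤ K :=
      { carrier := {v | m * v ∈ I}
        add_mem' := fun {v w} hv hw => by
          simp only [Set.mem_ofPred_eq, mul_add] at *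
          exact I.add_mem hv hw
        zero_mem' := by simp
        smul_mem' := fun k v hv => by
          simp only [Set.mem_ofPred_eq, zsmul_eq_mul, mul_left_comm (m : K)] at *
          exact zmul k hv }
    have hS : I * I ≤ S := by
      rw [Submodule.mul_le]
      intro v hv w hw
      obtain ⟨ρ, hρ, hv'⟩ := key v hv
      change (m : K) * (v * w) ∈ I
      have : (m : K) * v = ρ := by
        apply mul_left_cancel₀ hp0
        rw [← hv']
        push_cast
        ring
      rw [← mul_assoc, this]
      exact hI.2 (Submodule.mul_mem_mul hρ hw)
    have h1 : (m : K) * 1 ∈ I := hS (by rw [hI.1]; exact hone)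
    have h2 := (hmem m).1 (by simpa using h1)
    rw [Int.natCast_dvd_natCast] at h2
    have hm0 : 0 < m := Nat.pos_of_ne_zero (by rintro rfl; simp at hn)
    have := Nat.le_of_dvd hm0 h2
    have := hp.two_le
    nlinarith
  have hnω : ((n : ℤ) ^ 2 : ℤ) * ω / n ∈ I := by
    convert hI.2 (Submodule.mul_mem_mul (mem_cubicLattice.2 ⟨0, 1, 0, by simp⟩ :
      ω ∈ cubicLattice ω θ) hn_mem) using 1
    push_cast
    field_simp
  have hnθ : ((n : ℤ) ^ 2 : ℤ) * θ / n ∈ I := by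
    convert hI.2 (Submodule.mul_mem_mul (mem_cubicLattice.2 ⟨0, 0, 1, by simp⟩ :
      θ ∈ cubicLattice ω θ) hn_mem) using 1
    push_cast
    field_simp
  let E₁ : Ideal ℤ :=
    { carrier := {y | ∃ x z : ℤ, (x + y * ω + z * θ) / n ∈ I}
      add_mem' := by
        rintro y y' ⟨x, z, hx⟩ ⟨x', z', hx'⟩
        exact ⟨x + x', z + z', by convert I.add_mem hx hx' using 1; push_cast; ring⟩
      zero_mem' := ⟨0, 0, by simp⟩
      smul_mem' := by
        rintro k y ⟨x, z, hx⟩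
        exact ⟨k * x, k * z, by convert zmul k hx using 1; simp; ring⟩ }
  let E₂ : Ideal ℤ :=
    { carrier := {z | ∃ x : ℤ, (x + z * θ) / n ∈ I}
      add_mem' := by
        rintro z z' ⟨x, hx⟩ ⟨x', hx'⟩
        exact ⟨x + x', by convert I.add_mem hx hx' using 1; push_cast; ring⟩
      zero_mem' := ⟨0, by simp⟩
      smul_mem' := by
        rintro k z ⟨x, hx⟩
        exact ⟨k * x, by convert zmul k hx using 1; simp; ring⟩ }
  obtain ⟨α, hα⟩ := (IsPrincipalIdealRing.principal E₁).principal
  obtain ⟨δ, hδ⟩ := (IsPrincipalIdealRing.principal E₂).principal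
  have hα' : ∀ {x y z : ℤ}, (x + y * ω + z * θ) / n ∈ I → α ∣ y := by
    intro x y z hx
    rw [← Ideal.mem_span_singleton]
    change y ∈ Submodule.span ℤ {α}
    rw [← hα]
    exact ⟨x, z, hx⟩
  have hδ' : ∀ {x z : ℤ}, (x + z * θ) / n ∈ I → δ ∣ z := by
    intro x z hx
    rw [← Ideal.mem_span_singleton]
    change z ∈ Submodule.span ℤ {δ}
    rw [← hδ]
    exact ⟨x, hx⟩
  have hα0 : α ≠ 0 := by
    rintro rfl
    have := hα' (x := 0) (y := n ^ 2) (z := 0) (by simpa using hnω)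
    exact pow_ne_zero 2 hnZ (zero_dvd_iff.1 this)
  obtain ⟨x₁, β, hx₁⟩ : α ∈ E₁ := by rw [hα]; exact Submodule.mem_span_singleton_self α
  obtain ⟨x₂, hx₂⟩ : δ ∈ E₂ := by rw [hδ]; exact Submodule.mem_span_singleton_self δ
  obtain ⟨k, hk⟩ : ∃ k : ℤ, IsCoprime α (β + k * δ) := by
    refine exists_isCoprime_add_mul hα0 fun p hp hpα hpβ hpδ => ?_
    have hpZ : Prime (p : ℤ) := Nat.prime_iff_prime_int.1 hp
    have hpn : p ∣ n := by
      have : (p : ℤ) ∣ (n : ℤ) ^ 2 :=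
        hpα.trans (hα' (x := 0) (y := n ^ 2) (z := 0) (by simpa using hnω))
      exact Int.natCast_dvd_natCast.1 (hpZ.dvd_of_dvd_pow this)
    refine hnot p hp hpn fun x y z hx => ?_
    obtain ⟨m, rfl⟩ := hα' hx
    refine ⟨hpα.mul_right _, ?_⟩
    have : (((x - m * x₁ : ℤ) : K) + ((z - m * β : ℤ) : K) * θ) / n ∈ I := by
      convert I.sub_mem hx (zmul m hx₁) using 1
      push_cast
      ring
    have h4 := (hpδ.trans (hδ' this)).add (hpβ.mul_left m)
    simpa using h4
  refine ⟨n, hn, α, β + k * δ, hk, ?_⟩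
  set q := β + k * δ with hq
  have hv : ∃ t : ℤ, (t + α * ω + q * θ) / n ∈ I := by
    refine ⟨x₁ + k * x₂, ?_⟩
    convert I.add_mem hx₁ (zmul k hx₂) using 1
    rw [hq]
    push_cast
    ring
  clear_value q
  clear hx₁ hα hα' hα0 E₁ hδ hδ' hx₂ E₂ hnot hq
  obtain ⟨t, ht⟩ := hv
  obtain ⟨s, r', hsr⟩ := hk
  obtain ⟨r, rfl⟩ : ∃ r, r' = -r := ⟨-r', by simp⟩
  have hdet : α * s - q * r = 1 := by linear_combination hsr
  obtain ⟨t₁, -, hI₁⟩ := exists_eq_torsionLattice_of_mem (h.change hdet)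
    (I := I) (by rwa [cubicLattice_change _ _ hdet]) hn hmem
    (t := t - shiftFst α q r s (a, b, c, d)) (by
      convert ht using 1
      push_cast
      ring)
  intro p' q' r' s' hdet' hdvd
  obtain ⟨g, hg⟩ := hdvd
  have hdetK : (α : K) * s - q * r = 1 := by
    exact_mod_cast congrArg (Int.cast : ℤ → K) hdet
  have hgK : (α : K) * q' - q * p' = n * g := by
    exact_mod_cast congrArg (Int.cast : ℤ → K) hg
  have hθ₁ : (r * ω + s * θ + (shiftSnd α q r s (a, b, c, d) : ℤ)) ∈ I := by
    rw [hI₁, mem_torsionLattice]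
    exact ⟨0, 0, 1, by simp⟩
  have hmem' : ((p' * ω + q' * θ + (shiftFst p' q' r' s' (a, b, c, d) : ℤ)) +
      (((p' * s - q' * r) * t + g * n * shiftSnd α q r s (a, b, c, d)
        - shiftFst p' q' r' s' (a, b, c, d) : ℤ) : K)) / n ∈ I := by
    convert I.add_mem (zmul (p' * s - q' * r) ht) (zmul g hθ₁) using 1
    push_cast
    field_simp
    linear_combination -(p' * ω + q' * θ) * hdetK + (r * ω + s * θ) * hgK
  exact exists_eq_torsionLattice_of_mem (h.change hdet') (I := I)
    (by rwa [cubicLattice_change _ _ hdet']) hn hmem hmem'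

end Lattice

open scoped nonZeroDivisors

section DeloneFaddeev

theorem natDegree_cubicPolyQ {a b c d : ℤ} (ha : a ≠ 0) :
    (cubicPolyQ a b c d).natDegree = 3 := by
  rw [cubicPolyQ]
  compute_degree!

theorem IsIrredCubicForm.isCubicBasis {a b c d : ℤ} [Fact (Irreducible (cubicPolyQ a b c d))]
    (ha : a ≠ 0) :
    IsCubicBasis ((a : cubicField a b c d) * AdjoinRoot.root _)
      ((a : cubicField a b c d) * AdjoinRoot.root _ ^ 2 +
        (b : cubicField a b c d) * AdjoinRoot.root _ + (c : cubicField a b c d)) a b c d := by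
  set x : cubicField a b c d := AdjoinRoot.root _ with hx
  have hroot : (a : cubicField a b c d) * x ^ 3 + b * x ^ 2 + c * x + d = 0 := by
    have := AdjoinRoot.eval₂_root (cubicPolyQ a b c d)
    rw [hx]
    conv at this => lhs; arg 3; rw [cubicPolyQ]
    simp only [Polynomial.eval₂_add, Polynomial.eval₂_mul, Polynomial.eval₂_C,
      Polynomial.eval₂_X_pow, Polynomial.eval₂_X] at this
    simpa only [map_intCast] using this
  refine ⟨by linear_combination a * hroot, by ring,
    by linear_combination (a * x + b) * hroot, ?_⟩
  intro u v w h
  have hne : cubicPolyQ a b c d ≠ 0 := (Fact.out : Irreducible _).ne_zero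
  have hzero : (Polynomial.C (u + w * c : ℚ) + Polynomial.C (v * a + w * b : ℚ) * Polynomial.X +
      Polynomial.C (w * a : ℚ) * Polynomial.X ^ 2) = 0 := by
    apply Polynomial.eq_zero_of_dvd_of_natDegree_lt (p := cubicPolyQ a b c d)
    · rw [← AdjoinRoot.mk_eq_zero]
      have : AdjoinRoot.mk (cubicPolyQ a b c d) (Polynomial.C (u + w * c : ℚ) +
          Polynomial.C (v * a + w * b : ℚ) * Polynomial.X +
          Polynomial.C (w * a : ℚ) * Polynomial.X ^ 2) =
        (u : cubicField a b c d) + v * (a * x) + w * (a * x ^ 2 + b * x + c) := by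
        simp [hx]
        ring
      rw [this, h]
    · rw [natDegree_cubicPolyQ ha]
      apply Nat.lt_of_le_of_lt (m := 2) _ (by norm_num)
      compute_degree
  have h0 := congrArg (Polynomial.coeff · 0) hzero
  have h1 := congrArg (Polynomial.coeff · 1) hzero
  have h2 := congrArg (Polynomial.coeff · 2) hzero
  simp only [Polynomial.coeff_add, Polynomial.coeff_C_mul, Polynomial.coeff_C,
    Polynomial.coeff_X, Polynomial.coeff_X_pow, Polynomial.coeff_zero] at h0 h1 h2
  norm_num at h0 h1 h2
  have hw : w = 0 := by tauto
  subst hw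
  norm_num at h0 h1
  exact ⟨h0, by tauto, rfl⟩

theorem mem_DFring {a b c d : ℤ} [Fact (Irreducible (cubicPolyQ a b c d))]
    (ha : a ≠ 0) {v : cubicField a b c d} :
    v ∈ DFring a b c d ↔ v ∈ cubicLattice ((a : cubicField a b c d) * AdjoinRoot.root _)
      ((a : cubicField a b c d) * AdjoinRoot.root _ ^ 2 +
        (b : cubicField a b c d) * AdjoinRoot.root _ + (c : cubicField a b c d)) := by
  have h := IsIrredCubicForm.isCubicBasis (b := b) (c := c) (d := d) ha
  constructor
  · intro hv
    rw [DFring] at hv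
    induction hv using Subring.closure_induction with
    | mem v hv =>
      rw [mem_cubicLattice]
      rcases hv with rfl | rfl
      · exact ⟨0, 1, 0, by simp⟩
      · exact ⟨-c, 0, 1, by push_cast; ring⟩
    | zero => exact Submodule.zero_mem _
    | one => exact mem_cubicLattice.2 ⟨1, 0, 0, by simp⟩
    | add v w _ _ hv hw => exact Submodule.add_mem _ hv hw
    | neg v _ hv => exact Submodule.neg_mem _ hv
    | mul v w _ _ hv hw =>
      rw [← cubicLattice_mul_self h]
      exact Submodule.mul_mem_mul hv hw
  · rw [mem_cubicLattice]
    rintro ⟨x, y, z, rfl⟩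
    have h1 : (a : cubicField a b c d) * AdjoinRoot.root _ ∈ DFring a b c d :=
      Subring.subset_closure (by simp)
    have h2 : (a : cubicField a b c d) * AdjoinRoot.root _ ^ 2 +
        (b : cubicField a b c d) * AdjoinRoot.root _ ∈ DFring a b c d :=
      Subring.subset_closure (by simp)
    exact add_mem (add_mem (intCast_mem _ x) (mul_mem (intCast_mem _ y) h1))
      (mul_mem (intCast_mem _ z)
      (add_mem h2 (intCast_mem _ c)))

theorem exists_intCast_mul_mem_DFring {a b c d : ℤ} [Fact (Irreducible (cubicPolyQ a b c d))]
    (ha : a ≠ 0) (v : cubicField a b c d) :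
    ∃ D : ℤ, D ≠ 0 ∧ (D : cubicField a b c d) * v ∈ DFring a b c d := by
  induction v using AdjoinRoot.induction_on with
  | ih P =>
    induction P using Polynomial.induction_on' with
    | add P Q hP hQ =>
      obtain ⟨D, hD, hDP⟩ := hP
      obtain ⟨D', hD', hDQ⟩ := hQ
      refine ⟨D * D', mul_ne_zero hD hD', ?_⟩
      convert add_mem (mul_mem (intCast_mem _ D') hDP) (mul_mem (intCast_mem _ D) hDQ) using 1
      push_cast [map_add]
      ring
    | monomial k t =>
      refine ⟨t.den * a ^ k, mul_ne_zero (by exact_mod_cast t.den_ne_zero) (pow_ne_zero _ ha), ?_⟩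
      have h1 : (a : cubicField a b c d) * AdjoinRoot.root _ ∈ DFring a b c d :=
        Subring.subset_closure (by simp)
      have e : (t.den : cubicField a b c d) * AdjoinRoot.of (cubicPolyQ a b c d) t = t.num := by
        rw [← map_natCast (AdjoinRoot.of (cubicPolyQ a b c d)), ← map_mul, Rat.den_mul_eq_num,
          map_intCast]
      convert mul_mem (intCast_mem _ t.num) (pow_mem h1 k) using 1
      rw [← Polynomial.C_mul_X_pow_eq_monomial, map_mul, map_pow, AdjoinRoot.mk_X,
        AdjoinRoot.mk_C, ← e]
      push_cast
      ring

theorem isFractionRing_DFring {a b c d : ℤ} [Fact (Irreducible (cubicPolyQ a b c d))]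
    (ha : a ≠ 0) : IsFractionRing (DFring a b c d) (cubicField a b c d) := by
  apply IsFractionRing.of_field
  intro z
  obtain ⟨D, hD, hDz⟩ := exists_intCast_mul_mem_DFring ha z
  refine ⟨⟨_, hDz⟩, (D : DFring a b c d), ?_⟩
  have : (D : cubicField a b c d) ≠ 0 := by exact_mod_cast hD
  simp only [map_intCast]
  rw [eq_div_iff this, mul_comm]
  rfl

/-- An order as a `ℤ`-submodule of a field. -/
def orderSubmodule {K : Type*} [Field K] (R : Subring K) : Submodule ℤ K :=
  (Subring.toAddSubgroup R).toIntSubmodule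

theorem mem_orderSubmodule {K : Type*} [Field K] {R : Subring K} {v : K} :
    v ∈ orderSubmodule R ↔ v ∈ R := Iff.rfl

theorem restrictScalars_mul {K : Type*} [Field K] (R : Subring K)
    (I J : Submodule R K) :
    (I * J).restrictScalars ℤ = I.restrictScalars ℤ * J.restrictScalars ℤ := by
  apply le_antisymm
  · intro v hv
    rw [Submodule.restrictScalars_mem] at hv
    induction hv using Submodule.mul_induction_on' with
    | mem_mul_mem v hv w hw => exact Submodule.mul_mem_mul hv hw
    | add v _ w _ ihv ihw => exact Submodule.add_mem _ ihv ihw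
  · rw [Submodule.mul_le]
    intro v hv w hw
    have hv' : v ∈ I := hv
    have hw' : w ∈ J := hw
    have : v * w ∈ I * J := Submodule.mul_mem_mul hv' hw'
    exact this

theorem restrictScalars_one {K : Type*} [Field K] (R : Subring K) :
    (1 : Submodule R K).restrictScalars ℤ = orderSubmodule R := by
  ext v
  rw [Submodule.restrictScalars_mem, Submodule.mem_one, mem_orderSubmodule]
  exact ⟨fun ⟨y, hy⟩ => hy ▸ y.2, fun h => ⟨⟨v, h⟩, rfl⟩⟩

theorem idealGroupTwoTorsion_eq {K : Type*} [Field K] [CharZero K] (R : Subring K)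
    [IsFractionRing R K]
    (hfrac : ∀ v : K, ∃ D : ℤ, D ≠ 0 ∧ (D : K) * v ∈ R) :
    idealGroupTwoTorsion R = Nat.card {I : Submodule ℤ K // IsTwoTorsionLattice (orderSubmodule R) I} := by
  rw [idealGroupTwoTorsion]
  let e := Units.mapEquiv
    (FractionalIdeal.canonicalEquiv R⁰ (FractionRing R) K).toMulEquiv
  rw [Nat.card_congr (e.toEquiv.subtypeEquiv (p := fun I => I ^ 2 = 1) (q := fun I => I ^ 2 = 1)
    (fun I => by
      change I ^ 2 = 1 ↔ (e I) ^ 2 = 1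
      rw [← map_pow, map_eq_one_iff e e.injective]))]
  have hsq : ∀ I : (FractionalIdeal R⁰ K)ˣ, I ^ 2 = 1 →
      ((I : FractionalIdeal R⁰ K) : Submodule R K) * ((I : FractionalIdeal R⁰ K) : Submodule R K)
        = 1 := by
    intro I hI
    rw [← FractionalIdeal.coe_mul, ← Units.val_mul, ← sq, hI, Units.val_one,
      FractionalIdeal.coe_one]
  refine Nat.card_eq_of_bijective (fun I =>
    ⟨((I.1 : FractionalIdeal R⁰ K) : Submodule R K).restrictScalars ℤ, ?_, ?_⟩) ⟨?_, ?_⟩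
  · rw [← restrictScalars_mul, hsq _ I.2, restrictScalars_one]
  · rw [Submodule.mul_le]
    intro v hv w hw
    exact Submodule.smul_mem _ (⟨v, hv⟩ : R) hw
  · intro I J hIJ
    have hIJ' := congrArg Subtype.val hIJ
    apply Subtype.ext
    apply Units.ext
    apply FractionalIdeal.coeToSubmodule_injective
    exact Submodule.restrictScalars_injective ℤ R K hIJ'
  · rintro ⟨I, hI⟩
    let I' : Submodule R K :=
      { I with
        smul_mem' := fun x v hv => hI.2 (Submodule.mul_mem_mul x.2 hv) }
    have hI' : I'.restrictScalars ℤ = I := rfl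
    have hmul : I' * I' = 1 := by
      apply Submodule.restrictScalars_injective ℤ R K
      rw [restrictScalars_mul, hI', restrictScalars_one, hI.1]
    obtain ⟨D, hD, hDI⟩ := hI.exists_intCast_mem (one_mem R) hfrac
    have hfracI : IsFractional R⁰ I' := by
      refine ⟨(D : R), ?_, fun v hv => ?_⟩
      · rw [mem_nonZeroDivisors_iff_ne_zero]
        intro h0
        apply hD
        have := congrArg (Subtype.val) h0
        simpa using this
      · have : (D : K) * v ∈ R := by
          rw [← mem_orderSubmodule, ← hI.1]
          exact Submodule.mul_mem_mul hDI hv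
        refine ⟨⟨_, this⟩, ?_⟩
        rw [Algebra.smul_def, map_intCast]
        rfl
    let F : FractionalIdeal R⁰ K := ⟨I', hfracI⟩
    have hF : F * F = 1 := by
      apply FractionalIdeal.coeToSubmodule_injective
      change ((F * F : FractionalIdeal R⁰ K) : Submodule R K) =
        ((1 : FractionalIdeal R⁰ K) : Submodule R K)
      rw [FractionalIdeal.coe_mul, FractionalIdeal.coe_one]
      exact hmul
    exact ⟨⟨⟨F, F, hF, hF⟩, by ext1; rw [sq]; exact hF⟩, rfl⟩

end DeloneFaddeev

/-- The unimodular pairs modulo `n`. -/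
def unimodularPairs (n : ℕ) : Set (ZMod n × ZMod n) := {z | IsCoprime z.1 z.2}

theorem exists_lift_of_isCoprime {n : ℕ} [NeZero n] {x y : ZMod n} (h : IsCoprime x y) :
    ∃ p q : ℤ, IsCoprime p q ∧ (p : ZMod n) = x ∧ (q : ZMod n) = y := by
  obtain ⟨X, hX0, rfl⟩ : ∃ X : ℤ, X ≠ 0 ∧ (X : ZMod n) = x := by
    refine ⟨x.val + n, ?_, by simp⟩
    have := NeZero.pos n
    positivity
  obtain ⟨Y, rfl⟩ := ZMod.intCast_surjective y
  obtain ⟨k, hk⟩ := exists_isCoprime_add_mul (α := X) (β := Y) (δ := n) hX0 (by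
    intro p hp hpX hpY hpn
    obtain ⟨α, β, hαβ⟩ := h
    obtain ⟨A, rfl⟩ := ZMod.intCast_surjective α
    obtain ⟨B, rfl⟩ := ZMod.intCast_surjective β
    have h1 : (n : ℤ) ∣ A * X + B * Y - 1 := by
      rw [← ZMod.intCast_zmod_eq_zero_iff_dvd]
      push_cast
      rw [hαβ, sub_self]
    have h2 : (p : ℤ) ∣ 1 := by
      have h3 := (hpX.mul_left A).add (hpY.mul_left B)
      simpa using h3.sub (hpn.trans h1)
    exact (Nat.prime_iff_prime_int.1 hp).not_dvd_one h2)
  exact ⟨X, Y + k * n, hk, rfl, by simp⟩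

/-- Two unimodular pairs with vanishing determinant differ by a unit. -/
theorem exists_units_smul_of_det_eq_zero {R : Type*} [CommRing R] {x y x' y' : R}
    (h : IsCoprime x y) (h' : IsCoprime x' y') (hdet : x * y' = y * x') :
    ∃ u : Rˣ, x' = u * x ∧ y' = u * y := by
  obtain ⟨α, β, hαβ⟩ := h
  obtain ⟨α', β', hαβ'⟩ := h'
  refine ⟨⟨α * x' + β * y', α' * x + β' * y, ?_, ?_⟩, ?_, ?_⟩
  · linear_combination (α' * x' + β' * y') * hαβ + hαβ' + (α' * β - α * β') * hdet
  · linear_combination (α' * x' + β' * y') * hαβ + hαβ' + (α' * β - α * β') * hdet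
  · simp only
    linear_combination -x' * hαβ - β * hdet
  · simp only
    linear_combination -y' * hαβ + α * hdet

theorem exists_reps (n : ℕ) [NeZero n] : ∃ S : Finset (ℤ × ℤ),
    (∀ v ∈ S, IsCoprime v.1 v.2) ∧
    (∀ v ∈ S, ∀ w ∈ S, (n : ℤ) ∣ v.1 * w.2 - v.2 * w.1 → v = w) ∧
    (∀ v : ℤ × ℤ, IsCoprime v.1 v.2 → ∃ w ∈ S, (n : ℤ) ∣ v.1 * w.2 - v.2 * w.1) ∧
    S.card * n.totient = (unimodularPairs n).ncard := by
  classical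
  let s : Setoid (unimodularPairs n) :=
    { r := fun v w => ∃ u : (ZMod n)ˣ, w.1 = (u * v.1.1, u * v.1.2)
      iseqv := ⟨fun v => ⟨1, by simp⟩, fun {v w} ⟨u, hu⟩ => ⟨u⁻¹, by simp [hu]⟩,
        fun {v w z} ⟨u, hu⟩ ⟨u', hu'⟩ => ⟨u' * u, by simp [hu', hu, mul_assoc]⟩⟩ }
  choose p q hpq hp hq using fun c : Quotient s => exists_lift_of_isCoprime c.out.2
  have : Finite (Quotient s) := Quotient.finite s
  have : Fintype (Quotient s) := Fintype.ofFinite _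
  have hinj : ∀ c c' : Quotient s, (n : ℤ) ∣ p c * q c' - q c * p c' → c = c' := by
    intro c c' h
    rw [← ZMod.intCast_zmod_eq_zero_iff_dvd] at h
    push_cast at h
    rw [hp, hq, hp, hq, sub_eq_zero] at h
    obtain ⟨u, h1, h2⟩ := exists_units_smul_of_det_eq_zero c.out.2 c'.out.2 h
    rw [← Quotient.out_eq c, ← Quotient.out_eq c']
    exact Quotient.sound ⟨u, Prod.ext h1 h2⟩
  refine ⟨Finset.univ.image fun c => (p c, q c), ?_, ?_, ?_, ?_⟩
  · intro v hv
    obtain ⟨c, -, rfl⟩ := Finset.mem_image.1 hv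
    exact hpq c
  · intro v hv w hw h
    obtain ⟨c, -, rfl⟩ := Finset.mem_image.1 hv
    obtain ⟨c', -, rfl⟩ := Finset.mem_image.1 hw
    rw [hinj c c' h]
  · intro v hv
    have hv' : IsCoprime (v.1 : ZMod n) (v.2 : ZMod n) := by
      exact hv.map (Int.castRingHom (ZMod n))
    let c : Quotient s := ⟦⟨((v.1 : ZMod n), (v.2 : ZMod n)), hv'⟩⟧
    refine ⟨(p c, q c), Finset.mem_image.2 ⟨c, Finset.mem_univ _, rfl⟩, ?_⟩
    rw [← ZMod.intCast_zmod_eq_zero_iff_dvd]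
    push_cast
    rw [hp, hq]
    obtain ⟨u, hu⟩ : s.r c.out ⟨((v.1 : ZMod n), (v.2 : ZMod n)), hv'⟩ :=
      Quotient.exact (Quotient.out_eq c)
    simp only [Prod.mk.injEq] at hu
    rw [hu.1, hu.2]
    ring
  · rw [Finset.card_image_of_injective _ (fun c c' h => hinj c c' (by
      simp only [Prod.mk.injEq] at h
      rw [h.1, h.2]
      ring_nf
      simp)), ← ZMod.card_units_eq_totient, Finset.card_univ, ← Fintype.card_prod,
      ← Nat.card_eq_fintype_card, ← Nat.card_coe_set_eq]
    refine Nat.card_eq_of_bijective (fun z : Quotient s × (ZMod n)ˣ =>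
      (⟨(z.2 * z.1.out.1.1, z.2 * z.1.out.1.2), ?_⟩ : unimodularPairs n)) ⟨?_, ?_⟩
    · obtain ⟨α, β, h⟩ := z.1.out.2
      exact ⟨α * (z.2⁻¹ : (ZMod n)ˣ), β * (z.2⁻¹ : (ZMod n)ˣ), by simpa [mul_assoc] using h⟩
    · rintro ⟨c, u⟩ ⟨c', u'⟩ h
      simp only [Subtype.mk.injEq, Prod.mk.injEq] at h
      have hc : c = c' := by
        rw [← Quotient.out_eq c, ← Quotient.out_eq c']
        apply Quotient.sound
        refine ⟨u'⁻¹ * u, ?_⟩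
        ext <;> simp [mul_assoc, h.1, h.2]
      subst hc
      simp only [Prod.mk.injEq, true_and]
      obtain ⟨α, β, h1⟩ := c.out.2
      ext
      linear_combination α * h.1 + β * h.2 - (u - u' : ZMod n) * h1
    · rintro ⟨v, hv⟩
      let c : Quotient s := ⟦⟨v, hv⟩⟧
      obtain ⟨u, hu⟩ : s.r c.out ⟨v, hv⟩ := Quotient.exact (Quotient.out_eq c)
      exact ⟨(c, u), Subtype.ext hu.symm⟩

/-- Representatives in coprime integer pairs of the projective line modulo `n`. -/
noncomputable def projReps (n : ℕ) : Finset (ℤ × ℤ) :=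
  if h : n = 0 then ∅ else haveI : NeZero n := ⟨h⟩; (exists_reps n).choose

theorem projReps_spec {n : ℕ} (hn : n ≠ 0) :
    (∀ v ∈ projReps n, IsCoprime v.1 v.2) ∧
    (∀ v ∈ projReps n, ∀ w ∈ projReps n, (n : ℤ) ∣ v.1 * w.2 - v.2 * w.1 → v = w) ∧
    (∀ v : ℤ × ℤ, IsCoprime v.1 v.2 → ∃ w ∈ projReps n, (n : ℤ) ∣ v.1 * w.2 - v.2 * w.1) ∧
    (projReps n).card * n.totient = (unimodularPairs n).ncard := by
  have : NeZero n := ⟨hn⟩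
  rw [projReps, dif_neg hn]
  exact (exists_reps n).choose_spec

/-- A form rewritten in a basis of `ℤ²` whose first vector is `v` (for coprime `v`). -/
def completedAct (v : ℤ × ℤ) (f : ℤ × ℤ × ℤ × ℤ) : ℤ × ℤ × ℤ × ℤ :=
  formAct v.1 v.2 (-Int.gcdB v.1 v.2) (Int.gcdA v.1 v.2) f

theorem completion_det {v : ℤ × ℤ} (hv : IsCoprime v.1 v.2) :
    v.1 * Int.gcdA v.1 v.2 - v.2 * (-Int.gcdB v.1 v.2) = 1 := by
  have := Int.gcd_eq_gcd_ab v.1 v.2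
  rw [Int.isCoprime_iff_gcd_eq_one.1 hv] at this
  push_cast at this
  linear_combination -this

open Classical in
/-- The number of lattices of index datum `n` squaring to the cubic ring of `f`. -/
noncomputable def torsionCount (n : ℕ) (f : ℤ × ℤ × ℤ × ℤ) : ℕ :=
  ∑ v ∈ projReps n, ((Finset.range n).filter fun r : ℕ => TorsionCond n r (completedAct v f)).card

/-- The discriminant of a coefficient tuple. -/
def tupleDisc (f : ℤ × ℤ × ℤ × ℤ) : ℤ := cubicDisc f.1 f.2.1 f.2.2.1 f.2.2.2

theorem tupleDisc_formAct {p q r s : ℤ} (hdet : p * s - q * r = 1) (f : ℤ × ℤ × ℤ × ℤ) :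
    tupleDisc (formAct p q r s f) = tupleDisc f := by
  have : tupleDisc (formAct p q r s f) = (p * s - q * r) ^ 6 * tupleDisc f := by
    simp only [tupleDisc, formAct, cubicDisc]
    ring
  rw [this, hdet]
  ring

theorem TorsionCond.sq_dvd_disc {n : ℕ} {r : ℤ} {f : ℤ × ℤ × ℤ × ℤ} (h : TorsionCond n r f) :
    (n : ℤ) ^ 2 ∣ tupleDisc f := by
  obtain ⟨⟨a, ha⟩, ⟨b, hb⟩, -⟩ := h
  have hb' : f.2.1 = n * (n * b + 2 * r) := by linear_combination hb
  simp only [tupleDisc, cubicDisc]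
  rw [ha, hb']
  exact ⟨18*a*(n * (n * b + 2 * r))*f.2.2.1*f.2.2.2 - 4*n*(n * b + 2 * r)^3*f.2.2.2 +
    (n * b + 2 * r)^2*f.2.2.1^2 - 4*a*f.2.2.1^3 - 27*n^2*a^2*f.2.2.2^2, by ring⟩

theorem card_isTwoTorsionLattice {K : Type*} [Field K] [CharZero K] {ω θ : K} {a b c d : ℤ}
    (h : IsCubicBasis ω θ a b c d)
    (hfrac : ∀ v : K, ∃ D : ℤ, D ≠ 0 ∧ (D : K) * v ∈ cubicLattice ω θ)
    (hdisc : tupleDisc (a, b, c, d) ≠ 0) {N : ℕ} (hN : (tupleDisc (a, b, c, d)).natAbs ≤ N) :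
    Nat.card {I : Submodule ℤ K // IsTwoTorsionLattice (cubicLattice ω θ) I} =
      ∑ n ∈ Finset.Icc 1 N, torsionCount n (a, b, c, d) := by
  classical
  set f : ℤ × ℤ × ℤ × ℤ := (a, b, c, d) with hf
  let P : Finset (Σ _ : ℕ, Σ _ : ℤ × ℤ, ℕ) := (Finset.Icc 1 N).sigma fun n =>
    (projReps n).sigma fun v => (Finset.range n).filter fun r : ℕ =>
      TorsionCond n r (completedAct v f)
  have hP : P.card = ∑ n ∈ Finset.Icc 1 N, torsionCount n f := by
    simp only [P, Finset.card_sigma]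
    rfl
  rw [← hP, ← Nat.card_eq_finsetCard]
  have hmemP : ∀ x : (Σ _ : ℕ, Σ _ : ℤ × ℤ, ℕ), x ∈ P ↔ (1 ≤ x.1 ∧ x.1 ≤ N) ∧ x.2.1 ∈ projReps x.1 ∧
      x.2.2 < x.1 ∧ TorsionCond x.1 x.2.2 (completedAct x.2.1 f) := by
    intro x
    simp [P]
  let F : ℕ → ℤ × ℤ → ℕ → Submodule ℤ K := fun n v r => torsionLattice n r
    (v.1 * ω + v.2 * θ + (shiftFst v.1 v.2 (-Int.gcdB v.1 v.2) (Int.gcdA v.1 v.2) f : ℤ))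
    (((-Int.gcdB v.1 v.2 : ℤ) : K) * ω + Int.gcdA v.1 v.2 * θ +
      (shiftSnd v.1 v.2 (-Int.gcdB v.1 v.2) (Int.gcdA v.1 v.2) f : ℤ))
  symm
  refine Nat.card_eq_of_bijective (fun x : P => ⟨F x.1.1 x.1.2.1 x.1.2.2, ?_⟩) ⟨?_, ?_⟩
  · obtain ⟨⟨h1, -⟩, h2, -, h4⟩ := (hmemP x.1).1 x.2
    have hdet := completion_det ((projReps_spec (by omega)).1 _ h2)
    rw [← cubicLattice_change ω θ hdet]
    exact isTwoTorsionLattice_torsionLattice (h.change hdet) (by omega) h4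
  · rintro ⟨⟨n, v, r⟩, hx⟩ ⟨⟨n', v', r'⟩, hx'⟩ hxx
    obtain ⟨⟨h1, -⟩, h2, h3, h4⟩ := (hmemP _).1 hx
    obtain ⟨⟨h1', -⟩, h2', h3', h4'⟩ := (hmemP _).1 hx'
    simp only at h1 h2 h3 h4 h1' h2' h3' h4'
    have hdet := completion_det ((projReps_spec (by omega)).1 _ h2)
    have hdet' := completion_det ((projReps_spec (by omega)).1 _ h2')
    have hF : F n v r = F n' v' r' := congrArg Subtype.val hxx
    obtain ⟨hn, hv⟩ := torsionLattice_injective h (by omega) (by omega) hdet (h.change hdet)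
      (h.change hdet') hF
    subst hn
    have hv' := (projReps_spec (by omega)).2.1 _ h2 _ h2' hv
    subst hv'
    have hr := torsionLattice_shift_injective (h.change hdet) (by omega) hF
    have hr' : r = r' := by
      have := Int.eq_zero_of_abs_lt_dvd hr (by rw [abs_lt]; omega)
      omega
    subst hr'
    rfl
  · rintro ⟨I, hI⟩
    obtain ⟨n, hn, p, q, hpq, hall⟩ := exists_eq_torsionLattice h hfrac hI
    obtain ⟨v, hv, hdvd⟩ := (projReps_spec hn).2.2.1 (p, q) hpq
    have hdet := completion_det ((projReps_spec hn).1 _ hv)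
    obtain ⟨t, ht, hIt⟩ := hall _ _ _ _ hdet hdvd
    obtain ⟨r, hr, k, hk⟩ : ∃ r : ℕ, r < n ∧ ∃ k : ℤ, t = r + n * k := by
      refine ⟨(t % n).toNat, ?_, t / n, ?_⟩
      · have := Int.emod_lt_of_pos t (by omega : (0 : ℤ) < n)
        have := Int.emod_nonneg t (by omega : (n : ℤ) ≠ 0)
        omega
      · have := Int.emod_nonneg t (by omega : (n : ℤ) ≠ 0)
        rw [Int.toNat_of_nonneg this, Int.emod_add_mul_ediv]
    subst hk
    have hcond : TorsionCond n r (completedAct v f) := by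
      obtain ⟨h1, h2, h3⟩ := ht
      refine ⟨h1, ?_, ?_⟩
      · obtain ⟨m, hm⟩ := h2
        exact ⟨m + 2 * k, by simp only [completedAct]; linear_combination hm⟩
      · have key : ∀ X : ℤ, IsCoprime ((r + n * k) ^ 2 - X) (n : ℤ) →
            IsCoprime ((r : ℤ) ^ 2 - X) n := fun X hX => by
          have := hX.add_mul_left_left (-(2 * r * k + n * k ^ 2))
          rwa [show ((r : ℤ) + n * k) ^ 2 - X + n * -(2 * r * k + n * k ^ 2) = r ^ 2 - X by ring]
            at this
        exact key _ h3
    refine ⟨⟨⟨n, v, r⟩, (hmemP _).2 ⟨⟨Nat.one_le_iff_ne_zero.2 hn, ?_⟩, hv, hr, hcond⟩⟩, ?_⟩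
    · have h1 := hcond.sq_dvd_disc
      rw [completedAct, tupleDisc_formAct hdet] at h1
      have h2 := Int.natAbs_dvd_natAbs.2 ((dvd_pow_self (n : ℤ) two_ne_zero).trans h1)
      have h3 := Nat.le_of_dvd (Int.natAbs_pos.2 hdisc) h2
      simp only [Int.natAbs_natCast] at h3
      exact h3.trans hN
    · apply Subtype.ext
      change F n v r = I
      rw [hIt]
      ext w
      simp only [F]
      rw [mem_torsionLattice, mem_torsionLattice]
      constructor
      · rintro ⟨x, y, z, rfl⟩
        exact ⟨x - y * k, y, z, by push_cast; ring⟩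
      · rintro ⟨x, y, z, rfl⟩
        exact ⟨x + y * k, y, z, by push_cast; ring⟩

theorem idealGroupTwoTorsion_DFring {a b c d : ℤ} (hirr : IsIrredCubicForm a b c d)
    (hdisc : tupleDisc (a, b, c, d) ≠ 0) {N : ℕ} (hN : (tupleDisc (a, b, c, d)).natAbs ≤ N) :
    idealGroupTwoTorsion (DFring a b c d) =
      ∑ n ∈ Finset.Icc 1 N, torsionCount n (a, b, c, d) := by
  have : Fact (Irreducible (cubicPolyQ a b c d)) := ⟨hirr.2⟩
  have := isFractionRing_DFring (b := b) (c := c) (d := d) hirr.1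
  have : CharZero (cubicField a b c d) :=
    charZero_of_injective_algebraMap (algebraMap ℚ _).injective
  rw [idealGroupTwoTorsion_eq (K := cubicField a b c d) _ (exists_intCast_mul_mem_DFring hirr.1)]
  have hR : orderSubmodule (DFring a b c d) = cubicLattice
      ((a : cubicField a b c d) * AdjoinRoot.root _)
      ((a : cubicField a b c d) * AdjoinRoot.root _ ^ 2 +
        (b : cubicField a b c d) * AdjoinRoot.root _ + (c : cubicField a b c d)) := by
    ext v
    rw [mem_orderSubmodule, mem_DFring hirr.1]
  rw [hR]
  refine card_isTwoTorsionLattice (IsIrredCubicForm.isCubicBasis hirr.1) (fun v => ?_) hdisc hN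
  obtain ⟨D, hD, hDv⟩ := exists_intCast_mul_mem_DFring hirr.1 v
  exact ⟨D, hD, (mem_DFring hirr.1).1 hDv⟩

/-- The number of invertible symmetric `2 × 2` matrices over a commutative ring. -/
noncomputable def symmUnitCount (R : Type*) [CommRing R] : ℕ :=
  Nat.card {z : R × R × R // IsUnit (z.1 ^ 2 - z.2.1 * z.2.2)}

theorem symmUnitCount_congr {R S : Type*} [CommRing R] [CommRing S] (e : R ≃+* S) :
    symmUnitCount R = symmUnitCount S := by
  refine Nat.card_congr (Equiv.subtypeEquiv
    (e.toEquiv.prodCongr (e.toEquiv.prodCongr e.toEquiv)) fun z => ?_)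
  rw [← MulEquiv.isUnit_map e]
  simp

theorem symmUnitCount_prod (R S : Type*) [CommRing R] [CommRing S] :
    symmUnitCount (R × S) = symmUnitCount R * symmUnitCount S := by
  unfold symmUnitCount
  rw [← Nat.card_prod]
  refine Nat.card_congr
    { toFun := fun z => (⟨(z.1.1.1, z.1.2.1.1, z.1.2.2.1), (Prod.isUnit_iff.1 z.2).1⟩,
        ⟨(z.1.1.2, z.1.2.1.2, z.1.2.2.2), (Prod.isUnit_iff.1 z.2).2⟩)
      invFun := fun z => ⟨((z.1.1.1, z.2.1.1), (z.1.1.2.1, z.2.1.2.1), (z.1.1.2.2, z.2.1.2.2)),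
        Prod.isUnit_iff.2 ⟨z.1.2, z.2.2⟩⟩
      left_inv := fun z => rfl
      right_inv := fun z => rfl }

open Classical in
theorem symmUnitCount_of_isLocalRing (R : Type*) [CommRing R] [Finite R] [IsLocalRing R] :
    symmUnitCount R = Nat.card R ^ 2 * Nat.card Rˣ := by
  have := Fintype.ofFinite R
  have hU : (Finset.univ.filter fun x : R => IsUnit x).card = Nat.card Rˣ := by
    rw [← Fintype.card_subtype, ← Nat.card_eq_fintype_card]
    exact (Nat.card_congr (Equiv.ofBijective (fun u : Rˣ => (⟨u, u.isUnit⟩ : {x : R // IsUnit x}))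
      ⟨fun u v h => Units.ext (Subtype.mk.inj h), fun x => ⟨x.2.unit, rfl⟩⟩)).symm
  have hN : (Finset.univ.filter fun x : R => ¬ IsUnit x).card + Nat.card Rˣ = Nat.card R := by
    rw [← hU, add_comm, Finset.card_filter_add_card_filter_not, Finset.card_univ,
      Nat.card_eq_fintype_card]
  have h1 : ∀ a : R, IsUnit a → ∀ r : R,
      (∑ c : R, if IsUnit (r ^ 2 - a * c) then 1 else 0) = Nat.card Rˣ := by
    intro a ha r
    rw [← hU, Finset.card_filter]
    obtain ⟨u, rfl⟩ := ha
    exact Fintype.sum_equiv ((Units.mulLeft u).trans (Equiv.subLeft (r ^ 2))) _ _ fun c => rfl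
  have h2 : ∀ a : R, ¬ IsUnit a → ∀ r c : R, IsUnit (r ^ 2 - a * c) ↔ IsUnit r := by
    intro a ha r c
    have hac : a * c ∈ IsLocalRing.maximalIdeal R := Ideal.mul_mem_right _ _ ha
    rw [← not_iff_not, ← mem_nonunits_iff, ← mem_nonunits_iff, ← IsLocalRing.mem_maximalIdeal,
      ← IsLocalRing.mem_maximalIdeal, Submodule.sub_mem_iff_left _ hac]
    exact ⟨fun h => Ideal.IsPrime.mem_of_pow_mem inferInstance _ h,
      fun h => Ideal.pow_mem_of_mem _ h 2 two_pos⟩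
  have key : symmUnitCount R =
      ∑ a : R, ∑ r : R, ∑ c : R, if IsUnit (r ^ 2 - a * c) then 1 else 0 := by
    unfold symmUnitCount
    rw [Nat.card_eq_fintype_card, Fintype.card_subtype, Finset.card_filter,
      Fintype.sum_prod_type, Finset.sum_comm]
    rw [Finset.sum_comm]
    simp_rw [Fintype.sum_prod_type]
    rw [Finset.sum_comm]
  rw [key, ← Finset.sum_filter_add_sum_filter_not _ (fun a : R => IsUnit a)]
  rw [Finset.sum_congr rfl (g := fun _ => Nat.card R * Nat.card Rˣ) (fun a ha => by
      rw [Finset.sum_congr rfl fun r _ => h1 a (Finset.mem_filter.1 ha).2 r]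
      simp),
    Finset.sum_congr (s₁ := Finset.univ.filter fun x : R => ¬ IsUnit x) rfl
      (g := fun _ => Nat.card R * Nat.card Rˣ) (fun a ha => by
      rw [Finset.sum_congr rfl fun r _ => Finset.sum_congr rfl fun c _ => by
        rw [if_congr (h2 a (Finset.mem_filter.1 ha).2 r c) rfl rfl]]
      rw [Finset.sum_comm, Finset.sum_congr rfl fun r _ => by rw [← Finset.card_filter, hU]]
      simp)]
  rw [Finset.sum_const, Finset.sum_const, ← add_smul, hU, add_comm, hN, smul_eq_mul]
  ring

theorem symmUnitCount_zmod (n : ℕ) (hn : n ≠ 0) :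
    symmUnitCount (ZMod n) = n ^ 2 * n.totient := by
  induction n using Nat.recOnPosPrimePosCoprime with
  | prime_pow p k hp hk =>
    have := Fact.mk hp
    have : NeZero (p ^ k) := ⟨hn⟩
    have : Fact (1 < p ^ k) := ⟨Nat.one_lt_pow hk.ne' hp.one_lt⟩
    have hu : ∀ x : ZMod (p ^ k), x ∈ nonunits (ZMod (p ^ k)) ↔ p ∣ x.val := by
      intro x
      rw [mem_nonunits_iff, ← ZMod.natCast_zmod_val x, ZMod.isUnit_iff_coprime,
        Nat.coprime_pow_right_iff hk, Nat.coprime_comm, hp.coprime_iff_not_dvd, not_not]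
      simp
    have : IsLocalRing (ZMod (p ^ k)) := by
      refine IsLocalRing.of_nonunits_add fun x y hx hy => ?_
      rw [hu] at *
      rw [ZMod.val_add, Nat.dvd_mod_iff (dvd_pow_self p hk.ne')]
      exact dvd_add hx hy
    rw [symmUnitCount_of_isLocalRing, Nat.card_zmod, Nat.card_eq_fintype_card,
      ZMod.card_units_eq_totient]
  | zero => exact absurd rfl hn
  | one =>
    rw [symmUnitCount, Nat.totient_one, one_pow, one_mul, Nat.card_eq_one_iff_unique]
    exact ⟨inferInstance, ⟨⟨0, isUnit_of_subsingleton _⟩⟩⟩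
  | coprime a b ha hb hab iha ihb =>
    rw [symmUnitCount_congr (ZMod.chineseRemainder hab), symmUnitCount_prod,
      iha (by lia), ihb (by lia), Nat.totient_mul hab]
    ring

/-- Coordinatewise reduction of an integer quadruple. -/
def reduceMod (M : ℕ) (f : ℤ × ℤ × ℤ × ℤ) : ZMod M × ZMod M × ZMod M × ZMod M :=
  ((f.1 : ZMod M), (f.2.1 : ZMod M), (f.2.2.1 : ZMod M), (f.2.2.2 : ZMod M))

/-- A function on integer quadruples that depends only on their reductions modulo `M`. -/
def IsPeriodicMod {A : Type*} (M : ℕ) (F : ℤ × ℤ × ℤ × ℤ → A) : Prop :=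
  ∀ f g, reduceMod M f = reduceMod M g → F f = F g

/-- The sum of a function over the quadruples with coordinates in `[0, M)`. -/
def cubeSum {A : Type*} [AddCommMonoid A] (M : ℕ) (F : ℤ × ℤ × ℤ × ℤ → A) : A :=
  ∑ i ∈ Finset.range M, ∑ j ∈ Finset.range M, ∑ k ∈ Finset.range M, ∑ l ∈ Finset.range M,
    F ((i : ℤ), (j : ℤ), (k : ℤ), (l : ℤ))

/-- The representatives in `[0, M)` of a quadruple of residue classes. -/
def liftMod (M : ℕ) (z : ZMod M × ZMod M × ZMod M × ZMod M) : ℤ × ℤ × ℤ × ℤ :=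
  (z.1.val, z.2.1.val, z.2.2.1.val, z.2.2.2.val)

theorem reduceMod_liftMod (M : ℕ) [NeZero M] (z : ZMod M × ZMod M × ZMod M × ZMod M) :
    reduceMod M (liftMod M z) = z := by
  simp [reduceMod, liftMod]

theorem reduceMod_formAct (M : ℕ) (p q r s : ℤ) (f : ℤ × ℤ × ℤ × ℤ) :
    reduceMod M (formAct p q r s f) = formAct (p : ZMod M) q r s (reduceMod M f) := by
  simp [reduceMod, formAct]

theorem sum_zmod_val {A : Type*} [AddCommMonoid A] (M : ℕ) [NeZero M] (h : ℕ → A) :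
    ∑ z : ZMod M, h z.val = ∑ i ∈ Finset.range M, h i := by
  obtain ⟨m, rfl⟩ := Nat.exists_eq_succ_of_ne_zero (NeZero.ne M)
  exact Fin.sum_univ_eq_sum_range h (m + 1)

theorem cubeSum_eq_sum_zmod {A : Type*} [AddCommMonoid A] (M : ℕ) [NeZero M]
    (F : ℤ × ℤ × ℤ × ℤ → A) : cubeSum M F = ∑ z, F (liftMod M z) := by
  simp_rw [cubeSum, ← sum_zmod_val, Fintype.sum_prod_type]
  rfl

theorem cubeSum_formAct {A : Type*} [AddCommMonoid A] {M : ℕ} [NeZero M]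
    {F : ℤ × ℤ × ℤ × ℤ → A} (hF : IsPeriodicMod M F) {p q r s : ℤ} (hdet : p * s - q * r = 1) :
    cubeSum M (fun f => F (formAct p q r s f)) = cubeSum M F := by
  have hd : (p : ZMod M) * s - q * r = 1 := by exact_mod_cast congrArg (Int.cast : ℤ → ZMod M) hdet
  have hinv : ∀ (p q r s : ZMod M) (_ : p * s - q * r = 1) (z : ZMod M × ZMod M × ZMod M × ZMod M),
      formAct s (-q) (-r) p (formAct p q r s z) = z := by
    intro p q r s h z
    have : formAct s (-q) (-r) p (formAct p q r s z) =
      ((p * s - q * r) ^ 3 * z.1, (p * s - q * r) ^ 3 * z.2.1,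
        (p * s - q * r) ^ 3 * z.2.2.1, (p * s - q * r) ^ 3 * z.2.2.2) := by
      simp only [formAct, Prod.mk.injEq]
      refine ⟨?_, ?_, ?_, ?_⟩ <;> ring
    rw [this, h]
    simp
  rw [cubeSum_eq_sum_zmod, cubeSum_eq_sum_zmod]
  refine Fintype.sum_equiv ⟨formAct (p : ZMod M) q r s, formAct (s : ZMod M) (-q) (-r) p,
    hinv _ _ _ _ hd, fun z => ?_⟩ _ _ fun z => hF _ _ ?_
  · have := hinv (s : ZMod M) (-q) (-r) p (by linear_combination hd) z
    simpa using this
  · rw [reduceMod_formAct, reduceMod_liftMod, reduceMod_liftMod]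
    rfl

theorem sum_range_mul_periodic {n : ℕ} (h : ℕ → ℕ) (hh : ∀ i, h (i + n) = h i) (m : ℕ) :
    ∑ i ∈ Finset.range (n * m), h i = m * ∑ i ∈ Finset.range n, h i := by
  induction m with
  | zero => simp
  | succ m ih =>
    have : ∀ k i, h (n * k + i) = h i := by
      intro k
      induction k with
      | zero => simp
      | succ k ihk =>
        intro i
        rw [← ihk i, ← hh (n * k + i)]
        congr 1
        ring
    rw [mul_add_one, Finset.sum_range_add, ih, Finset.sum_congr rfl fun i _ => this m i]
    ring

theorem sum_range_mul_dvd {k : ℕ} [DecidablePred (k ∣ ·)] (hk : k ≠ 0) (h : ℕ → ℕ) (m : ℕ) :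
    ∑ i ∈ Finset.range (k * m), (if k ∣ i then h (i / k) else 0) = ∑ i ∈ Finset.range m, h i := by
  induction m with
  | zero => simp
  | succ m ih =>
    rw [mul_add_one, Finset.sum_range_add, ih, Finset.sum_range_succ, add_right_inj,
      Finset.sum_eq_single_of_mem 0 (Finset.mem_range.2 (Nat.pos_of_ne_zero hk))]
    · simp [Nat.pos_of_ne_zero hk]
    · intro i hi hi0
      rw [if_neg]
      rw [Nat.dvd_add_right (dvd_mul_right k m)]
      exact fun hd => absurd (Nat.le_of_dvd (Nat.pos_of_ne_zero hi0) hd)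
        (not_le.2 (Finset.mem_range.1 hi))

theorem isPeriodicMod_torsionCond (n : ℕ) (hn : n ≠ 0) (r : ℤ) :
    IsPeriodicMod (n ^ 3) (TorsionCond n r) := by
  have hn' : (n : ℤ) ≠ 0 := by exact_mod_cast hn
  have half : ∀ f g, reduceMod (n ^ 3) f = reduceMod (n ^ 3) g →
      TorsionCond n r f → TorsionCond n r g := by
    rintro ⟨a, b, c, d⟩ ⟨a', b', c', d'⟩ h ⟨h1, h2, h3⟩
    simp only [reduceMod, Prod.mk.injEq] at h
    obtain ⟨ha, hb, hc, -⟩ := h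
    rw [ZMod.intCast_eq_intCast_iff_dvd_sub] at ha hb hc
    push_cast at ha hb hc
    obtain ⟨a₁, rfl⟩ := h1
    obtain ⟨b₁, hb₁⟩ := h2
    obtain ⟨x, hx⟩ := ha
    obtain ⟨y, hy⟩ := hb
    obtain ⟨w, hw⟩ := hc
    obtain rfl : a' = (n : ℤ) ^ 2 * (a₁ + n * x) := by linear_combination hx
    obtain rfl : c' = c + (n : ℤ) * (n ^ 2 * w) := by linear_combination hw
    refine ⟨dvd_mul_right _ _, ⟨b₁ + n * y, ?_⟩, ?_⟩
    · simp only at hb₁ ⊢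
      linear_combination hb₁ + hy
    · simp only [Int.mul_ediv_cancel_left _ (pow_ne_zero 2 hn')] at h3 ⊢
      rw [show r ^ 2 - (a₁ + n * x) * (c + n * (n ^ 2 * w)) = r ^ 2 - a₁ * c +
        n * (-(a₁ + n * x) * (n ^ 2 * w) - x * c) by ring]
      exact h3.add_mul_left_left _
  exact fun f g h => propext ⟨half f g h, half g f h.symm⟩

theorem isPeriodicMod_comp_formAct {A : Type*} {M : ℕ} {F : ℤ × ℤ × ℤ × ℤ → A}
    (hF : IsPeriodicMod M F) (p q r s : ℤ) : IsPeriodicMod M fun f => F (formAct p q r s f) :=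
  fun f g h => hF _ _ (by rw [reduceMod_formAct, reduceMod_formAct, h])

theorem isPeriodicMod_torsionCount (n : ℕ) : IsPeriodicMod (n ^ 3) (torsionCount n) := by
  classical
  rcases eq_or_ne n 0 with rfl | hn
  · intro f g _
    simp [torsionCount, projReps]
  intro f g h
  unfold torsionCount
  refine Finset.sum_congr rfl fun v _ => congrArg Finset.card (Finset.filter_congr fun r _ => ?_)
  exact iff_of_eq (isPeriodicMod_comp_formAct (isPeriodicMod_torsionCond n hn r) _ _ _ _ f g h)

open Classical in
theorem sum_isCoprime_eq (n : ℕ) (hn : n ≠ 0) :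
    (∑ r ∈ Finset.range n, ∑ a ∈ Finset.range n, ∑ c ∈ Finset.range n,
      if IsCoprime ((r : ℤ) ^ 2 - a * c) (n : ℤ) then 1 else 0) = n ^ 2 * n.totient := by
  have : NeZero n := ⟨hn⟩
  rw [← symmUnitCount_zmod n hn, symmUnitCount, Nat.card_eq_fintype_card, Fintype.card_subtype,
    Finset.card_filter]
  simp_rw [← sum_zmod_val, Fintype.sum_prod_type]
  refine Finset.sum_congr rfl fun r _ => Finset.sum_congr rfl fun a _ =>
    Finset.sum_congr rfl fun c _ => if_congr ?_ rfl rfl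
  rw [isCoprime_comm, ← ZMod.coe_int_isUnit_iff_isCoprime]
  simp

open Classical in
theorem sum_cubeSum_torsionCond (n : ℕ) (hn : n ≠ 0) :
    ∑ r ∈ Finset.range n, cubeSum (n ^ 3) (fun f => if TorsionCond n r f then 1 else 0) =
      n ^ 8 * n.totient := by
  have hn' : (n : ℤ) ≠ 0 := by exact_mod_cast hn
  have hb : ∀ r : ℕ, (∑ b ∈ Finset.range (n ^ 3),
      if (n : ℤ) ^ 2 ∣ (b : ℤ) - 2 * n * r then 1 else 0) = n := by
    intro r
    have h1 := Nat.count_modEq_card (n ^ 3) (r := n ^ 2) (pow_pos (Nat.pos_of_ne_zero hn) 2) (2 * n * r)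
    rw [Nat.count_eq_card_filter_range, Finset.card_filter] at h1
    have h2 : n ^ 3 % n ^ 2 = 0 := Nat.mod_eq_zero_of_dvd (pow_dvd_pow n (by norm_num))
    rw [h2, Nat.pow_div (by norm_num) (Nat.pos_of_ne_zero hn)] at h1
    simp only [not_lt_zero, if_false, add_zero, Nat.reduceSub, pow_one] at h1
    refine Eq.trans ?_ h1
    refine Finset.sum_congr rfl fun b _ => if_congr ?_ rfl rfl
    rw [Nat.ModEq.comm, Nat.modEq_iff_dvd]
    push_cast
    rfl
  have hc : ∀ r a : ℕ, (∑ c ∈ Finset.range (n ^ 3),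
      if IsCoprime ((r : ℤ) ^ 2 - a * c) (n : ℤ) then 1 else 0) =
      n ^ 2 * ∑ c ∈ Finset.range n, if IsCoprime ((r : ℤ) ^ 2 - a * c) (n : ℤ) then 1 else 0 := by
    intro r a
    rw [show n ^ 3 = n * n ^ 2 by ring]
    refine sum_range_mul_periodic _ (fun i => ?_) _
    refine if_congr ?_ rfl rfl
    push_cast
    rw [show (r : ℤ) ^ 2 - a * (i + n) = r ^ 2 - a * i + n * (-a) by ring]
    exact IsCoprime.add_mul_left_left_iff
  have hr : ∀ r : ℕ, cubeSum (n ^ 3) (fun f => if TorsionCond n r f then 1 else 0) =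
      n ^ 6 * ∑ a ∈ Finset.range n, ∑ c ∈ Finset.range n,
        if IsCoprime ((r : ℤ) ^ 2 - a * c) (n : ℤ) then 1 else 0 := by
    intro r
    calc cubeSum (n ^ 3) (fun f => if TorsionCond n r f then 1 else 0)
        = ∑ a ∈ Finset.range (n ^ 3), ∑ b ∈ Finset.range (n ^ 3), ∑ c ∈ Finset.range (n ^ 3),
          ∑ d ∈ Finset.range (n ^ 3), (if n ^ 2 ∣ a then 1 else 0) *
            ((if (n : ℤ) ^ 2 ∣ (b : ℤ) - 2 * n * r then 1 else 0) *
            (if IsCoprime ((r : ℤ) ^ 2 - ((a / n ^ 2 : ℕ) : ℤ) * c) (n : ℤ) then 1 else 0)) := by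
          refine Finset.sum_congr rfl fun a _ => Finset.sum_congr rfl fun b _ =>
            Finset.sum_congr rfl fun c _ => Finset.sum_congr rfl fun d _ => ?_
          simp only [TorsionCond]
          push_cast
          have : ((n : ℤ) ^ 2 ∣ (a : ℤ)) ↔ n ^ 2 ∣ a := by exact_mod_cast Int.natCast_dvd_natCast
          simp only [this]
          split_ifs <;> simp_all
      _ = ∑ a ∈ Finset.range (n ^ 2 * n), (if n ^ 2 ∣ a then (fun a' : ℕ => n ^ 6 *
          ∑ c ∈ Finset.range n,
            if IsCoprime ((r : ℤ) ^ 2 - a' * c) (n : ℤ) then 1 else 0) (a / n ^ 2) else 0) := by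
          rw [show n ^ 2 * n = n ^ 3 by ring]
          refine Finset.sum_congr rfl fun a _ => ?_
          simp_rw [Finset.sum_const, Finset.card_range, smul_eq_mul, ← Finset.mul_sum, hc]
          rw [← Finset.sum_mul, hb]
          split_ifs
          · ring
          · ring
      _ = _ := by
        rw [Finset.mul_sum]
        exact sum_range_mul_dvd (pow_ne_zero 2 hn) (fun a' : ℕ => n ^ 6 * ∑ c ∈ Finset.range n,
            if IsCoprime ((r : ℤ) ^ 2 - a' * c) (n : ℤ) then 1 else 0) n
  rw [Finset.sum_congr rfl fun r _ => hr r, ← Finset.mul_sum, sum_isCoprime_eq n hn]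
  ring

theorem cubeSum_sum {A ι : Type*} [AddCommMonoid A] (M : ℕ) (s : Finset ι)
    (F : ι → ℤ × ℤ × ℤ × ℤ → A) :
    cubeSum M (fun f => ∑ i ∈ s, F i f) = ∑ i ∈ s, cubeSum M (F i) := by
  rcases eq_or_ne M 0 with rfl | hM
  · simp [cubeSum]
  have : NeZero M := ⟨hM⟩
  simp_rw [cubeSum_eq_sum_zmod]
  exact Finset.sum_comm

theorem cubeSum_torsionCount (n : ℕ) (hn : n ≠ 0) :
    cubeSum (n ^ 3) (torsionCount n) = n ^ 8 * (unimodularPairs n).ncard := by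
  classical
  have : NeZero (n ^ 3) := ⟨pow_ne_zero 3 hn⟩
  have h := (projReps_spec hn).2.2.2
  have h1 : cubeSum (n ^ 3) (torsionCount n) =
      ∑ v ∈ projReps n, ∑ r ∈ Finset.range n, cubeSum (n ^ 3) fun f =>
        if TorsionCond n r (completedAct v f) then 1 else 0 := by
    simp_rw [← cubeSum_sum]
    congr 1
    funext f
    rw [torsionCount]
    simp_rw [Finset.card_filter]
  rw [h1, ← h]
  rw [Finset.sum_congr (g := fun _ => n ^ 8 * n.totient) rfl fun v hv => ?_]
  · rw [Finset.sum_const, smul_eq_mul]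
    ring
  rw [← sum_cubeSum_torsionCond n hn]
  refine Finset.sum_congr rfl fun r _ => ?_
  refine cubeSum_formAct (F := fun f => if TorsionCond n r f then 1 else 0) (fun f g hfg => ?_)
    (completion_det ((projReps_spec hn).1 v hv))
  simp only [isPeriodicMod_torsionCond n hn r f g hfg]

/-- The integer quadruples with all coordinates in `[-H, H]`. -/
noncomputable def coeffBox (H : ℕ) : Finset (ℤ × ℤ × ℤ × ℤ) :=
  Finset.Icc (-H : ℤ) H ×ˢ Finset.Icc (-H : ℤ) H ×ˢ Finset.Icc (-H : ℤ) H ×ˢ Finset.Icc (-H : ℤ) H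

/-- The integer triples with all coordinates in `[-H, H]`. -/
noncomputable def coeffBoxThree (H : ℕ) : Finset (ℤ × ℤ × ℤ) :=
  Finset.Icc (-H : ℤ) H ×ˢ Finset.Icc (-H : ℤ) H ×ˢ Finset.Icc (-H : ℤ) H

/-- The quadruples in the coefficient box whose discriminant has the sign of `s`. -/
noncomputable def signedBox (s : ℤ) (H : ℕ) : Finset (ℤ × ℤ × ℤ × ℤ) :=
  (coeffBox H).filter fun f => 0 < s * tupleDisc f

theorem card_Icc_neg (H : ℕ) : (Finset.Icc (-H : ℤ) H).card = 2 * H + 1 := by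
  rw [Int.card_Icc]
  lia

theorem card_coeffBoxThree (H : ℕ) : (coeffBoxThree H).card = (2 * H + 1) ^ 3 := by
  simp only [coeffBoxThree, Finset.card_product, card_Icc_neg]
  ring

theorem mem_coeffBox {H : ℕ} {f : ℤ × ℤ × ℤ × ℤ} : f ∈ coeffBox H ↔
    |f.1| ≤ H ∧ |f.2.1| ≤ H ∧ |f.2.2.1| ≤ H ∧ |f.2.2.2| ≤ H := by
  simp only [coeffBox, Finset.mem_product, Finset.mem_Icc, abs_le]

theorem mem_coeffBoxThree {H : ℕ} {f : ℤ × ℤ × ℤ} : f ∈ coeffBoxThree H ↔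
    |f.1| ≤ H ∧ |f.2.1| ≤ H ∧ |f.2.2| ≤ H := by
  simp only [coeffBoxThree, Finset.mem_product, Finset.mem_Icc, abs_le]

open Polynomial in
theorem card_sign_changes_le {p : ℝ[X]} {S : Finset ℤ}
    (hS : ∀ x ∈ S, 0 < p.eval (x : ℝ) ∧ p.eval ((x : ℝ) - 1) ≤ 0) : S.card ≤ p.natDegree := by
  classical
  have hroot : ∀ x ∈ S, ∃ c : ℝ, p.IsRoot c ∧ ⌊c⌋ = x - 1 := by
    intro x hx
    obtain ⟨c, ⟨hc1, hc2⟩, hc⟩ := intermediate_value_Icc (f := fun y => p.eval y)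
      (by linarith : (x : ℝ) - 1 ≤ x) p.continuous.continuousOn ⟨(hS x hx).2, (hS x hx).1.le⟩
    refine ⟨c, hc, Int.floor_eq_iff.2 ⟨by push_cast; exact hc1, ?_⟩⟩
    push_cast
    rw [sub_add_cancel]
    refine lt_of_le_of_ne hc2 ?_
    rintro rfl
    exact (hS x hx).1.ne' hc
  choose! c hc using hroot
  have hp : ∀ x ∈ S, p ≠ 0 := by
    rintro x hx rfl
    simpa using (hS x hx).1
  calc S.card ≤ p.roots.toFinset.card := by
        refine Finset.card_le_card_of_injOn c (fun x hx => ?_) fun x hx y hy h => ?_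
        · rw [Finset.mem_coe, Multiset.mem_toFinset, mem_roots (hp x hx)]
          exact (hc x hx).1
        · have h1 := (hc x hx).2
          have h2 := (hc y hy).2
          rw [h, h2] at h1
          linarith
    _ ≤ p.natDegree := (Multiset.toFinset_card_le _).trans p.card_roots'

open Polynomial in
theorem card_signedBox_boundary_le (s : ℤ) (H : ℕ) (κ : ℤ × ℤ × ℤ × ℤ → ℤ)
    (π : ℤ × ℤ × ℤ × ℤ → ℤ × ℤ × ℤ) (P : ℤ × ℤ × ℤ → ℝ[X]) (e : ℤ × ℤ × ℤ × ℤ)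
    (hinj : ∀ f g, κ f = κ g → π f = π g → f = g) (hdeg : ∀ b, (P b).natDegree ≤ 3)
    (heval : ∀ f, (P (π f)).eval (κ f : ℝ) = (s * tupleDisc f : ℤ))
    (hκ : ∀ f, κ (f - e) = κ f - 1) (hπ : ∀ f, π (f - e) = π f)
    (hbox : ∀ f ∈ coeffBox H, π f ∈ coeffBoxThree H)
    (hbd : ∀ f ∈ coeffBox H, f - e ∉ coeffBox H → κ f = -H) :
    ((signedBox s H).filter fun f => f - e ∉ signedBox s H).card ≤ 4 * (2 * H + 1) ^ 3 := by
  classical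
  rw [← card_coeffBoxThree]
  refine Finset.card_le_mul_card_image_of_maps_to (f := π) (fun f hf => ?_) 4 fun b _ => ?_
  · exact hbox f (Finset.mem_filter.1 (Finset.mem_filter.1 hf).1).1
  set T := ((signedBox s H).filter fun f => f - e ∉ signedBox s H).filter fun f => π f = b
  have hT : ∀ f ∈ T, f ∈ coeffBox H ∧ 0 < s * tupleDisc f ∧ f - e ∉ signedBox s H ∧ π f = b := by
    intro f hf
    simp only [T, Finset.mem_filter, signedBox] at hf ⊢
    tauto
  have h1 : (T.filter fun f => κ f = -H).card ≤ 1 := by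
    refine Finset.card_le_one.2 fun f hf g hg => ?_
    rw [Finset.mem_filter] at hf hg
    exact hinj f g (hf.2.trans hg.2.symm) ((hT f hf.1).2.2.2.trans (hT g hg.1).2.2.2.symm)
  have h2 : (T.filter fun f => ¬ κ f = -H).card ≤ 3 := by
    have hci : Set.InjOn κ (T.filter fun f => ¬ κ f = -H) := by
      intro f hf g hg h
      rw [Finset.mem_coe, Finset.mem_filter] at hf hg
      exact hinj f g h ((hT f hf.1).2.2.2.trans (hT g hg.1).2.2.2.symm)
    rw [← Finset.card_image_of_injOn hci]
    refine (card_sign_changes_le (p := P b) fun x hx => ?_).trans (hdeg b)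
    obtain ⟨f, hf, rfl⟩ := Finset.mem_image.1 hx
    obtain ⟨hfT, hfH⟩ := Finset.mem_filter.1 hf
    obtain ⟨g1, g2, g3, rfl⟩ := hT f hfT
    refine ⟨by rw [heval]; exact_mod_cast g2, ?_⟩
    have h3 := heval (f - e)
    rw [hπ, hκ] at h3
    push_cast at h3
    rw [h3]
    by_contra! hcon
    refine g3 (Finset.mem_filter.2 ⟨?_, by exact_mod_cast hcon⟩)
    by_contra hnot
    exact hfH (hbd f g1 hnot)
  rw [← Finset.card_filter_add_card_filter_not (s := T) fun f => κ f = -H]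
  lia

theorem abs_sum_shift_sub_le {G : Type*} [AddCommGroup G] [DecidableEq G] (B : Finset G) (e : G)
    {F : G → ℝ} {K : ℝ} (hF : ∀ f, |F f| ≤ K) :
    |∑ f ∈ B, F (f + e) - ∑ f ∈ B, F f| ≤ 2 * K * (B.filter fun f => f - e ∉ B).card := by
  have h1 : ∑ f ∈ B, F (f + e) = ∑ f ∈ B.map (addRightEmbedding e), F f := by
    rw [Finset.sum_map]
    rfl
  have h2 : (B.filter fun f => f - e ∉ B) = B \ B.map (addRightEmbedding e) := by
    ext f
    simp only [Finset.mem_filter, Finset.mem_sdiff, Finset.mem_map, addRightEmbedding_apply]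
    refine and_congr_right fun _ => not_congr ⟨fun h => ⟨_, h, sub_add_cancel f e⟩, ?_⟩
    rintro ⟨g, hg, rfl⟩
    simpa using hg
  have h3 : ∀ C : Finset G, |∑ f ∈ C, F f| ≤ K * C.card := fun C =>
    (Finset.abs_sum_le_sum_abs _ _).trans ((Finset.sum_le_card_nsmul _ _ _ fun f _ => hF f).trans
      (by rw [nsmul_eq_mul, mul_comm]))
  rw [h1, h2, ← Finset.sum_sdiff_sub_sum_sdiff]
  refine (abs_sub _ _).trans ?_
  have h4 := Finset.card_sdiff_comm (s := B.map (addRightEmbedding e)) (t := B)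
    (Finset.card_map _)
  have h5 := h3 (B.map (addRightEmbedding e) \ B)
  have h6 := h3 (B \ B.map (addRightEmbedding e))
  rw [h4] at h5
  linarith

theorem abs_sum_nsmul_shift_sub_le {G : Type*} [AddCommGroup G] [DecidableEq G] {B : Finset G}
    {e : G} {F : G → ℝ} {K D : ℝ} (hF : ∀ f, |F f| ≤ K)
    (hD : (B.filter fun f => f - e ∉ B).card ≤ D) (n : ℕ) (g : G) :
    |∑ f ∈ B, F (f + (g + n • e)) - ∑ f ∈ B, F (f + g)| ≤ n * (2 * K * D) := by
  have hK : 0 ≤ K := (abs_nonneg _).trans (hF 0)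
  induction n with
  | zero => simp
  | succ n ih =>
    have h := abs_sum_shift_sub_le B e (F := fun f => F (f + (g + n • e))) fun f => hF _
    have h2 : ∀ f, f + (g + (n + 1) • e) = f + e + (g + n • e) := fun f => by
      rw [succ_nsmul]
      abel
    simp_rw [h2]
    have h3 := mul_le_mul_of_nonneg_left hD (by positivity : 0 ≤ 2 * K)
    have h4 := abs_sub_le (∑ f ∈ B, F (f + e + (g + n • e))) (∑ f ∈ B, F (f + (g + n • e)))
      (∑ f ∈ B, F (f + g))
    push_cast
    linarith

section Boundary

variable (s : ℤ) (H : ℕ)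

open Polynomial

theorem card_signedBox_boundary_fst :
    ((signedBox s H).filter fun f => f - (1, 0, 0, 0) ∉ signedBox s H).card ≤
      4 * (2 * H + 1) ^ 3 := by
  refine card_signedBox_boundary_le s H (fun f => f.1) (fun f => f.2)
    (fun b => C (0 : ℝ) * X ^ 3 + C (s * (-27 * b.2.2 ^ 2) : ℝ) * X ^ 2 +
      C (s * (18 * b.1 * b.2.1 * b.2.2 - 4 * b.2.1 ^ 3) : ℝ) * X +
      C (s * (b.1 ^ 2 * b.2.1 ^ 2 - 4 * b.1 ^ 3 * b.2.2) : ℝ)) _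
    (fun f g h1 h2 => Prod.ext h1 h2) (fun b => natDegree_cubic_le) (fun f => ?_) (fun f => rfl)
    (fun f => by simp) (fun f hf => ?_) (fun f hf hf' => ?_)
  · simp [tupleDisc, cubicDisc]
    ring
  · rw [mem_coeffBox] at hf
    exact mem_coeffBoxThree.2 hf.2
  · rw [mem_coeffBox] at hf hf'
    simp only [Prod.fst_sub, Prod.snd_sub, sub_zero] at hf'
    have h1 : ¬ |f.1 - 1| ≤ H := fun h => hf' ⟨h, hf.2⟩
    have := abs_le.1 hf.1
    rw [abs_le] at h1
    lia

theorem card_signedBox_boundary_snd :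
    ((signedBox s H).filter fun f => f - (0, 1, 0, 0) ∉ signedBox s H).card ≤
      4 * (2 * H + 1) ^ 3 := by
  refine card_signedBox_boundary_le s H (fun f => f.2.1) (fun f => (f.1, f.2.2))
    (fun b => C (s * (-4 * b.2.2) : ℝ) * X ^ 3 + C (s * b.2.1 ^ 2 : ℝ) * X ^ 2 +
      C (s * (18 * b.1 * b.2.1 * b.2.2) : ℝ) * X +
      C (s * (-4 * b.1 * b.2.1 ^ 3 - 27 * b.1 ^ 2 * b.2.2 ^ 2) : ℝ)) _
    (fun f g h1 h2 => ?_) (fun b => natDegree_cubic_le) (fun f => ?_) (fun f => rfl)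
    (fun f => by simp) (fun f hf => ?_) (fun f hf hf' => ?_)
  · simp only [Prod.mk.injEq] at h2
    exact Prod.ext h2.1 (Prod.ext h1 h2.2)
  · simp [tupleDisc, cubicDisc]
    ring
  · rw [mem_coeffBox] at hf
    exact mem_coeffBoxThree.2 ⟨hf.1, hf.2.2⟩
  · rw [mem_coeffBox] at hf hf'
    simp only [Prod.fst_sub, Prod.snd_sub, sub_zero] at hf'
    have h1 : ¬ |f.2.1 - 1| ≤ H := fun h => hf' ⟨hf.1, h, hf.2.2⟩
    have := abs_le.1 hf.2.1
    rw [abs_le] at h1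
    lia

theorem card_signedBox_boundary_trd :
    ((signedBox s H).filter fun f => f - (0, 0, 1, 0) ∉ signedBox s H).card ≤
      4 * (2 * H + 1) ^ 3 := by
  refine card_signedBox_boundary_le s H (fun f => f.2.2.1) (fun f => (f.1, f.2.1, f.2.2.2))
    (fun b => C (s * (-4 * b.1) : ℝ) * X ^ 3 + C (s * b.2.1 ^ 2 : ℝ) * X ^ 2 +
      C (s * (18 * b.1 * b.2.1 * b.2.2) : ℝ) * X +
      C (s * (-4 * b.2.1 ^ 3 * b.2.2 - 27 * b.1 ^ 2 * b.2.2 ^ 2) : ℝ)) _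
    (fun f g h1 h2 => ?_) (fun b => natDegree_cubic_le) (fun f => ?_) (fun f => rfl)
    (fun f => by simp) (fun f hf => ?_) (fun f hf hf' => ?_)
  · simp only [Prod.mk.injEq] at h2
    exact Prod.ext h2.1 (Prod.ext h2.2.1 (Prod.ext h1 h2.2.2))
  · simp [tupleDisc, cubicDisc]
    ring
  · rw [mem_coeffBox] at hf
    exact mem_coeffBoxThree.2 ⟨hf.1, hf.2.1, hf.2.2.2⟩
  · rw [mem_coeffBox] at hf hf'
    simp only [Prod.fst_sub, Prod.snd_sub, sub_zero] at hf'
    have h1 : ¬ |f.2.2.1 - 1| ≤ H := fun h => hf' ⟨hf.1, hf.2.1, h, hf.2.2.2⟩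
    have := abs_le.1 hf.2.2.1
    rw [abs_le] at h1
    lia

theorem card_signedBox_boundary_fth :
    ((signedBox s H).filter fun f => f - (0, 0, 0, 1) ∉ signedBox s H).card ≤
      4 * (2 * H + 1) ^ 3 := by
  refine card_signedBox_boundary_le s H (fun f => f.2.2.2) (fun f => (f.1, f.2.1, f.2.2.1))
    (fun b => C (0 : ℝ) * X ^ 3 + C (s * (-27 * b.1 ^ 2) : ℝ) * X ^ 2 +
      C (s * (18 * b.1 * b.2.1 * b.2.2 - 4 * b.2.1 ^ 3) : ℝ) * X +
      C (s * (b.2.1 ^ 2 * b.2.2 ^ 2 - 4 * b.1 * b.2.2 ^ 3) : ℝ)) _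
    (fun f g h1 h2 => ?_) (fun b => natDegree_cubic_le) (fun f => ?_) (fun f => rfl)
    (fun f => by simp) (fun f hf => ?_) (fun f hf hf' => ?_)
  · simp only [Prod.mk.injEq] at h2
    exact Prod.ext h2.1 (Prod.ext h2.2.1 (Prod.ext h2.2.2 h1))
  · simp [tupleDisc, cubicDisc]
    ring
  · rw [mem_coeffBox] at hf
    exact mem_coeffBoxThree.2 ⟨hf.1, hf.2.1, hf.2.2.1⟩
  · rw [mem_coeffBox] at hf hf'
    simp only [Prod.fst_sub, Prod.snd_sub, sub_zero] at hf'
    have h1 : ¬ |f.2.2.2 - 1| ≤ H := fun h => hf' ⟨hf.1, hf.2.1, hf.2.2.1, h⟩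
    have := abs_le.1 hf.2.2.2
    rw [abs_le] at h1
    lia

end Boundary

theorem abs_sum_signedBox_shift_sub_le (s : ℤ) (H : ℕ) {F : ℤ × ℤ × ℤ × ℤ → ℝ} {K : ℝ}
    (hF : ∀ f, |F f| ≤ K) (i j k l : ℕ) :
    |∑ f ∈ signedBox s H, F (f + ((i : ℤ), (j : ℤ), (k : ℤ), (l : ℤ))) -
      ∑ f ∈ signedBox s H, F f| ≤ (i + j + k + l) * (8 * K * (2 * H + 1) ^ 3) := by
  have cast : ∀ {m : ℕ}, m ≤ 4 * (2 * H + 1) ^ 3 → (m : ℝ) ≤ 4 * (2 * H + 1) ^ 3 :=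
    fun h => by exact_mod_cast h
  have h1 := abs_sum_nsmul_shift_sub_le (B := signedBox s H) hF
    (cast (card_signedBox_boundary_fst s H)) i 0
  have h2 := abs_sum_nsmul_shift_sub_le (B := signedBox s H) hF
    (cast (card_signedBox_boundary_snd s H)) j (0 + i • (1, 0, 0, 0))
  have h3 := abs_sum_nsmul_shift_sub_le (B := signedBox s H) hF
    (cast (card_signedBox_boundary_trd s H)) k (0 + i • (1, 0, 0, 0) + j • (0, 1, 0, 0))
  have h4 := abs_sum_nsmul_shift_sub_le (B := signedBox s H) hF
    (cast (card_signedBox_boundary_fth s H)) l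
    (0 + i • (1, 0, 0, 0) + j • (0, 1, 0, 0) + k • (0, 0, 1, 0))
  have h5 : (0 + i • (1, 0, 0, 0) + j • (0, 1, 0, 0) + k • (0, 0, 1, 0) + l • (0, 0, 0, 1) :
      ℤ × ℤ × ℤ × ℤ) = ((i : ℤ), (j : ℤ), (k : ℤ), (l : ℤ)) := by simp
  rw [h5] at h4
  simp only [add_zero] at h1
  rw [abs_le] at *
  constructor <;> linarith [h1.1, h2.1, h3.1, h4.1, h1.2, h2.2, h3.2, h4.2]

theorem cubeSum_shift {A : Type*} [AddCommMonoid A] {M : ℕ} [NeZero M]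
    {F : ℤ × ℤ × ℤ × ℤ → A} (hF : IsPeriodicMod M F)
    (f : ℤ × ℤ × ℤ × ℤ) : cubeSum M (fun t => F (f + t)) = cubeSum M F := by
  rw [cubeSum_eq_sum_zmod, cubeSum_eq_sum_zmod]
  refine Fintype.sum_equiv (Equiv.addLeft (reduceMod M f)) _ _ fun z => hF _ _ ?_
  rw [reduceMod_liftMod, Equiv.coe_addLeft]
  conv_rhs => rw [← reduceMod_liftMod M z]
  simp [reduceMod]

theorem abs_sum_signedBox_sub_le (s : ℤ) (H : ℕ) {M : ℕ} [NeZero M] {F : ℤ × ℤ × ℤ × ℤ → ℝ}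
    {K : ℝ} (hF : ∀ f, |F f| ≤ K) (hM : IsPeriodicMod M F) :
    |∑ f ∈ signedBox s H, F f - (signedBox s H).card * (cubeSum M F / M ^ 4)| ≤
      32 * M * K * (2 * H + 1) ^ 3 := by
  have hK : 0 ≤ K := (abs_nonneg _).trans (hF 0)
  have hM0 : (0 : ℝ) < M := by exact_mod_cast NeZero.pos M
  set S := ∑ f ∈ signedBox s H, F f
  have hcube : ∀ c : ℝ, cubeSum M (fun _ => c) = M ^ 4 * c := fun c => by
    simp only [cubeSum, Finset.sum_const, Finset.card_range, nsmul_eq_mul]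
    ring
  have h1 : (signedBox s H).card * cubeSum M F =
      cubeSum M fun t => ∑ f ∈ signedBox s H, F (f + t) := by
    rw [cubeSum_sum, Finset.sum_congr rfl fun f _ => cubeSum_shift hM f, Finset.sum_const,
      nsmul_eq_mul]
  have h2 : |M ^ 4 * S - (signedBox s H).card * cubeSum M F| ≤
      M ^ 4 * (32 * M * K * (2 * H + 1) ^ 3) := by
    rw [h1, ← hcube, ← hcube]
    simp only [cubeSum, ← Finset.sum_sub_distrib]
    refine (Finset.abs_sum_le_sum_abs _ _).trans (Finset.sum_le_sum fun i hi => ?_)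
    refine (Finset.abs_sum_le_sum_abs _ _).trans (Finset.sum_le_sum fun j hj => ?_)
    refine (Finset.abs_sum_le_sum_abs _ _).trans (Finset.sum_le_sum fun k hk => ?_)
    refine (Finset.abs_sum_le_sum_abs _ _).trans (Finset.sum_le_sum fun l hl => ?_)
    have cast : ∀ {m : ℕ}, m ∈ Finset.range M → (m : ℝ) ≤ M := fun h => by
      exact_mod_cast (Finset.mem_range.1 h).le
    have h3 : ((i : ℝ) + j + k + l) ≤ 4 * M := by
      linarith [cast hi, cast hj, cast hk, cast hl]
    have h4 := mul_le_mul_of_nonneg_right h3 (by positivity : 0 ≤ 8 * K * (2 * (H : ℝ) + 1) ^ 3)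
    rw [abs_sub_comm]
    refine (abs_sum_signedBox_shift_sub_le s H hF i j k l).trans (h4.trans (le_of_eq (by ring)))
  have h5 : S - (signedBox s H).card * (cubeSum M F / M ^ 4) =
      (M ^ 4 * S - (signedBox s H).card * cubeSum M F) / M ^ 4 := by
    field_simp
  rw [h5, abs_div, abs_of_pos (by positivity : (0 : ℝ) < M ^ 4), div_le_iff₀ (by positivity)]
  linarith

theorem tupleDisc_sign {s k a b c d : ℤ} (hs : s = 1 ∨ s = -1) (hk : 0 < k) (ha : |a| ≤ k)
    (hc : |c| ≤ k) (hb : 10 * k ≤ b) (hb' : b ≤ 20 * k) (hd : 10 * k ≤ d) (hd' : d ≤ 20 * k) :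
    0 < s * tupleDisc (a, b, c, -s * d) := by
  have hss : s * s = 1 := by rcases hs with rfl | rfl <;> norm_num
  have hsa : |s| = 1 := by rcases hs with rfl | rfl <;> norm_num
  have hba : |b| ≤ 20 * k := by rw [abs_le]; constructor <;> linarith
  have hda : |d| ≤ 20 * k := by rw [abs_le]; constructor <;> linarith
  have h1 : |18 * a * b * c * d| ≤ 18 * k * (20 * k) * k * (20 * k) := by
    simp only [abs_mul, abs_of_pos (by norm_num : (0 : ℤ) < 18)]
    gcongr
  have h2 : |s * b ^ 2 * c ^ 2| ≤ 1 * (20 * k) ^ 2 * k ^ 2 := by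
    simp only [abs_mul, abs_pow, hsa]
    gcongr
  have h3 : |4 * s * a * c ^ 3| ≤ 4 * 1 * k * k ^ 3 := by
    simp only [abs_mul, abs_pow, hsa, abs_of_pos (by norm_num : (0 : ℤ) < 4)]
    gcongr
  have h4 : |27 * s * a ^ 2 * d ^ 2| ≤ 27 * 1 * k ^ 2 * (20 * k) ^ 2 := by
    simp only [abs_mul, abs_pow, hsa, abs_of_pos (by norm_num : (0 : ℤ) < 27)]
    gcongr
  have h5 : 4 * (10 * k) ^ 3 * (10 * k) ≤ 4 * b ^ 3 * d := by
    have hb0 : 0 ≤ b := by linarith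
    gcongr
  have h6 : s * tupleDisc (a, b, c, -s * d) = -(18 * a * b * c * d) + 4 * b ^ 3 * d +
      s * b ^ 2 * c ^ 2 - 4 * s * a * c ^ 3 - 27 * s * a ^ 2 * d ^ 2 := by
    simp only [tupleDisc, cubicDisc]
    linear_combination (-18 * a * b * c * d + 4 * b ^ 3 * d - 27 * s * a ^ 2 * d ^ 2) * hss
  rw [h6]
  have h7 : 0 < k ^ 4 := by positivity
  rw [abs_le] at h1 h2 h3 h4
  linarith [h1.2, h2.1, h3.2, h4.2]

theorem card_signedBox_ge {s : ℤ} (hs : s = 1 ∨ s = -1) {H : ℕ} (hH : 20 ≤ H) :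
    (H : ℝ) ^ 4 ≤ 6400 * (signedBox s H).card := by
  classical
  obtain ⟨k, hk⟩ : ∃ k, k = H / 20 := ⟨_, rfl⟩
  have hk1 : 1 ≤ k := by lia
  have hk2 : 20 * k ≤ H := by lia
  have hk3 : H ≤ 40 * k := by lia
  have hinj : Function.Injective fun f : ℤ × ℤ × ℤ × ℤ => (f.1, f.2.1, f.2.2.1, -s * f.2.2.2) := by
    rintro ⟨a, b, c, d⟩ ⟨a', b', c', d'⟩ h
    simp only [Prod.mk.injEq] at h ⊢
    refine ⟨h.1, h.2.1, h.2.2.1, ?_⟩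
    rcases hs with rfl | rfl <;> lia
  have hsub : (Finset.Icc (-k : ℤ) k ×ˢ Finset.Icc (10 * k : ℤ) (20 * k) ×ˢ
      Finset.Icc (-k : ℤ) k ×ˢ Finset.Icc (10 * k : ℤ) (20 * k)).image
        (fun f : ℤ × ℤ × ℤ × ℤ => (f.1, f.2.1, f.2.2.1, -s * f.2.2.2)) ⊆ signedBox s H := by
    intro f hf
    obtain ⟨⟨a, b, c, d⟩, hg, rfl⟩ := Finset.mem_image.1 hf
    simp only [Finset.mem_product, Finset.mem_Icc] at hg
    obtain ⟨ha, hb, hc, hd⟩ := hg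
    refine Finset.mem_filter.2 ⟨mem_coeffBox.2 ?_, tupleDisc_sign hs (k := k) (by lia)
      (abs_le.2 ha) (abs_le.2 hc) hb.1 hb.2 hd.1 hd.2⟩
    simp only [abs_le]
    rcases hs with rfl | rfl <;> lia
  have hcard := Finset.card_le_card hsub
  rw [Finset.card_image_of_injective _ hinj] at hcard
  simp only [Finset.card_product, Int.card_Icc] at hcard
  have h1 : ((k : ℤ) + 1 - -k).toNat = 2 * k + 1 := by lia
  have h2 : (20 * (k : ℤ) + 1 - 10 * k).toNat = 10 * k + 1 := by lia
  rw [h1, h2] at hcard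
  have h3 : 400 * k ^ 4 ≤ (signedBox s H).card := by
    refine le_trans ?_ hcard
    calc 400 * k ^ 4 = (2 * k) * ((10 * k) * ((2 * k) * (10 * k))) := by ring
      _ ≤ _ := by gcongr <;> lia
  have h4 : (400 : ℝ) * k ^ 4 ≤ (signedBox s H).card := by exact_mod_cast h3
  have h5 : (H : ℝ) ^ 4 ≤ (40 * k) ^ 4 := by
    gcongr
    exact_mod_cast hk3
  linarith

theorem succ_pow_le_two_pow (k : ℕ) : ∃ A : ℕ, ∀ e : ℕ, (e + 1) ^ k ≤ A * 2 ^ e := by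
  have h : Filter.Tendsto (fun e : ℕ => ((e : ℝ)) ^ k / 2 ^ e) Filter.atTop (nhds 0) :=
    tendsto_pow_const_div_const_pow_of_one_lt k (by norm_num)
  obtain ⟨B, hB⟩ := (h.isBoundedUnder_le).bddAbove_range
  obtain ⟨A, hA⟩ := exists_nat_ge (B * 2)
  refine ⟨A, fun e => ?_⟩
  have h1 : ((e + 1 : ℕ) : ℝ) ^ k / 2 ^ (e + 1) ≤ B := hB ⟨e + 1, rfl⟩
  rw [div_le_iff₀ (by positivity), pow_succ] at h1
  have h2 : ((e : ℝ) + 1) ^ k ≤ A * 2 ^ e := by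
    push_cast at h1
    nlinarith [pow_pos (two_pos : (0 : ℝ) < 2) e]
  exact_mod_cast h2

theorem card_divisors_pow_le (k : ℕ) :
    ∃ C : ℕ, 0 < C ∧ ∀ n : ℕ, n ≠ 0 → n.divisors.card ^ k ≤ C * n := by
  obtain ⟨A, hA⟩ := succ_pow_le_two_pow k
  have hA1 : 1 ≤ A := by simpa using hA 0
  refine ⟨A ^ (2 ^ k), by positivity, fun n hn => ?_⟩
  rw [Nat.card_divisors hn, ← Finset.prod_pow]
  calc ∏ p ∈ n.primeFactors, (n.factorization p + 1) ^ k
      ≤ ∏ p ∈ n.primeFactors, (if p < 2 ^ k then A else 1) * p ^ n.factorization p := by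
        refine Finset.prod_le_prod' fun p hp => ?_
        have hp2 := (Nat.prime_of_mem_primeFactors hp).two_le
        split_ifs with h
        · exact (hA _).trans (by gcongr)
        · rw [one_mul]
          calc (n.factorization p + 1) ^ k ≤ (2 ^ n.factorization p) ^ k := by
                gcongr
                exact Nat.lt_two_pow_self
            _ = (2 ^ k) ^ n.factorization p := by rw [← pow_mul, ← pow_mul, mul_comm]
            _ ≤ _ := by
              gcongr
              exact not_lt.1 h
    _ = A ^ (n.primeFactors.filter fun p => p < 2 ^ k).card * n := by
        rw [Finset.prod_mul_distrib, ← Finset.prod_filter, Finset.prod_const]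
        congr 1
        exact Nat.prod_factorization_pow_eq_self hn
    _ ≤ A ^ (2 ^ k) * n := by
        gcongr
        calc _ ≤ (Finset.range (2 ^ k)).card := Finset.card_le_card fun p hp =>
              Finset.mem_range.2 (Finset.mem_filter.1 hp).2
          _ = _ := Finset.card_range _

/-- The largest number of divisors of a positive integer up to `N`. -/
def maxDivisors (N : ℕ) : ℕ := (Finset.Icc 1 N).sup fun n => n.divisors.card

theorem card_divisors_le_maxDivisors {n N : ℕ} (hn : n ≠ 0) (hN : n ≤ N) :
    n.divisors.card ≤ maxDivisors N :=
  Finset.le_sup (f := fun n => n.divisors.card) (Finset.mem_Icc.2 ⟨by lia, hN⟩)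

theorem maxDivisors_pow_le (k : ℕ) (hk : k ≠ 0) : ∃ C : ℕ, ∀ N, maxDivisors N ^ k ≤ C * N := by
  obtain ⟨C, -, hC⟩ := card_divisors_pow_le k
  refine ⟨C, fun N => ?_⟩
  rcases (Finset.Icc 1 N).eq_empty_or_nonempty with h | h
  · simp [maxDivisors, h, hk]
  · obtain ⟨n, hn, h2⟩ := Finset.exists_mem_eq_sup _ h fun n : ℕ => n.divisors.card
    rw [maxDivisors, h2]
    rw [Finset.mem_Icc] at hn
    exact (hC n (by lia)).trans (by gcongr; exact hn.2)

open Classical in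
/-- The integers dividing `m`. -/
noncomputable def intDivisors (m : ℤ) : Finset ℤ :=
  m.natAbs.divisors.image (fun n : ℕ => (n : ℤ)) ∪ m.natAbs.divisors.image (fun n : ℕ => -(n : ℤ))

theorem mem_intDivisors {m x : ℤ} (hm : m ≠ 0) (hx : x ∣ m) : x ∈ intDivisors m := by
  rw [intDivisors, Finset.mem_union]
  have h : x.natAbs ∈ m.natAbs.divisors :=
    Nat.mem_divisors.2 ⟨Int.natAbs_dvd_natAbs.2 hx, Int.natAbs_ne_zero.2 hm⟩
  rcases Int.natAbs_eq x with h1 | h1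
  · exact Or.inl (Finset.mem_image.2 ⟨_, h, h1.symm⟩)
  · exact Or.inr (Finset.mem_image.2 ⟨_, h, h1.symm⟩)

theorem card_intDivisors_le {m : ℤ} {N : ℕ} (hm : m ≠ 0) (hN : |m| ≤ N) :
    (intDivisors m).card ≤ 2 * maxDivisors N := by
  classical
  have h := card_divisors_le_maxDivisors (Int.natAbs_ne_zero.2 hm) (N := N)
    (by rw [Int.abs_eq_natAbs] at hN; exact_mod_cast hN)
  rw [intDivisors]
  refine (Finset.card_union_le _ _).trans ?_
  have h1 := Finset.card_image_le (s := m.natAbs.divisors) (f := fun n : ℕ => (n : ℤ))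
  have h2 := Finset.card_image_le (s := m.natAbs.divisors) (f := fun n : ℕ => -(n : ℤ))
  lia

/-- The irreducible forms in the signed coefficient box. -/
noncomputable def irredBox (s : ℤ) (H : ℕ) : Finset (ℤ × ℤ × ℤ × ℤ) := by
  classical exact (signedBox s H).filter fun f => IsIrredCubicForm f.1 f.2.1 f.2.2.1 f.2.2.2

theorem mem_irredBox {s : ℤ} {H : ℕ} {f : ℤ × ℤ × ℤ × ℤ} : f ∈ irredBox s H ↔
    f ∈ signedBox s H ∧ IsIrredCubicForm f.1 f.2.1 f.2.2.1 f.2.2.2 := by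
  classical
  rw [irredBox, Finset.mem_filter]

theorem irredBox_subset (s : ℤ) (H : ℕ) : irredBox s H ⊆ signedBox s H :=
  fun _ hf => (mem_irredBox.1 hf).1

theorem IsIrredCubicForm.last_ne_zero {a b c d : ℤ} (h : IsIrredCubicForm a b c d) : d ≠ 0 := by
  rintro rfl
  have h1 := (Polynomial.irreducible_iff_roots_eq_zero_of_degree_le_three
    (by rw [natDegree_cubicPolyQ h.1]; norm_num) (natDegree_cubicPolyQ h.1).le).1 h.2
  have h2 : (0 : ℚ) ∈ (cubicPolyQ a b c 0).roots := by
    rw [Polynomial.mem_roots h.2.ne_zero, Polynomial.IsRoot.def]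
    simp [cubicPolyQ]
  rw [h1] at h2
  exact absurd h2 (Multiset.notMem_zero _)

theorem exists_root_of_not_irred {a b c d : ℤ} (ha : a ≠ 0) (hd : d ≠ 0)
    (h : ¬ IsIrredCubicForm a b c d) : ∃ p q : ℤ, p ≠ 0 ∧ q ≠ 0 ∧ p ∣ d ∧ q ∣ a ∧
      a * p ^ 3 + b * p ^ 2 * q + c * p * q ^ 2 + d * q ^ 3 = 0 := by
  have h1 : (cubicPolyQ a b c d).roots ≠ 0 := fun h0 => h ⟨ha,
    (Polynomial.irreducible_iff_roots_eq_zero_of_degree_le_three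
      (by rw [natDegree_cubicPolyQ ha]; norm_num) (natDegree_cubicPolyQ ha).le).2 h0⟩
  obtain ⟨x, hx⟩ := Multiset.exists_mem_of_ne_zero h1
  have hx' := Polynomial.isRoot_of_mem_roots hx
  simp only [cubicPolyQ, Polynomial.IsRoot.def, Polynomial.eval_add, Polynomial.eval_mul,
    Polynomial.eval_C, Polynomial.eval_pow, Polynomial.eval_X] at hx'
  have hq : (x.den : ℚ) ≠ 0 := by exact_mod_cast x.den_ne_zero
  have key : a * x.num ^ 3 + b * x.num ^ 2 * x.den + c * x.num * x.den ^ 2 +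
      d * (x.den : ℤ) ^ 3 = 0 := by
    have h2 : (a * x.num ^ 3 + b * x.num ^ 2 * x.den + c * x.num * x.den ^ 2 +
        d * (x.den : ℚ) ^ 3) = 0 := by
      rw [← Rat.num_div_den x] at hx'
      field_simp at hx'
      linear_combination hx'
    exact_mod_cast h2
  have hcop : IsCoprime x.num (x.den : ℤ) := by
    rw [Int.isCoprime_iff_nat_coprime]
    exact x.reduced
  have hden : (x.den : ℤ) ≠ 0 := by exact_mod_cast x.den_ne_zero
  refine ⟨x.num, x.den, ?_, hden, ?_, ?_, key⟩
  · intro h0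
    rw [h0] at key
    have : d * (x.den : ℤ) ^ 3 = 0 := by linear_combination key
    exact (mul_ne_zero hd (pow_ne_zero 3 hden)) this
  · exact (hcop.pow_right (n := 3)).dvd_of_dvd_mul_right
      ⟨-(a * x.num ^ 2 + b * x.num * x.den + c * x.den ^ 2), by linear_combination key⟩
  · exact (hcop.symm.pow_right (n := 3)).dvd_of_dvd_mul_right
      ⟨-(b * x.num ^ 2 + c * x.num * x.den + d * x.den ^ 2), by linear_combination key⟩

theorem card_reducible_le {s : ℤ} {H : ℕ} (hH : 1 ≤ H) :
    (signedBox s H \ irredBox s H).card ≤ 6 * maxDivisors H ^ 2 * (2 * H + 1) ^ 3 := by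
  classical
  have hD : 1 ≤ maxDivisors H := by
    simpa using card_divisors_le_maxDivisors (n := 1) one_ne_zero hH
  set T := signedBox s H \ irredBox s H
  have hT : ∀ f ∈ T, f ∈ coeffBox H ∧ ¬ IsIrredCubicForm f.1 f.2.1 f.2.2.1 f.2.2.2 := by
    intro f hf
    obtain ⟨h1, h2⟩ := Finset.mem_sdiff.1 hf
    exact ⟨(Finset.mem_filter.1 h1).1, fun h => h2 (mem_irredBox.2 ⟨h1, h⟩)⟩
  have h1 : (T.filter fun f => f.1 = 0).card ≤ (2 * H + 1) ^ 3 := by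
    rw [← card_coeffBoxThree]
    refine Finset.card_le_card_of_injOn (fun f => f.2) (fun f hf => ?_) fun f hf g hg h => ?_
    · rw [Finset.mem_coe, Finset.mem_filter] at hf
      exact mem_coeffBoxThree.2 (mem_coeffBox.1 (hT f hf.1).1).2
    · rw [Finset.mem_coe, Finset.mem_filter] at hf hg
      exact Prod.ext (hf.2.trans hg.2.symm) h
  have h2 : (T.filter fun f => f.2.2.2 = 0).card ≤ (2 * H + 1) ^ 3 := by
    rw [← card_coeffBoxThree]
    refine Finset.card_le_card_of_injOn (fun f => (f.1, f.2.1, f.2.2.1)) (fun f hf => ?_)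
      fun f hf g hg h => ?_
    · rw [Finset.mem_coe, Finset.mem_filter] at hf
      have := mem_coeffBox.1 (hT f hf.1).1
      exact mem_coeffBoxThree.2 ⟨this.1, this.2.1, this.2.2.1⟩
    · rw [Finset.mem_coe, Finset.mem_filter] at hf hg
      simp only [Prod.mk.injEq] at h
      exact Prod.ext h.1 (Prod.ext h.2.1 (Prod.ext h.2.2 (hf.2.trans hg.2.symm)))
  have h3 : (T.filter fun f => f.1 ≠ 0 ∧ f.2.2.2 ≠ 0).card ≤
      (2 * maxDivisors H * (2 * maxDivisors H)) * (2 * H + 1) ^ 3 := by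
    rw [← card_coeffBoxThree]
    refine Finset.card_le_mul_card_image_of_maps_to (f := fun f => (f.1, f.2.1, f.2.2.2))
      (fun f hf => ?_) _ fun b _ => ?_
    · have := mem_coeffBox.1 (hT f (Finset.mem_filter.1 hf).1).1
      exact mem_coeffBoxThree.2 ⟨this.1, this.2.1, this.2.2.2⟩
    set U := (T.filter fun f => f.1 ≠ 0 ∧ f.2.2.2 ≠ 0).filter
      fun f => (f.1, f.2.1, f.2.2.2) = b
    rcases U.eq_empty_or_nonempty with hU | ⟨f₀, hf₀⟩
    · simp [hU]
    have hU : ∀ f ∈ U, f ∈ coeffBox H ∧ ¬ IsIrredCubicForm f.1 f.2.1 f.2.2.1 f.2.2.2 ∧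
        f.1 ≠ 0 ∧ f.2.2.2 ≠ 0 ∧ f.1 = b.1 ∧ f.2.1 = b.2.1 ∧ f.2.2.2 = b.2.2 := by
      intro f hf
      simp only [U, Finset.mem_filter] at hf
      obtain ⟨⟨g1, g2, g3⟩, rfl⟩ := hf
      exact ⟨(hT f g1).1, (hT f g1).2, g2, g3, rfl, rfl, rfl⟩
    obtain ⟨g1, -, g3, g4, g5, -, g7⟩ := hU f₀ hf₀
    rw [mem_coeffBox] at g1
    rw [g5] at g1 g3
    rw [g7] at g1 g4
    have hroot : ∀ f ∈ U, ∃ z : ℤ × ℤ, z.1 ≠ 0 ∧ z.2 ≠ 0 ∧ z.1 ∣ b.2.2 ∧ z.2 ∣ b.1 ∧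
        b.1 * z.1 ^ 3 + b.2.1 * z.1 ^ 2 * z.2 + f.2.2.1 * z.1 * z.2 ^ 2 + b.2.2 * z.2 ^ 3 = 0 := by
      intro f hf
      obtain ⟨-, k2, k3, k4, k5, k6, k7⟩ := hU f hf
      rw [k5] at k3
      rw [k7] at k4
      rw [k5, k6, k7] at k2
      obtain ⟨p, q, hp⟩ := exists_root_of_not_irred k3 k4 k2
      exact ⟨(p, q), hp⟩
    choose! z hz using hroot
    calc U.card ≤ (intDivisors b.2.2 ×ˢ intDivisors b.1).card := by
          refine Finset.card_le_card_of_injOn z (fun f hf => ?_) fun f hf g hg h => ?_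
          · obtain ⟨-, -, k3, k4, -⟩ := hz f hf
            exact Finset.mem_product.2 ⟨mem_intDivisors g4 k3, mem_intDivisors g3 k4⟩
          · obtain ⟨k1, k2, -, -, k5⟩ := hz f hf
            obtain ⟨-, -, -, -, k6⟩ := hz g hg
            rw [← h] at k6
            obtain ⟨-, -, -, -, e1, e2, e3⟩ := hU f hf
            obtain ⟨-, -, -, -, e4, e5, e6⟩ := hU g hg
            have hc : f.2.2.1 = g.2.2.1 :=
              mul_right_cancel₀ (mul_ne_zero k1 (pow_ne_zero 2 k2)) (by linear_combination k5 - k6)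
            exact Prod.ext (e1.trans e4.symm) (Prod.ext (e2.trans e5.symm)
              (Prod.ext hc (e3.trans e6.symm)))
      _ ≤ _ := by
          rw [Finset.card_product]
          exact Nat.mul_le_mul (card_intDivisors_le g4 g1.2.2.2) (card_intDivisors_le g3 g1.1)
  have h4 : T.card ≤ (T.filter fun f => f.1 = 0).card + (T.filter fun f => f.2.2.2 = 0).card +
      (T.filter fun f => f.1 ≠ 0 ∧ f.2.2.2 ≠ 0).card := by
    refine le_trans (Finset.card_le_card fun f hf => ?_)
      ((Finset.card_union_le _ _).trans (Nat.add_le_add_right (Finset.card_union_le _ _) _))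
    simp only [Finset.mem_union, Finset.mem_filter]
    tauto
  have h5 : 1 ≤ maxDivisors H ^ 2 := Nat.one_le_pow _ _ hD
  nlinarith [Nat.mul_le_mul_right ((2 * H + 1) ^ 3) h5]

theorem sum_Icc_neg_le_sum_range (h : ℤ → ℕ) {H N : ℕ} (hN : 2 * H + 1 ≤ N) :
    ∑ x ∈ Finset.Icc (-H : ℤ) H, h x ≤ ∑ i ∈ Finset.range N, h (-H + i) := by
  have h1 : ∑ x ∈ Finset.Icc (-H : ℤ) H, h x = ∑ i ∈ Finset.range (2 * H + 1), h (-H + i) := by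
    refine Finset.sum_nbij' (fun x => (x + H).toNat) (fun i => -H + i) ?_ ?_ ?_ ?_ ?_
    · intro x hx
      rw [Finset.mem_Icc] at hx
      rw [Finset.mem_range]
      lia
    · intro i hi
      rw [Finset.mem_range] at hi
      rw [Finset.mem_Icc]
      lia
    · intro x hx
      rw [Finset.mem_Icc] at hx
      lia
    · intro i hi
      lia
    · intro x hx
      rw [Finset.mem_Icc] at hx
      congr 1
      lia
  rw [h1]
  exact Finset.sum_le_sum_of_subset (Finset.range_mono hN)

theorem cubeSum_mul {M : ℕ} {F : ℤ × ℤ × ℤ × ℤ → ℕ} (hF : IsPeriodicMod M F) (m : ℕ) :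
    cubeSum (M * m) F = m ^ 4 * cubeSum M F := by
  have h1 : ∀ i j k : ℕ, ∑ l ∈ Finset.range (M * m), F ((i : ℤ), (j : ℤ), (k : ℤ), (l : ℤ)) =
      m * ∑ l ∈ Finset.range M, F ((i : ℤ), (j : ℤ), (k : ℤ), (l : ℤ)) := fun i j k =>
    sum_range_mul_periodic _ (fun l => hF _ _ (by simp [reduceMod])) m
  have h2 : ∀ i j : ℕ, ∑ k ∈ Finset.range (M * m), ∑ l ∈ Finset.range M,
        F ((i : ℤ), (j : ℤ), (k : ℤ), (l : ℤ)) =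
      m * ∑ k ∈ Finset.range M, ∑ l ∈ Finset.range M, F ((i : ℤ), (j : ℤ), (k : ℤ), (l : ℤ)) :=
    fun i j => sum_range_mul_periodic _ (fun k => Finset.sum_congr rfl fun l _ =>
      hF _ _ (by simp [reduceMod])) m
  have h3 : ∀ i : ℕ, ∑ j ∈ Finset.range (M * m), ∑ k ∈ Finset.range M, ∑ l ∈ Finset.range M,
        F ((i : ℤ), (j : ℤ), (k : ℤ), (l : ℤ)) =
      m * ∑ j ∈ Finset.range M, ∑ k ∈ Finset.range M, ∑ l ∈ Finset.range M,
        F ((i : ℤ), (j : ℤ), (k : ℤ), (l : ℤ)) :=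
    fun i => sum_range_mul_periodic _ (fun j => Finset.sum_congr rfl fun k _ =>
      Finset.sum_congr rfl fun l _ => hF _ _ (by simp [reduceMod])) m
  have h4 : ∑ i ∈ Finset.range (M * m), ∑ j ∈ Finset.range M, ∑ k ∈ Finset.range M,
        ∑ l ∈ Finset.range M, F ((i : ℤ), (j : ℤ), (k : ℤ), (l : ℤ)) =
      m * ∑ i ∈ Finset.range M, ∑ j ∈ Finset.range M, ∑ k ∈ Finset.range M, ∑ l ∈ Finset.range M,
        F ((i : ℤ), (j : ℤ), (k : ℤ), (l : ℤ)) :=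
    sum_range_mul_periodic _ (fun i => Finset.sum_congr rfl fun j _ => Finset.sum_congr rfl
      fun k _ => Finset.sum_congr rfl fun l _ => hF _ _ (by simp [reduceMod])) m
  simp only [cubeSum]
  simp_rw [h1, ← Finset.mul_sum, h2, ← Finset.mul_sum, h3, ← Finset.mul_sum, h4]
  ring

theorem sum_coeffBox_le_cubeSum {M : ℕ} [NeZero M] {F : ℤ × ℤ × ℤ × ℤ → ℕ}
    (hF : IsPeriodicMod M F) {H m : ℕ} (hm : 2 * H + 1 ≤ M * m) :
    ∑ f ∈ coeffBox H, F f ≤ m ^ 4 * cubeSum M F := by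
  rw [← cubeSum_shift hF (-H, -H, -H, -H), ← cubeSum_mul (fun f g h => hF _ _ (by
    simp only [reduceMod, Prod.mk.injEq, Prod.fst_add, Prod.snd_add, Int.cast_add] at h ⊢
    exact ⟨by rw [h.1], by rw [h.2.1], by rw [h.2.2.1], by rw [h.2.2.2]⟩))]
  simp only [coeffBox, Finset.sum_product, cubeSum, Prod.mk_add_mk]
  refine (sum_Icc_neg_le_sum_range _ hm).trans (Finset.sum_le_sum fun i _ => ?_)
  refine (sum_Icc_neg_le_sum_range _ hm).trans (Finset.sum_le_sum fun j _ => ?_)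
  refine (sum_Icc_neg_le_sum_range _ hm).trans (Finset.sum_le_sum fun k _ => ?_)
  exact sum_Icc_neg_le_sum_range _ hm

theorem ncard_unimodularPairs_le (n : ℕ) [NeZero n] : (unimodularPairs n).ncard ≤ n ^ 2 := by
  calc (unimodularPairs n).ncard ≤ (Set.univ : Set (ZMod n × ZMod n)).ncard :=
        Set.ncard_le_ncard (Set.subset_univ _)
    _ = n ^ 2 := by
        rw [Set.ncard_univ, Nat.card_prod, Nat.card_zmod, sq]

theorem sum_torsionCount_le {n H : ℕ} (hn : n ≠ 0) (hH : n ^ 3 ≤ H) :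
    n ^ 2 * ∑ f ∈ coeffBox H, torsionCount n f ≤ 81 * H ^ 4 := by
  have : NeZero n := ⟨hn⟩
  have : NeZero (n ^ 3) := ⟨pow_ne_zero 3 hn⟩
  obtain ⟨m, hm⟩ : ∃ m, m = 2 * H / n ^ 3 + 1 := ⟨_, rfl⟩
  have h1 := Nat.div_add_mod (2 * H) (n ^ 3)
  have h2 := Nat.mod_lt (2 * H) (NeZero.pos (n ^ 3))
  have h3 : n ^ 3 * m = n ^ 3 * (2 * H / n ^ 3) + n ^ 3 := by rw [hm]; ring
  have h4 : 2 * H + 1 ≤ n ^ 3 * m := by lia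
  have h5 : n ^ 3 * m ≤ 3 * H := by lia
  calc n ^ 2 * ∑ f ∈ coeffBox H, torsionCount n f
      ≤ n ^ 2 * (m ^ 4 * (n ^ 8 * n ^ 2)) := by
        gcongr
        refine (sum_coeffBox_le_cubeSum (isPeriodicMod_torsionCount n) h4).trans ?_
        rw [cubeSum_torsionCount n hn]
        gcongr
        exact ncard_unimodularPairs_le n
    _ = (n ^ 3 * m) ^ 4 := by ring
    _ ≤ (3 * H) ^ 4 := by gcongr
    _ = 81 * H ^ 4 := by ring

theorem mul_card_le_of_dvd_sub {S : Finset ℤ} {m L : ℕ} (hdvd : ∀ x ∈ S, ∀ y ∈ S, (m : ℤ) ∣ x - y)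
    (hle : ∀ x ∈ S, ∀ y ∈ S, x - y ≤ L) : m * S.card ≤ L + m := by
  rcases S.eq_empty_or_nonempty with rfl | hS
  · simp
  rcases m.eq_zero_or_pos with rfl | hm
  · simp
  have hmin := S.min'_mem hS
  set x₀ := S.min' hS
  have hpos : ∀ x ∈ S, 0 ≤ x - x₀ := fun x hx => sub_nonneg.2 (S.min'_le x hx)
  have hcard : S.card ≤ (Finset.range (L / m + 1)).card := by
    refine Finset.card_le_card_of_injOn (fun x => ((x - x₀) / m).toNat) (fun x hx => ?_)
      fun x hx y hy h => ?_
    · rw [Finset.mem_coe, Finset.mem_range, Nat.lt_add_one_iff, Nat.le_div_iff_mul_le hm]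
      obtain ⟨k, hk⟩ := hdvd x hx x₀ hmin
      have h1 := hle x hx x₀ hmin
      have h2 := hpos x hx
      simp only [hk, Int.mul_ediv_cancel_left k (by exact_mod_cast hm.ne' : (m : ℤ) ≠ 0)]
      rw [hk] at h1 h2
      have hk0 : 0 ≤ k := by
        by_contra! hneg
        nlinarith [(by exact_mod_cast hm : (0 : ℤ) < m)]
      zify
      rw [Int.toNat_of_nonneg hk0]
      linarith
    · obtain ⟨k, hk⟩ := hdvd x hx x₀ hmin
      obtain ⟨l, hl⟩ := hdvd y hy x₀ hmin
      have h1 := Int.ediv_nonneg (hpos x hx) (Int.natCast_nonneg m)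
      have h2 := Int.ediv_nonneg (hpos y hy) (Int.natCast_nonneg m)
      have hm0 : (m : ℤ) ≠ 0 := by exact_mod_cast hm.ne'
      simp only [hk, hl, Int.mul_ediv_cancel_left _ hm0] at h h1 h2
      obtain rfl : k = l := by lia
      linarith
  rw [Finset.card_range] at hcard
  calc m * S.card ≤ m * (L / m + 1) := by gcongr
    _ = m * (L / m) + m := by ring
    _ ≤ L + m := by gcongr; exact Nat.mul_div_le L m

theorem sum_gcd_le {q : ℤ} (hq : q ≠ 0) (S : ℕ) :
    ∑ s ∈ Finset.Icc (-S : ℤ) S, Int.gcd q s ≤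
      q.natAbs.divisors.card * (2 * S + q.natAbs) := by
  calc ∑ s ∈ Finset.Icc (-S : ℤ) S, Int.gcd q s
      ≤ ∑ s ∈ Finset.Icc (-S : ℤ) S, ∑ e ∈ q.natAbs.divisors, if (e : ℤ) ∣ s then e else 0 := by
        refine Finset.sum_le_sum fun s _ => ?_
        have h := Finset.single_le_sum (s := q.natAbs.divisors)
          (f := fun e : ℕ => if (e : ℤ) ∣ s then e else 0) (fun _ _ => Nat.zero_le _)
          (Nat.mem_divisors.2 ⟨Int.natCast_dvd.1 (Int.gcd_dvd_left q s), Int.natAbs_ne_zero.2 hq⟩)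
        simpa only [Int.gcd_dvd_right, if_true] using h
    _ = ∑ e ∈ q.natAbs.divisors, e * ((Finset.Icc (-S : ℤ) S).filter fun s => (e : ℤ) ∣ s).card := by
        rw [Finset.sum_comm]
        refine Finset.sum_congr rfl fun e _ => ?_
        rw [← Finset.sum_filter, Finset.sum_const, smul_eq_mul, mul_comm]
    _ ≤ ∑ e ∈ q.natAbs.divisors, (2 * S + q.natAbs) := by
        refine Finset.sum_le_sum fun e he => ?_
        have h := mul_card_le_of_dvd_sub
          (S := (Finset.Icc (-S : ℤ) S).filter fun s => (e : ℤ) ∣ s) (m := e) (L := 2 * S)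
          (fun x hx y hy => dvd_sub (Finset.mem_filter.1 hx).2 (Finset.mem_filter.1 hy).2)
          (fun x hx y hy => by
            have h1 := Finset.mem_Icc.1 (Finset.mem_filter.1 hx).1
            have h2 := Finset.mem_Icc.1 (Finset.mem_filter.1 hy).1
            push_cast
            linarith)
        exact h.trans (Nat.add_le_add_left (Nat.divisor_le he) _)
    _ = _ := by rw [Finset.sum_const, smul_eq_mul]

/-- Counting integer matrices with rows `(p, q)`, `(r, s)` of bounded size whose determinant
divides a nonzero integer depending only on the second column `(q, s)`. -/
theorem card_matrices_le {W : Finset ((ℤ × ℤ) × (ℤ × ℤ))} {P R Q : ℕ} (hPR : P ≤ 4 * R)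
    (hPQ : 2 * P ≤ Q) (h : ℤ → ℤ → ℤ)
    (hW : ∀ u ∈ W, P ≤ |u.1.1| ∧ u.1.1 ≠ 0 ∧ |u.1.1| ≤ 2 * P ∧ |u.1.2| ≤ 2 * R ∧ |u.2.1| ≤ 2 * P ∧
      h u.1.1 u.1.2 ≠ 0 ∧ |h u.1.1 u.1.2| ≤ Q ∧
      u.2.1 * u.1.2 - u.1.1 * u.2.2 ∣ h u.1.1 u.1.2) :
    W.card ≤ 600 * maxDivisors Q ^ 2 * (P * R) := by
  classical
  rcases W.eq_empty_or_nonempty with rfl | ⟨u₀, hu₀⟩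
  · simp
  have hP : 0 < P := by
    obtain ⟨-, h1, h2, -⟩ := hW u₀ hu₀
    have := abs_pos.2 h1
    lia
  set B : Finset ℤ := (Finset.Icc (-(2 * P : ℕ) : ℤ) (2 * P : ℕ)).filter fun q => q ≠ 0
  have hB : B.card ≤ 4 * P := by
    have h1 : B ⊆ (Finset.Icc (-(2 * P : ℕ) : ℤ) (2 * P : ℕ)).erase 0 := by
      intro q hq
      obtain ⟨h1, h2⟩ := Finset.mem_filter.1 hq
      exact Finset.mem_erase.2 ⟨h2, h1⟩
    refine (Finset.card_le_card h1).trans ?_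
    rw [Finset.card_erase_of_mem (by simp), card_Icc_neg]
    lia
  have hfib : ∀ z ∈ B ×ˢ Finset.Icc (-(2 * R : ℕ) : ℤ) (2 * R : ℕ),
      (W.filter fun u => u.1 = z).card ≤ 5 * Int.gcd z.1 z.2 * (2 * maxDivisors Q) := by
    rintro ⟨q, s⟩ -
    set V := W.filter fun u => u.1 = (q, s)
    rcases V.eq_empty_or_nonempty with hV | ⟨v₀, hv₀⟩
    · simp [hV]
    have hV : ∀ u ∈ V, u ∈ W ∧ u.1.1 = q ∧ u.1.2 = s := by
      intro u hu
      obtain ⟨h1, h2⟩ := Finset.mem_filter.1 hu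
      exact ⟨h1, by rw [h2], by rw [h2]⟩
    obtain ⟨hv₀W, e1, e2⟩ := hV v₀ hv₀
    obtain ⟨f1, f2, f3, -, -, f6, f7, -⟩ := hW v₀ hv₀W
    rw [e1] at f1 f2 f3
    rw [e1, e2] at f6 f7
    refine le_trans ?_ (Nat.mul_le_mul_left _ (card_intDivisors_le f6 f7))
    refine Finset.card_le_mul_card_image_of_maps_to (f := fun u => u.2.1 * u.1.2 - u.1.1 * u.2.2)
      (fun u hu => ?_) _ fun n _ => ?_
    · obtain ⟨h1, h2, h3⟩ := hV u hu
      obtain ⟨-, -, -, -, -, -, -, h4⟩ := hW u h1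
      refine mem_intDivisors f6 ?_
      rwa [← h2, ← h3]
    · have hT : ∀ u ∈ V.filter fun u => u.2.1 * u.1.2 - u.1.1 * u.2.2 = n,
          u.1 = (q, s) ∧ |u.2.1| ≤ 2 * P ∧ u.2.1 * s - q * u.2.2 = n := by
        intro u hu
        obtain ⟨h1, h2⟩ := Finset.mem_filter.1 hu
        obtain ⟨h3, h4, h5⟩ := hV u h1
        obtain ⟨-, -, -, -, h6, -⟩ := hW u h3
        rw [h4, h5] at h2
        exact ⟨Prod.ext h4 h5, h6, h2⟩
      set T := V.filter fun u => u.2.1 * u.1.2 - u.1.1 * u.2.2 = n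
      have hinj : Set.InjOn (fun u : (ℤ × ℤ) × (ℤ × ℤ) => u.2.1) T := by
        intro u hu w hw huw
        obtain ⟨h1, -, h2⟩ := hT u hu
        obtain ⟨h3, -, h4⟩ := hT w hw
        simp only at huw
        rw [← huw] at h4
        refine Prod.ext (h1.trans h3.symm) (Prod.ext huw (mul_left_cancel₀ f2 ?_))
        linear_combination h4 - h2
      rw [← Finset.card_image_of_injOn hinj]
      have hg : 0 < Int.gcd q s := Int.gcd_pos_of_ne_zero_left s f2
      have hgZ : (Int.gcd q s : ℤ) ≠ 0 := by exact_mod_cast hg.ne'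
      obtain ⟨q', hq'⟩ := Int.gcd_dvd_left q s
      obtain ⟨s', hs'⟩ := Int.gcd_dvd_right q s
      have hcop : IsCoprime q' s' := by
        have := Int.gcd_eq_gcd_ab q s
        refine ⟨Int.gcdA q s, Int.gcdB q s, mul_left_cancel₀ hgZ ?_⟩
        linear_combination -this - Int.gcdA q s * hq' - Int.gcdB q s * hs'
      have hqabs : q.natAbs = Int.gcd q s * q'.natAbs := by
        conv_lhs => rw [hq', Int.natAbs_mul, Int.natAbs_natCast]
      have h1 := mul_card_le_of_dvd_sub (S := T.image fun u => u.2.1) (m := q'.natAbs) (L := 4 * P)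
        (fun x hx y hy => by
          obtain ⟨u, hu, rfl⟩ := Finset.mem_image.1 hx
          obtain ⟨w, hw, rfl⟩ := Finset.mem_image.1 hy
          obtain ⟨-, -, h2⟩ := hT u hu
          obtain ⟨-, -, h4⟩ := hT w hw
          rw [Int.natAbs_dvd]
          refine hcop.dvd_of_dvd_mul_right ⟨u.2.2 - w.2.2, mul_left_cancel₀ hgZ ?_⟩
          linear_combination h2 - h4 - (u.2.1 - w.2.1) * hs' + (u.2.2 - w.2.2) * hq')
        (fun x hx y hy => by
          obtain ⟨u, hu, rfl⟩ := Finset.mem_image.1 hx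
          obtain ⟨w, hw, rfl⟩ := Finset.mem_image.1 hy
          obtain ⟨-, h2, -⟩ := hT u hu
          obtain ⟨-, h4, -⟩ := hT w hw
          rw [abs_le] at h2 h4
          push_cast
          linarith)
      have hPq : P ≤ Int.gcd q s * q'.natAbs := by
        rw [← hqabs]
        rw [Int.abs_eq_natAbs] at f1
        exact_mod_cast f1
      have h2 : (Int.gcd q s * q'.natAbs) * (T.image fun u => u.2.1).card ≤
          (Int.gcd q s * q'.natAbs) * (5 * Int.gcd q s) := by
        calc (Int.gcd q s * q'.natAbs) * (T.image fun u => u.2.1).card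
            = Int.gcd q s * (q'.natAbs * (T.image fun u => u.2.1).card) := by ring
          _ ≤ Int.gcd q s * (4 * (Int.gcd q s * q'.natAbs) + q'.natAbs) := by
              gcongr
              exact h1.trans (by lia)
          _ = (Int.gcd q s * q'.natAbs) * (4 * Int.gcd q s + 1) := by ring
          _ ≤ _ := by
              gcongr
              lia
      exact Nat.le_of_mul_le_mul_left h2 (hP.trans_le hPq)
  have hmaps : ∀ u ∈ W, u.1 ∈ B ×ˢ Finset.Icc (-(2 * R : ℕ) : ℤ) (2 * R : ℕ) := by
    intro u hu
    obtain ⟨-, h2, h3, h4, -⟩ := hW u hu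
    rw [abs_le] at h3 h4
    simp only [B, Finset.mem_product, Finset.mem_filter, Finset.mem_Icc]
    push_cast
    exact ⟨⟨h3, h2⟩, h4⟩
  rw [Finset.card_eq_sum_card_fiberwise hmaps]
  refine (Finset.sum_le_sum hfib).trans ?_
  rw [Finset.sum_product]
  calc ∑ q ∈ B, ∑ s ∈ Finset.Icc (-(2 * R : ℕ) : ℤ) (2 * R : ℕ),
        5 * Int.gcd q s * (2 * maxDivisors Q)
      ≤ ∑ q ∈ B, 5 * (maxDivisors Q * (12 * R)) * (2 * maxDivisors Q) := by
        refine Finset.sum_le_sum fun q hq => ?_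
        obtain ⟨h1, h2⟩ := Finset.mem_filter.1 hq
        rw [Finset.mem_Icc] at h1
        have hqP : q.natAbs ≤ 2 * P := by lia
        rw [← Finset.sum_mul, ← Finset.mul_sum]
        gcongr
        refine (sum_gcd_le h2 _).trans ?_
        gcongr
        · exact card_divisors_le_maxDivisors (Int.natAbs_ne_zero.2 h2) (by lia)
        · lia
    _ ≤ 600 * maxDivisors Q ^ 2 * (P * R) := by
        rw [Finset.sum_const, smul_eq_mul]
        calc _ ≤ 4 * P * (5 * (maxDivisors Q * (12 * R)) * (2 * maxDivisors Q)) := by gcongr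
          _ = 480 * maxDivisors Q ^ 2 * (P * R) := by ring
          _ ≤ _ := by gcongr; norm_num

/-- The basis `u` of a sublattice of `ℤ²` of index `n` is Minkowski-reduced, and `f` becomes
divisible by `n²` when written in that basis. -/
def IsReducedPair (n : ℤ) (f : ℤ × ℤ × ℤ × ℤ) (u : (ℤ × ℤ) × (ℤ × ℤ)) : Prop :=
  u.1.1 * u.2.2 - u.1.2 * u.2.1 = n ∧
  u.1.1 ^ 2 + u.1.2 ^ 2 ≤ u.2.1 ^ 2 + u.2.2 ^ 2 ∧
  3 * ((u.1.1 ^ 2 + u.1.2 ^ 2) * (u.2.1 ^ 2 + u.2.2 ^ 2)) ≤ 4 * n ^ 2 ∧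
  ∃ g : ℤ × ℤ × ℤ × ℤ, formAct u.1.1 u.1.2 u.2.1 u.2.2 f =
    (n ^ 2 * g.1, n ^ 2 * g.2.1, n ^ 2 * g.2.2.1, n ^ 2 * g.2.2.2)

theorem exists_reduced_basis {n : ℤ} (v w : ℤ × ℤ) (hvw : v.1 * w.2 - v.2 * w.1 = 1) :
    ∃ p q r s : ℤ, p * s - q * r = n ∧ n ∣ v.1 * q - v.2 * p ∧ n ∣ v.1 * s - v.2 * r ∧
      p ^ 2 + q ^ 2 ≤ r ^ 2 + s ^ 2 ∧ 3 * ((p ^ 2 + q ^ 2) * (r ^ 2 + s ^ 2)) ≤ 4 * n ^ 2 := by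
  let S : Set (ℤ × ℤ × ℤ × ℤ) := {u | u.1 * u.2.2.2 - u.2.1 * u.2.2.1 = n ∧
    n ∣ v.1 * u.2.1 - v.2 * u.1 ∧ n ∣ v.1 * u.2.2.2 - v.2 * u.2.2.1}
  let μ : ℤ × ℤ × ℤ × ℤ → ℕ := fun u =>
    (u.1 ^ 2 + u.2.1 ^ 2 + (u.2.2.1 ^ 2 + u.2.2.2 ^ 2)).toNat
  have hS : S.Nonempty := ⟨(v.1, v.2, n * w.1, n * w.2),
    by linear_combination n * hvw, ⟨0, by ring⟩, ⟨1, by linear_combination n * hvw⟩⟩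
  obtain ⟨⟨p, q, r, s⟩, ⟨h1, h2, h3⟩, hmin⟩ := WellFounded.has_min (measure μ).wf S hS
  have key : ∀ p' q' r' s' : ℤ, (p', q', r', s') ∈ S →
      p ^ 2 + q ^ 2 + (r ^ 2 + s ^ 2) ≤ p' ^ 2 + q' ^ 2 + (r' ^ 2 + s' ^ 2) := by
    intro p' q' r' s' h
    have := hmin _ h
    change ¬ (μ _ < μ _) at this
    simp only [μ, not_lt] at this
    have h' : 0 ≤ p' ^ 2 + q' ^ 2 + (r' ^ 2 + s' ^ 2) := by positivity
    lia
  simp only at h1 h2 h3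
  have k1 := key p q (r + p) (s + q) ⟨by simp only; linear_combination h1, h2, by
    obtain ⟨x, hx⟩ := h2; obtain ⟨y, hy⟩ := h3
    exact ⟨x + y, by simp only; linear_combination hx + hy⟩⟩
  have k2 := key p q (r - p) (s - q) ⟨by simp only; linear_combination h1, h2, by
    obtain ⟨x, hx⟩ := h2; obtain ⟨y, hy⟩ := h3
    exact ⟨y - x, by simp only; linear_combination hy - hx⟩⟩
  have k3 := key (p + r) (q + s) r s ⟨by simp only; linear_combination h1, by
    obtain ⟨x, hx⟩ := h2; obtain ⟨y, hy⟩ := h3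
    exact ⟨x + y, by simp only; linear_combination hx + hy⟩, h3⟩
  have k4 := key (p - r) (q - s) r s ⟨by simp only; linear_combination h1, by
    obtain ⟨x, hx⟩ := h2; obtain ⟨y, hy⟩ := h3
    exact ⟨x - y, by simp only; linear_combination hx - hy⟩, h3⟩
  have hL : (p ^ 2 + q ^ 2) * (r ^ 2 + s ^ 2) = n ^ 2 + (p * r + q * s) ^ 2 := by
    rw [← h1]; ring
  have hI1 : |2 * (p * r + q * s)| ≤ p ^ 2 + q ^ 2 := abs_le.2 ⟨by linarith, by linarith⟩
  have hI2 : |2 * (p * r + q * s)| ≤ r ^ 2 + s ^ 2 := abs_le.2 ⟨by linarith, by linarith⟩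
  have h4 : (2 * (p * r + q * s)) ^ 2 ≤ (p ^ 2 + q ^ 2) * (r ^ 2 + s ^ 2) := by
    rw [← sq_abs, sq]
    exact mul_le_mul hI1 hI2 (abs_nonneg _) (by positivity)
  rcases le_total (p ^ 2 + q ^ 2) (r ^ 2 + s ^ 2) with h | h
  · exact ⟨p, q, r, s, h1, h2, h3, h, by linarith⟩
  · refine ⟨r, s, -p, -q, by linear_combination h1, h3, ?_, by linarith, ?_⟩
    · obtain ⟨x, hx⟩ := h2
      exact ⟨-x, by linear_combination -hx⟩
    · have : 3 * ((r ^ 2 + s ^ 2) * ((-p) ^ 2 + (-q) ^ 2)) =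
        3 * ((p ^ 2 + q ^ 2) * (r ^ 2 + s ^ 2)) := by ring
      linarith

theorem exists_isReducedPair {n : ℤ} {v w : ℤ × ℤ} (hvw : v.1 * w.2 - v.2 * w.1 = 1)
    {f : ℤ × ℤ × ℤ × ℤ} (h0 : n ^ 2 ∣ (formAct v.1 v.2 w.1 w.2 f).1)
    (h1 : n ∣ (formAct v.1 v.2 w.1 w.2 f).2.1) :
    ∃ u, IsReducedPair n f u ∧ n ∣ v.1 * u.1.2 - v.2 * u.1.1 ∧ n ∣ v.1 * u.2.2 - v.2 * u.2.1 := by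
  obtain ⟨p, q, r, s, hd, ⟨β, hβ⟩, ⟨δ, hδ⟩, hle, h3⟩ := exists_reduced_basis (n := n) v w hvw
  refine ⟨((p, q), (r, s)), ⟨hd, hle, h3, ?_⟩, ⟨β, hβ⟩, ⟨δ, hδ⟩⟩
  obtain ⟨A, hA⟩ := h0
  obtain ⟨B, hB⟩ := h1
  set F := formAct v.1 v.2 w.1 w.2 f with hF
  have e1 : formAct p q r s f = formAct (p * w.2 - q * w.1) (n * β) (r * w.2 - s * w.1) (n * δ) F := by
    have hp : p = (p * w.2 - q * w.1) * v.1 + n * β * w.1 := by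
      rw [← hβ]; linear_combination -p * hvw
    have hq : q = (p * w.2 - q * w.1) * v.2 + n * β * w.2 := by
      rw [← hβ]; linear_combination -q * hvw
    have hr : r = (r * w.2 - s * w.1) * v.1 + n * δ * w.1 := by
      rw [← hδ]; linear_combination -r * hvw
    have hs : s = (r * w.2 - s * w.1) * v.2 + n * δ * w.2 := by
      rw [← hδ]; linear_combination -s * hvw
    generalize p * w.2 - q * w.1 = x at *
    generalize r * w.2 - s * w.1 = y at *
    generalize n * β = z at *
    generalize n * δ = t at *
    subst hp hq hr hs
    simp only [hF, formAct, Prod.mk.injEq]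
    refine ⟨by ring, by ring, by ring, by ring⟩
  rw [e1]
  generalize p * w.2 - q * w.1 = x
  generalize r * w.2 - s * w.1 = y
  obtain ⟨F0, F1, F2, F3⟩ := F
  simp only at hA hB
  subst hA hB
  refine ⟨(A * x ^ 3 + B * x ^ 2 * β + F2 * x * β ^ 2 + n * F3 * β ^ 3,
    3 * A * x ^ 2 * y + B * (x ^ 2 * δ + 2 * x * β * y) + F2 * (2 * x * β * δ + β ^ 2 * y) +
      3 * n * F3 * β ^ 2 * δ,
    3 * A * x * y ^ 2 + B * (2 * x * y * δ + β * y ^ 2) + F2 * (x * δ ^ 2 + 2 * β * y * δ) +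
      3 * n * F3 * β * δ ^ 2,
    A * y ^ 3 + B * y ^ 2 * δ + F2 * y * δ ^ 2 + n * F3 * δ ^ 3), ?_⟩
  simp only [formAct, Prod.mk.injEq]
  refine ⟨by ring, by ring, by ring, by ring⟩

theorem dvd_cross_of_isReducedPair {n : ℤ} (hn : n ≠ 0) {f : ℤ × ℤ × ℤ × ℤ}
    {u : (ℤ × ℤ) × (ℤ × ℤ)} (hu : IsReducedPair n f u) {v v' : ℤ × ℤ}
    (h1 : n ∣ v.1 * u.1.2 - v.2 * u.1.1) (h2 : n ∣ v.1 * u.2.2 - v.2 * u.2.1)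
    (h1' : n ∣ v'.1 * u.1.2 - v'.2 * u.1.1) (h2' : n ∣ v'.1 * u.2.2 - v'.2 * u.2.1) :
    n ∣ v.1 * v'.2 - v.2 * v'.1 := by
  obtain ⟨x, hx⟩ := h1
  obtain ⟨y, hy⟩ := h2
  obtain ⟨x', hx'⟩ := h1'
  obtain ⟨y', hy'⟩ := h2'
  refine ⟨x * y' - y * x', mul_left_cancel₀ hn ?_⟩
  have := hu.1
  linear_combination -(v.1 * v'.2 - v.2 * v'.1) * this + (v'.1 * u.2.2 - v'.2 * u.2.1) * hx +
    n * x * hy' - (v'.1 * u.1.2 - v'.2 * u.1.1) * hy - n * y * hx'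

theorem two_mul_card_ge_torsionCount {n : ℕ} (hn : n ≠ 0) (f : ℤ × ℤ × ℤ × ℤ) :
    torsionCount n f ≤ 2 * ((projReps n).filter fun v =>
      (n : ℤ) ^ 2 ∣ (completedAct v f).1 ∧ (n : ℤ) ∣ (completedAct v f).2.1).card := by
  classical
  rw [torsionCount, Finset.card_filter, Finset.mul_sum]
  refine Finset.sum_le_sum fun v _ => ?_
  split_ifs with h
  · rw [mul_one, ← not_lt, Finset.two_lt_card]
    rintro ⟨a, ha, b, hb, c, hc, hab, hac, hbc⟩
    rw [Finset.mem_filter, Finset.mem_range] at ha hb hc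
    have aux : ∀ {i j : ℕ}, TorsionCond n i (completedAct v f) → TorsionCond n j (completedAct v f) →
        (n : ℤ) ∣ 2 * ((i : ℤ) - j) := by
      intro i j hi hj
      have := dvd_sub hj.2.1 hi.2.1
      rw [show (completedAct v f).2.1 - 2 * n * j - ((completedAct v f).2.1 - 2 * n * i) =
        n * (2 * ((i : ℤ) - j)) by ring, sq] at this
      exact Int.dvd_of_mul_dvd_mul_left (by exact_mod_cast hn) this
    obtain ⟨x, hx⟩ := aux ha.2 hb.2
    obtain ⟨y, hy⟩ := aux ha.2 hc.2
    obtain ⟨z, hz⟩ := aux hb.2 hc.2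
    have bound : ∀ {i j : ℕ} {t : ℤ}, i < n → j < n → i ≠ j → 2 * ((i : ℤ) - j) = n * t →
        t = 1 ∨ t = -1 := by
      intro i j t hi hj hij ht
      have h1 : t < 2 := by nlinarith
      have h2 : -2 < t := by nlinarith
      have h3 : t ≠ 0 := by
        rintro rfl
        lia
      lia
    have hsum : (n : ℤ) * (x + z) = n * y := by linear_combination hy - hx - hz
    have := mul_left_cancel₀ (by exact_mod_cast hn) hsum
    have := bound ha.1 hb.1 hab hx
    have := bound ha.1 hc.1 hac hy
    have := bound hb.1 hc.1 hbc hz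
    lia
  · rw [mul_zero, Nat.le_zero, Finset.card_eq_zero, Finset.filter_eq_empty_iff]
    intro r _ hr
    refine h ⟨hr.1, ?_⟩
    have h2 := (dvd_trans (dvd_pow_self (n : ℤ) two_ne_zero) hr.2.1)
    exact (Int.dvd_iff_dvd_of_dvd_sub (by convert h2 using 1)).2 ⟨2 * r, by ring⟩

/-- The pairs of integer vectors with all coordinates at most `K` in absolute value. -/
noncomputable def pairBox (K : ℕ) : Finset ((ℤ × ℤ) × (ℤ × ℤ)) :=
  (Finset.Icc (-K : ℤ) K ×ˢ Finset.Icc (-K : ℤ) K) ×ˢ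
    (Finset.Icc (-K : ℤ) K ×ˢ Finset.Icc (-K : ℤ) K)

theorem IsReducedPair.mem_pairBox {n : ℕ} (hn : n ≠ 0) {f : ℤ × ℤ × ℤ × ℤ}
    {u : (ℤ × ℤ) × (ℤ × ℤ)} (hu : IsReducedPair n f u) {K : ℕ} (hK : 2 * n ≤ K) :
    u ∈ pairBox K := by
  obtain ⟨⟨p, q⟩, ⟨r, s⟩⟩ := u
  obtain ⟨h1, h2, h3, -⟩ := hu
  simp only at h1 h2 h3
  have hE : 1 ≤ p ^ 2 + q ^ 2 := by
    by_contra h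
    have hp : p = 0 := by nlinarith
    have hq : q = 0 := by nlinarith
    subst hp hq
    lia
  have hb : r ^ 2 + s ^ 2 ≤ (2 * n) ^ 2 := by nlinarith [sq_nonneg (n : ℤ)]
  have habs : ∀ x : ℤ, x ^ 2 ≤ (2 * n) ^ 2 → -(K : ℤ) ≤ x ∧ x ≤ K := by
    intro x hx
    have := abs_le.1 (abs_le_of_sq_le_sq hx (by positivity))
    lia
  simp only [pairBox, Finset.mem_product, Finset.mem_Icc]
  refine ⟨⟨habs _ ?_, habs _ ?_⟩, ⟨habs _ ?_, habs _ ?_⟩⟩ <;>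
    nlinarith [sq_nonneg p, sq_nonneg q, sq_nonneg r, sq_nonneg s]

open Classical in
theorem sum_torsionCount_le_card_isReducedPair {I : Finset ℕ} (hI : 0 ∉ I) {K : ℕ}
    (hK : ∀ n ∈ I, 2 * n ≤ K) (f : ℤ × ℤ × ℤ × ℤ) :
    ∑ n ∈ I, torsionCount n f ≤
      2 * ((pairBox K).filter fun u => ∃ n ∈ I, IsReducedPair n f u).card := by
  refine (Finset.sum_le_sum fun n hn =>
    two_mul_card_ge_torsionCount (fun h => hI (h ▸ hn)) f).trans ?_
  rw [← Finset.mul_sum, ← Finset.card_sigma]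
  refine Nat.mul_le_mul_left _ ?_
  have hex : ∀ x : Σ _ : ℕ, ℤ × ℤ, ∃ u, x ∈ (I.sigma fun n => (projReps n).filter fun v =>
      (n : ℤ) ^ 2 ∣ (completedAct v f).1 ∧ (n : ℤ) ∣ (completedAct v f).2.1) →
      IsReducedPair x.1 f u ∧ (x.1 : ℤ) ∣ x.2.1 * u.1.2 - x.2.2 * u.1.1 ∧
        (x.1 : ℤ) ∣ x.2.1 * u.2.2 - x.2.2 * u.2.1 := by
    rintro ⟨n, v⟩
    by_cases h : (⟨n, v⟩ : Σ _ : ℕ, ℤ × ℤ) ∈ (I.sigma fun n => (projReps n).filter fun v =>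
      (n : ℤ) ^ 2 ∣ (completedAct v f).1 ∧ (n : ℤ) ∣ (completedAct v f).2.1)
    · have h' := h
      rw [Finset.mem_sigma, Finset.mem_filter] at h'
      obtain ⟨hn, hv, h0, h1⟩ := h'
      have hcop := (projReps_spec (fun e => hI (e ▸ hn))).1 v hv
      obtain ⟨u, hu⟩ := exists_isReducedPair (w := (_, _)) (completion_det hcop) h0 h1
      exact ⟨u, fun _ => hu⟩
    · exact ⟨default, fun h' => absurd h' h⟩
  choose φ hφ using hex
  refine Finset.card_le_card_of_injOn φ ?_ ?_
  · intro x hx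
    have hx' := Finset.mem_coe.1 hx
    have hn := (Finset.mem_sigma.1 hx').1
    rw [Finset.mem_coe, Finset.mem_filter]
    exact ⟨(hφ x hx').1.mem_pairBox (fun e => hI (e ▸ hn)) (hK _ hn), _, hn, (hφ x hx').1⟩
  · rintro ⟨n, v⟩ hx ⟨m, w⟩ hy hxy
    obtain ⟨a1, a2, a3⟩ := hφ _ (Finset.mem_coe.1 hx)
    obtain ⟨b1, b2, b3⟩ := hφ _ (Finset.mem_coe.1 hy)
    have hn := (Finset.mem_sigma.1 (Finset.mem_coe.1 hx))
    have hm := (Finset.mem_sigma.1 (Finset.mem_coe.1 hy))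
    rw [← hxy] at b1 b2 b3
    simp only at a1 a2 a3 b1 b2 b3 hn hm
    obtain rfl : n = m := by exact_mod_cast a1.1.symm.trans b1.1
    have hn0 : n ≠ 0 := fun e => hI (e ▸ hn.1)
    rw [(projReps_spec hn0).2.1 v (Finset.mem_filter.1 hn.2).1 w (Finset.mem_filter.1 hm.2).1
      (dvd_cross_of_isReducedPair (by exact_mod_cast hn0) a1 a2 a3 b2 b3)]

theorem IsIrredCubicForm.value_ne_zero {a b c d : ℤ} (h : IsIrredCubicForm a b c d) {p q : ℤ}
    (hpq : ¬ (p = 0 ∧ q = 0)) :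
    a * p ^ 3 + b * p ^ 2 * q + c * p * q ^ 2 + d * q ^ 3 ≠ 0 := by
  intro h0
  by_cases hq : q = 0
  · subst hq
    have : a * p ^ 3 = 0 := by linear_combination h0
    rcases mul_eq_zero.1 this with h1 | h1
    · exact h.1 h1
    · exact hpq ⟨by simpa using h1, rfl⟩
  · have hroot : (cubicPolyQ a b c d).IsRoot ((p : ℚ) / q) := by
      have hq' : (q : ℚ) ≠ 0 := by exact_mod_cast hq
      have h0' : (a : ℚ) * p ^ 3 + b * p ^ 2 * q + c * p * q ^ 2 + d * q ^ 3 = 0 := by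
        exact_mod_cast h0
      simp only [cubicPolyQ, Polynomial.IsRoot.def, Polynomial.eval_add, Polynomial.eval_mul,
        Polynomial.eval_C, Polynomial.eval_pow, Polynomial.eval_X]
      field_simp
      linear_combination h0'
    have h1 := Polynomial.natDegree_eq_of_degree_eq_some
      (Polynomial.degree_eq_one_of_irreducible_of_root h.2 hroot)
    rw [natDegree_cubicPolyQ h.1] at h1
    norm_num at h1

theorem abs_formAct_le {H x y p q r s : ℤ} {f : ℤ × ℤ × ℤ × ℤ} (h0 : |f.1| ≤ H)
    (h1 : |f.2.1| ≤ H) (h2 : |f.2.2.1| ≤ H) (h3 : |f.2.2.2| ≤ H) (hp : |p| ≤ x) (hq : |q| ≤ x)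
    (hr : |r| ≤ y) (hs : |s| ≤ y) :
    |(formAct p q r s f).1| ≤ 4 * H * x ^ 3 ∧ |(formAct p q r s f).2.1| ≤ 12 * H * (x ^ 2 * y) ∧
      |(formAct p q r s f).2.2.1| ≤ 12 * H * (x * y ^ 2) ∧
      |(formAct p q r s f).2.2.2| ≤ 4 * H * y ^ 3 := by
  have hH := (abs_nonneg _).trans h0
  have hx := (abs_nonneg _).trans hp
  have hy := (abs_nonneg _).trans hr
  have mono : ∀ {a b c d A X Y Z : ℤ}, |a| ≤ A → |b| ≤ X → |c| ≤ Y → |d| ≤ Z →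
      |a * (b * c * d)| ≤ A * (X * Y * Z) := by
    intro a b c d A X Y Z ha hb hc hd
    have := (abs_nonneg _).trans ha
    have := (abs_nonneg _).trans hb
    have := (abs_nonneg _).trans hc
    rw [abs_mul, abs_mul, abs_mul]
    gcongr
  have add4 : ∀ {a b c d A B C D : ℤ}, |a| ≤ A → |b| ≤ B → |c| ≤ C → |d| ≤ D →
      |a + b + c + d| ≤ A + B + C + D := by
    intro a b c d A B C D ha hb hc hd
    rw [abs_le] at *
    constructor <;> linarith
  have add12 : ∀ {a b b' c c' d A : ℤ}, |a| ≤ A → |b| ≤ A → |b'| ≤ A → |c| ≤ A → |c'| ≤ A →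
      |d| ≤ A → |3 * a + (b + 2 * b') + (2 * c + c') + 3 * d| ≤ 12 * A := by
    intro a b b' c c' d A ha hb hb' hc hc' hd
    rw [abs_le] at *
    constructor <;> linarith
  refine ⟨?_, ?_, ?_, ?_⟩
  · convert add4 (mono h0 hp hp hp) (mono h1 hp hp hq) (mono h2 hp hq hq) (mono h3 hq hq hq) using 1
    · simp only [formAct]; congr 1; ring
    · ring
  · convert add12 (mono h0 hp hp hr) (mono h1 hp hp hs) (mono h1 hp hq hr) (mono h2 hp hq hs)
      (mono h2 hq hq hr) (mono h3 hq hq hs) using 1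
    · simp only [formAct]; congr 1; ring
    · ring
  · convert add12 (mono h0 hp hr hr) (mono h1 hq hr hr) (mono h1 hp hr hs) (mono h2 hq hr hs)
      (mono h2 hp hs hs) (mono h3 hq hs hs) using 1
    · simp only [formAct]; congr 1; ring
    · ring
  · convert add4 (mono h0 hr hr hr) (mono h1 hr hr hs) (mono h2 hr hs hs) (mono h3 hs hs hs) using 1
    · simp only [formAct]; congr 1; ring
    · ring

/-- The two vectors of `u` have sup norms of orders `P` and `R`. -/
def HasSize (P R : ℤ) (u : (ℤ × ℤ) × (ℤ × ℤ)) : Prop :=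
  (P ≤ |u.1.1| ∨ P ≤ |u.1.2|) ∧ |u.1.1| ≤ 2 * P ∧ |u.1.2| ≤ 2 * P ∧
  (R ≤ |u.2.1| ∨ R ≤ |u.2.2|) ∧ |u.2.1| ≤ 2 * R ∧ |u.2.2| ≤ 2 * R

theorem sq_le_of_le_abs {P p q : ℤ} (hP : 0 ≤ P) (h : P ≤ |p| ∨ P ≤ |q|) :
    P ^ 2 ≤ p ^ 2 + q ^ 2 := by
  rcases h with h | h
  · have := pow_le_pow_left₀ hP h 2
    rw [sq_abs] at this
    nlinarith [sq_nonneg q]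
  · have := pow_le_pow_left₀ hP h 2
    rw [sq_abs] at this
    nlinarith [sq_nonneg p]

theorem IsReducedPair.size_bounds {n P R : ℤ} (hP : 0 < P) (hR : 0 < R) {f : ℤ × ℤ × ℤ × ℤ}
    {u : (ℤ × ℤ) × (ℤ × ℤ)} (hu : IsReducedPair n f u) (hs : HasSize P R u) :
    P < 4 * R ∧ (P * R) ^ 2 ≤ 4 * n ^ 2 ∧ |n| ≤ 8 * (P * R) := by
  obtain ⟨h1, h2, h3, -⟩ := hu
  obtain ⟨s1, s2, s3, s4, s5, s6⟩ := hs
  have hP2 := sq_le_of_le_abs hP.le s1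
  have hR2 := sq_le_of_le_abs hR.le s4
  have hr : u.2.1 ^ 2 ≤ (2 * R) ^ 2 := sq_le_sq' (by linarith [(abs_le.1 s5).1]) (abs_le.1 s5).2
  have hs : u.2.2 ^ 2 ≤ (2 * R) ^ 2 := sq_le_sq' (by linarith [(abs_le.1 s6).1]) (abs_le.1 s6).2
  refine ⟨by nlinarith, ?_, ?_⟩
  · have : P ^ 2 * R ^ 2 ≤ (u.1.1 ^ 2 + u.1.2 ^ 2) * (u.2.1 ^ 2 + u.2.2 ^ 2) := by gcongr
    nlinarith [sq_nonneg (P * R)]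
  · rw [← h1]
    refine (abs_sub _ _).trans ?_
    rw [abs_mul, abs_mul]
    calc |u.1.1| * |u.2.2| + |u.1.2| * |u.2.1| ≤ 2 * P * (2 * R) + 2 * P * (2 * R) := by gcongr
      _ = 8 * (P * R) := by ring

theorem IsReducedPair.coeff_bounds {n H P R : ℤ} (hP : 0 < P) (hR : 0 < R)
    {f g : ℤ × ℤ × ℤ × ℤ} (h0 : |f.1| ≤ H) (h1 : |f.2.1| ≤ H) (h2 : |f.2.2.1| ≤ H)
    (h3 : |f.2.2.2| ≤ H) {u : (ℤ × ℤ) × (ℤ × ℤ)} (hu : IsReducedPair n f u) (hs : HasSize P R u)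
    (hg : formAct u.1.1 u.1.2 u.2.1 u.2.2 f =
      (n ^ 2 * g.1, n ^ 2 * g.2.1, n ^ 2 * g.2.2.1, n ^ 2 * g.2.2.2)) :
    |g.1| * R ^ 2 ≤ 384 * H * P ∧ |g.2.1| * R ≤ 384 * H ∧ |g.2.2.1| * P ≤ 384 * H ∧
      |g.2.2.2| * P ^ 2 ≤ 384 * H * R := by
  have hn2 := (hu.size_bounds hP hR hs).2.1
  obtain ⟨k0, k1, k2, k3⟩ := abs_formAct_le h0 h1 h2 h3 hs.2.1 hs.2.2.1 hs.2.2.2.2.1 hs.2.2.2.2.2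
  have hH := (abs_nonneg _).trans h0
  rw [hg] at k0 k1 k2 k3
  simp only [abs_mul, abs_of_nonneg (sq_nonneg n)] at k0 k1 k2 k3
  have aux : ∀ {z B : ℤ}, n ^ 2 * |z| ≤ B → (P * R) ^ 2 * |z| ≤ 4 * B := by
    intro z B h
    nlinarith [abs_nonneg z]
  have hHP : 0 ≤ H * P := by positivity
  have hHR : 0 ≤ H * R := by positivity
  refine ⟨?_, ?_, ?_, ?_⟩
  · refine le_of_mul_le_mul_left (a := P ^ 2) ?_ (by positivity)
    linarith [aux k0, show 0 ≤ H * P * P ^ 2 by positivity]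
  · refine le_of_mul_le_mul_left (a := P ^ 2 * R) ?_ (by positivity)
    linarith [aux k1, show 0 ≤ H * P ^ 2 * R by positivity]
  · refine le_of_mul_le_mul_left (a := P * R ^ 2) ?_ (by positivity)
    linarith [aux k2, show 0 ≤ H * P * R ^ 2 by positivity]
  · refine le_of_mul_le_mul_left (a := R ^ 2) ?_ (by positivity)
    linarith [aux k3, show 0 ≤ H * R * R ^ 2 by positivity]

theorem card_coeff_le {H P R : ℕ} (hP : 0 < P) (hR : 0 < R) (hPR : P < 4 * R)
    {G : Finset (ℤ × ℤ × ℤ × ℤ)}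
    (hG : ∀ g ∈ G, g.1 ≠ 0 ∧ |g.1| * R ^ 2 ≤ 384 * H * P ∧ |g.2.1| * R ≤ 384 * H ∧
      |g.2.2.1| * P ≤ 384 * H ∧ |g.2.2.2| * P ^ 2 ≤ 384 * H * R) :
    (P * R) ^ 2 * G.card ≤ 25344 ^ 4 * H ^ 4 := by
  rcases G.eq_empty_or_nonempty with rfl | ⟨g, hg⟩
  · simp
  have hR2 : R ^ 2 ≤ 384 * H * P := by
    obtain ⟨h1, h2, -⟩ := hG g hg
    have : 1 ≤ |g.1| := Int.one_le_abs h1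
    zify
    nlinarith [sq_nonneg (R : ℤ)]
  have hRH : R ≤ 1536 * H := by nlinarith
  have hPH : P ≤ 6144 * H := by lia
  have hPRH : P ^ 2 ≤ 24576 * H * R := by nlinarith
  set A0 := 384 * H * P / R ^ 2 with hA0
  set A1 := 384 * H / R with hA1
  set A2 := 384 * H / P with hA2
  set A3 := 384 * H * R / P ^ 2 with hA3
  have hsub : G ⊆ Finset.Icc (-A0 : ℤ) A0 ×ˢ Finset.Icc (-A1 : ℤ) A1 ×ˢ Finset.Icc (-A2 : ℤ) A2 ×ˢ
      Finset.Icc (-A3 : ℤ) A3 := by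
    intro g hg
    obtain ⟨-, h0, h1, h2, h3⟩ := hG g hg
    have aux : ∀ {z : ℤ} {B M : ℕ}, 0 < M → |z| * M ≤ B → -((B / M : ℕ) : ℤ) ≤ z ∧ z ≤ (B / M : ℕ) := by
      intro z B M hM h
      rw [← abs_le]
      push_cast
      exact (Int.le_ediv_iff_mul_le (by exact_mod_cast hM)).2 h
    simp only [Finset.mem_product, Finset.mem_Icc]
    exact ⟨aux (by positivity) (by exact_mod_cast h0), aux hR (by exact_mod_cast h1),
      aux hP (by exact_mod_cast h2), aux (by positivity) (by exact_mod_cast h3)⟩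
  have hcard := Finset.card_le_card hsub
  rw [Finset.card_product, Finset.card_product, Finset.card_product, card_Icc_neg, card_Icc_neg,
    card_Icc_neg, card_Icc_neg] at hcard
  have b0 : R ^ 2 * (2 * A0 + 1) ≤ 25344 * (H * P) := by
    have := Nat.mul_div_le (384 * H * P) (R ^ 2)
    rw [← hA0] at this
    nlinarith
  have b1 : R * (2 * A1 + 1) ≤ 25344 * H := by
    have := Nat.mul_div_le (384 * H) R
    rw [← hA1] at this
    nlinarith
  have b2 : P * (2 * A2 + 1) ≤ 25344 * H := by
    have := Nat.mul_div_le (384 * H) P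
    rw [← hA2] at this
    nlinarith
  have b3 : P ^ 2 * (2 * A3 + 1) ≤ 25344 * (H * R) := by
    have := Nat.mul_div_le (384 * H * R) (P ^ 2)
    rw [← hA3] at this
    nlinarith
  have hpos : 0 < P * R := by positivity
  refine le_of_mul_le_mul_left (a := P * R) ?_ hpos
  calc P * R * ((P * R) ^ 2 * G.card)
      ≤ P * R * ((P * R) ^ 2 *
          ((2 * A0 + 1) * ((2 * A1 + 1) * ((2 * A2 + 1) * (2 * A3 + 1))))) := by gcongr
    _ = (R ^ 2 * (2 * A0 + 1)) * (R * (2 * A1 + 1)) * (P * (2 * A2 + 1)) *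
          (P ^ 2 * (2 * A3 + 1)) := by ring
    _ ≤ (25344 * (H * P)) * (25344 * H) * (25344 * H) * (25344 * (H * R)) := by gcongr
    _ = P * R * (25344 ^ 4 * H ^ 4) := by ring

theorem formAct_adjugate {n p q r s : ℤ} (hn : n ≠ 0) (hdet : p * s - q * r = n)
    {f g : ℤ × ℤ × ℤ × ℤ} (hg : formAct p q r s f =
      (n ^ 2 * g.1, n ^ 2 * g.2.1, n ^ 2 * g.2.2.1, n ^ 2 * g.2.2.2)) :
    formAct s (-q) (-r) p g = (n * f.1, n * f.2.1, n * f.2.2.1, n * f.2.2.2) := by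
  obtain ⟨a, b, c, d⟩ := f
  obtain ⟨A, B, C, D⟩ := g
  simp only [formAct, Prod.mk.injEq] at hg ⊢
  obtain ⟨h0, h1, h2, h3⟩ := hg
  have hn2 : n ^ 2 ≠ 0 := pow_ne_zero _ hn
  refine ⟨?_, ?_, ?_, ?_⟩ <;> apply mul_left_cancel₀ hn2
  · rw [show n ^ 2 * (n * a) = n ^ 3 * a by ring, ← hdet] at *
    linear_combination (-s^3) * h0 + s^2*q*h1 - s*q^2*h2 + q^3*h3
  · rw [show n ^ 2 * (n * b) = n ^ 3 * b by ring, ← hdet] at *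
    linear_combination (3*s^2*r) * h0 - (s^2*p+2*s*q*r)*h1 + (2*s*q*p+q^2*r)*h2 - 3*q^2*p*h3
  · rw [show n ^ 2 * (n * c) = n ^ 3 * c by ring, ← hdet] at *
    linear_combination (-3*s*r^2) * h0 + (2*s*r*p+q*r^2)*h1 - (s*p^2+2*q*r*p)*h2 + 3*q*p^2*h3
  · rw [show n ^ 2 * (n * d) = n ^ 3 * d by ring, ← hdet] at *
    linear_combination (r^3) * h0 - r^2*p*h1 + r*p^2*h2 - p^3*h3

theorem card_pairs_with_form_le {g : ℤ × ℤ × ℤ × ℤ} {P R N H : ℕ} (hPR : P ≤ 4 * R) (hP : 0 < P)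
    (hPN : 2 * P ≤ N * H) {W : Finset ((ℤ × ℤ × ℤ × ℤ) × ((ℤ × ℤ) × (ℤ × ℤ)))}
    (hW : ∀ x ∈ W, ∃ n : ℤ, 0 < n ∧ n ≤ N ∧ IsReducedPair n x.1 x.2 ∧ HasSize P R x.2 ∧
      |x.1.1| ≤ H ∧ |x.1.2.2.2| ≤ H ∧ x.1.1 ≠ 0 ∧ x.1.2.2.2 ≠ 0 ∧
      formAct x.2.1.1 x.2.1.2 x.2.2.1 x.2.2.2 x.1 =
        (n ^ 2 * g.1, n ^ 2 * g.2.1, n ^ 2 * g.2.2.1, n ^ 2 * g.2.2.2)) :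
    W.card ≤ 1200 * maxDivisors (N * H) ^ 2 * (P * R) := by
  classical
  have hinj : ∀ x ∈ W, ∀ y ∈ W, x.2 = y.2 → x = y := by
    rintro ⟨f, u⟩ hx ⟨f', u'⟩ hy huu
    simp only at huu
    subst huu
    obtain ⟨n, hn, -, h1, -, -, -, -, -, h2⟩ := hW _ hx
    obtain ⟨m, -, -, h1', -, -, -, -, -, h2'⟩ := hW _ hy
    obtain rfl : n = m := h1.1.symm.trans h1'.1
    have e1 := formAct_adjugate hn.ne' h1.1 h2
    have e2 := formAct_adjugate hn.ne' h1.1 h2'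
    rw [e1] at e2
    simp only [Prod.mk.injEq, mul_eq_mul_left_iff, hn.ne', or_false] at e2
    obtain ⟨a, b, c, d⟩ := f
    obtain ⟨a', b', c', d'⟩ := f'
    simp only at e2
    obtain ⟨rfl, rfl, rfl, rfl⟩ := e2
    rfl
  have habs : ∀ {n z : ℤ}, 0 < n → n ≤ N → |z| ≤ H → |n * z| ≤ (N * H : ℕ) := by
    intro n z h1 h2 h3
    rw [abs_mul, abs_of_pos h1]
    push_cast
    gcongr
  have hA : (W.filter fun x => (P : ℤ) ≤ |x.2.1.2|).card ≤
      600 * maxDivisors (N * H) ^ 2 * (P * R) := by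
    rw [← Finset.card_image_of_injOn (f := fun x => ((x.2.1.2, x.2.2.2), (x.2.1.1, x.2.2.1)))]
    · refine card_matrices_le hPR hPN
        (fun q s => g.1 * s ^ 3 - g.2.1 * s ^ 2 * q + g.2.2.1 * s * q ^ 2 - g.2.2.2 * q ^ 3) ?_
      intro u hu
      obtain ⟨x, hx, rfl⟩ := Finset.mem_image.1 hu
      obtain ⟨hx, hxP⟩ := Finset.mem_filter.1 hx
      obtain ⟨n, hn, hnN, h1, ⟨-, s2, s3, -, s5, s6⟩, f0, f3, n0, n3, h2⟩ := hW x hx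
      have e1 := congrArg Prod.fst (formAct_adjugate hn.ne' h1.1 h2)
      have e1' : g.1 * x.2.2.2 ^ 3 - g.2.1 * x.2.2.2 ^ 2 * x.2.1.2 +
          g.2.2.1 * x.2.2.2 * x.2.1.2 ^ 2 - g.2.2.2 * x.2.1.2 ^ 3 = n * x.1.1 := by
        simp only [formAct] at e1
        linear_combination e1
      simp only
      rw [e1']
      refine ⟨hxP, ?_, s3, s6, s2, mul_ne_zero hn.ne' n0, habs hn hnN f0, x.1.1, ?_⟩
      · intro h0
        rw [h0, abs_zero] at hxP
        lia
      · rw [← h1.1]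
    · intro x hx y hy hxy
      simp only [Prod.mk.injEq] at hxy
      refine hinj x (Finset.mem_filter.1 (Finset.mem_coe.1 hx)).1 y
        (Finset.mem_filter.1 (Finset.mem_coe.1 hy)).1 ?_
      ext <;> simp [hxy]
  have hB : (W.filter fun x => (P : ℤ) ≤ |x.2.1.1|).card ≤
      600 * maxDivisors (N * H) ^ 2 * (P * R) := by
    rw [← Finset.card_image_of_injOn (f := fun x => ((x.2.1.1, x.2.2.1), (x.2.1.2, x.2.2.2)))]
    · refine card_matrices_le hPR hPN
        (fun p r => -g.1 * r ^ 3 + g.2.1 * r ^ 2 * p - g.2.2.1 * r * p ^ 2 + g.2.2.2 * p ^ 3) ?_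
      intro u hu
      obtain ⟨x, hx, rfl⟩ := Finset.mem_image.1 hu
      obtain ⟨hx, hxP⟩ := Finset.mem_filter.1 hx
      obtain ⟨n, hn, hnN, h1, ⟨-, s2, s3, -, s5, s6⟩, f0, f3, n0, n3, h2⟩ := hW x hx
      have e1 := congrArg (fun z => z.2.2.2) (formAct_adjugate hn.ne' h1.1 h2)
      have e1' : -g.1 * x.2.2.1 ^ 3 + g.2.1 * x.2.2.1 ^ 2 * x.2.1.1 -
          g.2.2.1 * x.2.2.1 * x.2.1.1 ^ 2 + g.2.2.2 * x.2.1.1 ^ 3 = n * x.1.2.2.2 := by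
        simp only [formAct] at e1
        linear_combination e1
      simp only
      rw [e1']
      refine ⟨hxP, ?_, s2, s5, s3, mul_ne_zero hn.ne' n3, habs hn hnN f3, -x.1.2.2.2, ?_⟩
      · intro h0
        rw [h0, abs_zero] at hxP
        lia
      · rw [← h1.1]; ring
    · intro x hx y hy hxy
      simp only [Prod.mk.injEq] at hxy
      refine hinj x (Finset.mem_filter.1 (Finset.mem_coe.1 hx)).1 y
        (Finset.mem_filter.1 (Finset.mem_coe.1 hy)).1 ?_
      ext <;> simp [hxy]
  have hsub : W ⊆ (W.filter fun x => (P : ℤ) ≤ |x.2.1.1|) ∪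
      (W.filter fun x => (P : ℤ) ≤ |x.2.1.2|) := by
    intro x hx
    obtain ⟨n, -, -, -, hs, -⟩ := hW x hx
    rw [Finset.mem_union, Finset.mem_filter, Finset.mem_filter]
    exact hs.1.imp (fun h => ⟨hx, h⟩) (fun h => ⟨hx, h⟩)
  calc W.card ≤ _ := Finset.card_le_card hsub
    _ ≤ _ := Finset.card_union_le _ _
    _ ≤ _ := Nat.add_le_add hB hA
    _ = 1200 * maxDivisors (N * H) ^ 2 * (P * R) := by ring

theorem card_fixed_size_le {P R N H : ℕ} (hP : 0 < P) (hR : 0 < R)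
    (hPN : 2 * P ≤ N * H) {s : ℤ} {W : Finset ((ℤ × ℤ × ℤ × ℤ) × ((ℤ × ℤ) × (ℤ × ℤ)))}
    (hW : ∀ x ∈ W, x.1 ∈ irredBox s H ∧ ∃ n : ℤ, 0 < n ∧ n ≤ N ∧ IsReducedPair n x.1 x.2 ∧
      HasSize P R x.2) :
    P * R * W.card ≤ 1200 * 25344 ^ 4 * maxDivisors (N * H) ^ 2 * H ^ 4 := by
  classical
  rcases W.eq_empty_or_nonempty with rfl | ⟨x₀, hx₀⟩
  · simp
  have hPR : P < 4 * R := by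
    obtain ⟨-, n, -, -, h1, h2⟩ := hW x₀ hx₀
    exact_mod_cast (h1.size_bounds (by exact_mod_cast hP) (by exact_mod_cast hR) h2).1
  have hex : ∀ x, ∃ g : ℤ × ℤ × ℤ × ℤ, x ∈ W → ∃ n : ℤ, 0 < n ∧ n ≤ N ∧
      IsReducedPair n x.1 x.2 ∧ HasSize P R x.2 ∧
      formAct x.2.1.1 x.2.1.2 x.2.2.1 x.2.2.2 x.1 =
        (n ^ 2 * g.1, n ^ 2 * g.2.1, n ^ 2 * g.2.2.1, n ^ 2 * g.2.2.2) := by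
    intro x
    by_cases hx : x ∈ W
    · obtain ⟨-, n, hn, hnN, h1, h2⟩ := hW x hx
      obtain ⟨g, hg⟩ := h1.2.2.2
      exact ⟨g, fun _ => ⟨n, hn, hnN, h1, h2, hg⟩⟩
    · exact ⟨default, fun h => absurd h hx⟩
  choose γ hγ using hex
  have hbox : ∀ x ∈ W, IsIrredCubicForm x.1.1 x.1.2.1 x.1.2.2.1 x.1.2.2.2 ∧ (|x.1.1| ≤ H ∧
      |x.1.2.1| ≤ H ∧ |x.1.2.2.1| ≤ H ∧ |x.1.2.2.2| ≤ H) := by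
    intro x hx
    obtain ⟨h1, h2⟩ := mem_irredBox.1 (hW x hx).1
    exact ⟨h2, mem_coeffBox.1 (Finset.mem_filter.1 h1).1⟩
  have hG : (P * R) ^ 2 * (W.image γ).card ≤ 25344 ^ 4 * H ^ 4 := by
    refine card_coeff_le hP hR hPR ?_
    intro g hg
    obtain ⟨x, hx, rfl⟩ := Finset.mem_image.1 hg
    obtain ⟨n, hn, hnN, h1, h2, h3⟩ := hγ x hx
    obtain ⟨hirr, k0, k1, k2, k3⟩ := hbox x hx
    refine ⟨?_, h1.coeff_bounds (by exact_mod_cast hP) (by exact_mod_cast hR) k0 k1 k2 k3 h2 h3⟩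
    intro h0
    have h4 := congrArg Prod.fst h3
    rw [h0, mul_zero] at h4
    refine hirr.value_ne_zero (p := x.2.1.1) (q := x.2.1.2) ?_ h4
    rintro ⟨hp, hq⟩
    have := h1.1
    rw [hp, hq] at this
    lia
  have hfib : ∀ g ∈ W.image γ, (W.filter fun x => γ x = g).card ≤
      1200 * maxDivisors (N * H) ^ 2 * (P * R) := by
    intro g _
    refine card_pairs_with_form_le (g := g) hPR.le hP hPN ?_
    intro x hx
    obtain ⟨hxW, hxg⟩ := Finset.mem_filter.1 hx
    obtain ⟨n, hn, hnN, h1, h2, h3⟩ := hγ x hxW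
    obtain ⟨hirr, k0, k1, k2, k3⟩ := hbox x hxW
    rw [hxg] at h3
    exact ⟨n, hn, hnN, h1, h2, k0, k3, hirr.1, hirr.last_ne_zero, h3⟩
  have hcard := Finset.card_le_mul_card_image W _ hfib
  calc P * R * W.card ≤ P * R * (1200 * maxDivisors (N * H) ^ 2 * (P * R) * (W.image γ).card) := by
        gcongr
    _ = 1200 * maxDivisors (N * H) ^ 2 * ((P * R) ^ 2 * (W.image γ).card) := by ring
    _ ≤ 1200 * maxDivisors (N * H) ^ 2 * (25344 ^ 4 * H ^ 4) := by gcongr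
    _ = _ := by ring

open Filter

/-- The base-two logarithms of the sup norms of the two vectors of `u`. -/
def logSizes (u : (ℤ × ℤ) × (ℤ × ℤ)) : ℕ × ℕ :=
  (Nat.log 2 (max u.1.1.natAbs u.1.2.natAbs), Nat.log 2 (max u.2.1.natAbs u.2.2.natAbs))

theorem hasSize_logSizes {u : (ℤ × ℤ) × (ℤ × ℤ)} (h1 : ¬ (u.1.1 = 0 ∧ u.1.2 = 0))
    (h2 : ¬ (u.2.1 = 0 ∧ u.2.2 = 0)) :
    HasSize (2 ^ (logSizes u).1 : ℕ) (2 ^ (logSizes u).2 : ℕ) u := by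
  have aux : ∀ {x y : ℤ}, ¬ (x = 0 ∧ y = 0) →
      (((2 ^ Nat.log 2 (max x.natAbs y.natAbs) : ℕ) : ℤ) ≤ |x| ∨
        ((2 ^ Nat.log 2 (max x.natAbs y.natAbs) : ℕ) : ℤ) ≤ |y|) ∧
      |x| ≤ 2 * (2 ^ Nat.log 2 (max x.natAbs y.natAbs) : ℕ) ∧
      |y| ≤ 2 * (2 ^ Nat.log 2 (max x.natAbs y.natAbs) : ℕ) := by
    intro x y h
    have hm : max x.natAbs y.natAbs ≠ 0 := by lia
    have e1 := Nat.pow_log_le_self 2 hm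
    have e2 := Nat.lt_pow_succ_log_self (b := 2) (by norm_num) (max x.natAbs y.natAbs)
    rw [pow_succ] at e2
    generalize 2 ^ Nat.log 2 (max x.natAbs y.natAbs) = P at *
    rw [Int.abs_eq_natAbs, Int.abs_eq_natAbs]
    lia
  obtain ⟨a1, a2, a3⟩ := aux h1
  obtain ⟨b1, b2, b3⟩ := aux h2
  exact ⟨a1, a2, a3, b1, b2, b3⟩

theorem log_lt_maxDivisors {m K : ℕ} (hK : K ≠ 0) (h : m ≤ K) : Nat.log 2 m < maxDivisors K := by
  refine (Nat.lt_succ_of_le (Nat.log_mono_right h)).trans_le ?_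
  have := card_divisors_le_maxDivisors (n := 2 ^ Nat.log 2 K) (by positivity)
    (Nat.pow_log_le_self 2 hK)
  rwa [Nat.divisors_prime_pow Nat.prime_two, Finset.card_map, Finset.card_range] at this

/-- The indices beyond the reach of the elementary equidistribution estimate. -/
def tailIndices (H : ℕ) : Finset ℕ := (Finset.Icc 1 (54 * H ^ 4)).filter fun n => H < n ^ 3

theorem exists_tail_card_bound (s : ℤ) : ∃ C : ℕ, ∀ {H : ℕ}, 0 < H →
    ∀ {W : Finset ((ℤ × ℤ × ℤ × ℤ) × ((ℤ × ℤ) × (ℤ × ℤ)))},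
    (∀ x ∈ W, x.1 ∈ irredBox s H ∧ ∃ n ∈ tailIndices H, IsReducedPair n x.1 x.2) →
    W.card ^ 3 * H ≤ C * maxDivisors (216 * H ^ 4 * H) ^ 12 * H ^ 12 := by
  classical
  obtain ⟨κ, hκ⟩ : ∃ κ : ℕ, κ = 1200 * 25344 ^ 4 := ⟨_, rfl⟩
  refine ⟨(8 * κ) ^ 3, ?_⟩
  intro H hH W hW
  set D := maxDivisors (216 * H ^ 4 * H) with hD
  have hK : 108 * H ^ 4 ≤ 216 * H ^ 4 * H := by nlinarith [pow_pos hH 4]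
  have hmaps : ∀ x ∈ W, logSizes x.2 ∈ Finset.range D ×ˢ Finset.range D := by
    intro x hx
    obtain ⟨-, n, hn, h⟩ := hW x hx
    rw [tailIndices, Finset.mem_filter, Finset.mem_Icc] at hn
    have := h.mem_pairBox (by lia) (K := 108 * H ^ 4) (by lia)
    simp only [pairBox, Finset.mem_product, Finset.mem_Icc] at this
    rw [Finset.mem_product, Finset.mem_range, Finset.mem_range]
    exact ⟨log_lt_maxDivisors (by positivity) (by lia),
      log_lt_maxDivisors (by positivity) (by lia)⟩
  rcases W.eq_empty_or_nonempty with rfl | ⟨x₀, hx₀⟩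
  · simp
  obtain ⟨z, -, hz⟩ := Finset.exists_max_image (Finset.range D ×ˢ Finset.range D)
    (fun z => (W.filter fun x => logSizes x.2 = z).card) ⟨_, hmaps x₀ hx₀⟩
  have hcard := Finset.card_le_mul_card_image_of_maps_to hmaps _ hz
  rw [Finset.card_product, Finset.card_range] at hcard
  have hfib : (W.filter fun x => logSizes x.2 = z).card ^ 3 * H ≤
      (8 * (κ * D ^ 2 * H ^ 4)) ^ 3 := by
    have hsize : ∀ x ∈ W.filter fun x => logSizes x.2 = z, x.1 ∈ irredBox s H ∧ ∃ n : ℕ, 0 < n ∧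
        n ≤ 54 * H ^ 4 ∧ H < n ^ 3 ∧ IsReducedPair n x.1 x.2 ∧
        HasSize (2 ^ z.1 : ℕ) (2 ^ z.2 : ℕ) x.2 := by
      intro x hx
      obtain ⟨hxW, hxz⟩ := Finset.mem_filter.1 hx
      obtain ⟨h1, n, hn, h⟩ := hW x hxW
      rw [← hxz]
      rw [tailIndices, Finset.mem_filter, Finset.mem_Icc] at hn
      refine ⟨h1, n, hn.1.1, hn.1.2, hn.2, h, hasSize_logSizes ?_ ?_⟩
      · rintro ⟨e1, e2⟩
        have := h.1
        rw [e1, e2] at this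
        lia
      · rintro ⟨e1, e2⟩
        have := h.1
        rw [e1, e2] at this
        lia
    rcases (W.filter fun x => logSizes x.2 = z).eq_empty_or_nonempty with h0 | ⟨x, hx⟩
    · rw [h0]; simp
    · obtain ⟨-, n, hn, hnH, hn3, h1, h2⟩ := hsize x hx
      have hP : 0 < 2 ^ z.1 := by positivity
      have hR : 0 < 2 ^ z.2 := by positivity
      generalize 2 ^ z.1 = P at *
      generalize 2 ^ z.2 = R at *
      have h8 : n ≤ 8 * (P * R) := by
        have := (h1.size_bounds (by exact_mod_cast hP) (by exact_mod_cast hR) h2).2.2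
        rw [Nat.abs_cast] at this
        exact_mod_cast this
      have hPn : P ≤ 108 * H ^ 4 := by
        have := h1.mem_pairBox (by lia) (K := 108 * H ^ 4) (by lia)
        simp only [pairBox, Finset.mem_product, Finset.mem_Icc] at this
        have h3 := h2.1
        rw [Int.abs_eq_natAbs, Int.abs_eq_natAbs] at h3
        lia
      have hfix := card_fixed_size_le (N := 216 * H ^ 4) (H := H) (s := s)
        (W := W.filter fun x => logSizes x.2 = z) hP hR (by nlinarith [pow_pos hH 4])
        (fun x hx => by
          obtain ⟨e1, n, e2, e3, -, e4, e5⟩ := hsize x hx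
          exact ⟨e1, n, by exact_mod_cast e2, by push_cast; lia, e4, e5⟩)
      rw [← hD, ← hκ] at hfix
      calc _ ≤ (W.filter fun x => logSizes x.2 = z).card ^ 3 * (8 * (P * R)) ^ 3 := by
            gcongr
            exact hn3.le.trans (Nat.pow_le_pow_left h8 3)
        _ = (8 * (P * R * (W.filter fun x => logSizes x.2 = z).card)) ^ 3 := by ring
        _ ≤ _ := by gcongr
  calc W.card ^ 3 * H
      ≤ ((W.filter fun x => logSizes x.2 = z).card * (D * D)) ^ 3 * H := by gcongr
    _ = (W.filter fun x => logSizes x.2 = z).card ^ 3 * H * D ^ 6 := by ring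
    _ ≤ (8 * (κ * D ^ 2 * H ^ 4)) ^ 3 * D ^ 6 := by gcongr
    _ = _ := by ring

theorem exists_sum_tail_torsionCount_bound (s : ℤ) : ∃ C : ℕ, ∀ {H : ℕ}, 0 < H →
    (∑ n ∈ tailIndices H, ∑ f ∈ irredBox s H, torsionCount n f) ^ 3 * H ≤
      C * maxDivisors (216 * H ^ 4 * H) ^ 12 * H ^ 12 := by
  classical
  obtain ⟨C, hC⟩ := exists_tail_card_bound s
  refine ⟨8 * C, fun {H} hH => ?_⟩
  set W := (irredBox s H ×ˢ pairBox (108 * H ^ 4)).filter fun x =>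
    ∃ n ∈ tailIndices H, IsReducedPair n x.1 x.2 with hWdef
  have h1 : ∑ n ∈ tailIndices H, ∑ f ∈ irredBox s H, torsionCount n f ≤ 2 * W.card := by
    rw [Finset.sum_comm, hWdef, Finset.card_filter, Finset.sum_product, Finset.mul_sum]
    refine Finset.sum_le_sum fun f _ => ?_
    rw [← Finset.card_filter]
    refine sum_torsionCount_le_card_isReducedPair ?_ ?_ f
    · simp [tailIndices]
    · intro n hn
      rw [tailIndices, Finset.mem_filter, Finset.mem_Icc] at hn
      lia
  have h2 := hC hH (W := W) (fun x hx => by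
    rw [hWdef, Finset.mem_filter, Finset.mem_product] at hx
    exact ⟨hx.1.1, hx.2⟩)
  calc _ ≤ (2 * W.card) ^ 3 * H := by gcongr
    _ = 8 * (W.card ^ 3 * H) := by ring
    _ ≤ 8 * (C * maxDivisors (216 * H ^ 4 * H) ^ 12 * H ^ 12) := by gcongr
    _ = _ := by ring

theorem tendsto_tail (s : ℤ) :
    Tendsto (fun H : ℕ => ((∑ n ∈ tailIndices H, ∑ f ∈ irredBox s H, torsionCount n f : ℕ) : ℝ) /
      (H : ℝ) ^ 4) atTop (nhds 0) := by
  obtain ⟨C, hC⟩ := maxDivisors_pow_le 120 (by norm_num)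
  obtain ⟨κ, hκ⟩ := exists_sum_tail_torsionCount_bound s
  set c : ℝ := (κ : ℝ) ^ 10 * (C * 216) with hc
  have hbound : ∀ᶠ H : ℕ in atTop, (((∑ n ∈ tailIndices H, ∑ f ∈ irredBox s H,
      torsionCount n f : ℕ) : ℝ) / (H : ℝ) ^ 4) ^ 30 ≤ c * (H : ℝ)⁻¹ := by
    filter_upwards [eventually_ge_atTop 1] with H hH
    have h1 := hκ hH
    have h2 := hC (216 * H ^ 4 * H)
    generalize ∑ n ∈ tailIndices H, ∑ f ∈ irredBox s H, torsionCount n f = S at *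
    generalize maxDivisors (216 * H ^ 4 * H) = D at *
    have h1' : (S : ℝ) ^ 3 * H ≤ (κ : ℝ) * D ^ 12 * H ^ 12 := by exact_mod_cast h1
    have h2' : (D : ℝ) ^ 120 ≤ C * (216 * H ^ 4 * H) := by exact_mod_cast h2
    have hH' : (1 : ℝ) ≤ H := by exact_mod_cast hH
    rw [div_pow, ← div_eq_mul_inv, div_le_div_iff₀ (by positivity) (by positivity)]
    refine le_of_mul_le_mul_right (a := (H : ℝ) ^ 9) ?_ (by positivity)
    calc (S : ℝ) ^ 30 * H * H ^ 9 = ((S : ℝ) ^ 3 * H) ^ 10 := by ring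
      _ ≤ ((κ : ℝ) * D ^ 12 * H ^ 12) ^ 10 := by gcongr
      _ = (κ : ℝ) ^ 10 * D ^ 120 * H ^ 120 := by
        ring
      _ ≤ (κ : ℝ) ^ 10 * (C * (216 * H ^ 4 * H)) * H ^ 120 := by gcongr
      _ = c * H ^ 120 * H ^ 5 := by rw [hc]; ring
      _ ≤ c * H ^ 120 * H ^ 9 := by
        gcongr
        norm_num
      _ = c * (H ^ 4) ^ 30 * H ^ 9 := by ring
  have h30 := squeeze_zero' (Eventually.of_forall fun H => by positivity) hbound
    (by simpa using (tendsto_natCast_atTop_atTop (R := ℝ)).inv_tendsto_atTop.const_mul c)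
  have := h30.rpow_const (p := ((30 : ℕ) : ℝ)⁻¹) (Or.inr (by positivity))
  rw [Real.zero_rpow (by norm_num)] at this
  refine this.congr fun H => Real.pow_rpow_inv_natCast (by positivity) (by norm_num)

theorem isCoprime_natCast_zmod_iff {n : ℕ} {x y : ℕ} :
    IsCoprime (x : ZMod n) (y : ZMod n) ↔ (x.gcd y).gcd n = 1 := by
  constructor
  · rintro ⟨α, β, h⟩
    obtain ⟨α, rfl⟩ := ZMod.intCast_surjective α
    obtain ⟨β, rfl⟩ := ZMod.intCast_surjective β
    have h' : ((α * x + β * y - 1 : ℤ) : ZMod n) = 0 := by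
      push_cast
      rw [h, sub_self]
    rw [ZMod.intCast_zmod_eq_zero_iff_dvd] at h'
    have h1 : ((x.gcd y).gcd n : ℤ) ∣ x :=
      Int.natCast_dvd_natCast.2 ((Nat.gcd_dvd_left _ _).trans (Nat.gcd_dvd_left _ _))
    have h2 : ((x.gcd y).gcd n : ℤ) ∣ y :=
      Int.natCast_dvd_natCast.2 ((Nat.gcd_dvd_left _ _).trans (Nat.gcd_dvd_right _ _))
    have h3 : ((x.gcd y).gcd n : ℤ) ∣ n := Int.natCast_dvd_natCast.2 (Nat.gcd_dvd_right _ _)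
    have h4 := dvd_sub (dvd_add (h1.mul_left α) (h2.mul_left β)) (h3.trans h')
    rw [sub_sub_cancel] at h4
    exact Nat.dvd_one.1 (by exact_mod_cast h4)
  · intro h
    have h1 := Nat.gcd_eq_gcd_ab (x.gcd y) n
    rw [h, Nat.gcd_eq_gcd_ab x y] at h1
    have h2 := congrArg (Int.cast : ℤ → ZMod n) h1
    push_cast at h2
    rw [ZMod.natCast_self, zero_mul, add_zero] at h2
    exact ⟨(x.gcdA y : ZMod n) * ((x.gcd y).gcdA n : ZMod n),
      (x.gcdB y : ZMod n) * ((x.gcd y).gcdA n : ZMod n), by linear_combination -h2⟩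

theorem ncard_unimodularPairs (n : ℕ) [NeZero n] : (unimodularPairs n).ncard =
    ((Finset.range n ×ˢ Finset.range n).filter fun z => (z.1.gcd z.2).gcd n = 1).card := by
  rw [← Set.ncard_coe_finset]
  symm
  refine Set.ncard_congr (fun z _ => ((z.1 : ZMod n), (z.2 : ZMod n))) ?_ ?_ ?_
  · intro z hz
    exact isCoprime_natCast_zmod_iff.2 (Finset.mem_filter.1 (Finset.mem_coe.1 hz)).2
  · rintro ⟨x, y⟩ ⟨x', y'⟩ h h' heq
    simp only [Finset.coe_filter, Finset.mem_product, Finset.mem_range, Set.mem_ofPred_eq] at h h'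
    simp only [Prod.mk.injEq, ZMod.natCast_eq_natCast_iff'] at heq
    rw [Nat.mod_eq_of_lt h.1.1, Nat.mod_eq_of_lt h.1.2, Nat.mod_eq_of_lt h'.1.1,
      Nat.mod_eq_of_lt h'.1.2] at heq
    rw [heq.1, heq.2]
  · rintro ⟨x, y⟩ h
    refine ⟨(x.val, y.val), ?_, by simp⟩
    simp only [Finset.coe_filter, Finset.mem_product, Finset.mem_range, Set.mem_ofPred_eq]
    refine ⟨⟨ZMod.val_lt x, ZMod.val_lt y⟩, isCoprime_natCast_zmod_iff.1 ?_⟩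
    simpa [unimodularPairs] using h

theorem sum_divisors_ncard_unimodularPairs {n : ℕ} (hn : n ≠ 0) :
    ∑ d ∈ n.divisors, (unimodularPairs d).ncard = n ^ 2 := by
  have hmaps : ∀ z ∈ Finset.range n ×ˢ Finset.range n, (z.1.gcd z.2).gcd n ∈ n.divisors :=
    fun z _ => Nat.mem_divisors.2 ⟨Nat.gcd_dvd_right _ _, hn⟩
  have h1 := Finset.card_eq_sum_card_fiberwise hmaps
  rw [Finset.card_product, Finset.card_range, ← sq] at h1
  rw [h1, ← Nat.sum_div_divisors n fun d => (unimodularPairs d).ncard]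
  refine Finset.sum_congr rfl fun e he => ?_
  obtain ⟨⟨d, rfl⟩, -⟩ := Nat.mem_divisors.1 he
  have he0 : 0 < e := Nat.pos_of_ne_zero (left_ne_zero_of_mul hn)
  have : NeZero d := ⟨right_ne_zero_of_mul hn⟩
  rw [Nat.mul_div_cancel_left _ he0, ncard_unimodularPairs]
  refine Finset.card_bij (fun z _ => (e * z.1, e * z.2)) ?_ ?_ ?_
  · rintro ⟨x, y⟩ h
    simp only [Finset.mem_filter, Finset.mem_product, Finset.mem_range] at h ⊢
    refine ⟨⟨Nat.mul_lt_mul_of_pos_left h.1.1 he0, Nat.mul_lt_mul_of_pos_left h.1.2 he0⟩, ?_⟩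
    rw [Nat.gcd_mul_left, Nat.gcd_mul_left, h.2, mul_one]
  · rintro ⟨x, y⟩ _ ⟨x', y'⟩ _ h
    simpa [he0.ne'] using h
  · rintro ⟨x, y⟩ h
    simp only [Finset.mem_filter, Finset.mem_product, Finset.mem_range] at h
    have hx : e ∣ x := h.2 ▸ (Nat.gcd_dvd_left _ _).trans (Nat.gcd_dvd_left _ _)
    have hy : e ∣ y := h.2 ▸ (Nat.gcd_dvd_left _ _).trans (Nat.gcd_dvd_right _ _)
    obtain ⟨x, rfl⟩ := hx
    obtain ⟨y, rfl⟩ := hy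
    refine ⟨(x, y), ?_, rfl⟩
    simp only [Finset.mem_filter, Finset.mem_product, Finset.mem_range]
    rw [Nat.gcd_mul_left, Nat.gcd_mul_left] at h
    exact ⟨⟨lt_of_mul_lt_mul_left' h.1.1, lt_of_mul_lt_mul_left' h.1.2⟩,
      Nat.eq_of_mul_eq_mul_left he0 (by rw [h.2, mul_one])⟩

theorem hasSum_ncard_unimodularPairs :
    HasSum (fun n : ℕ => ((unimodularPairs n).ncard : ℝ) / (n : ℝ) ^ 4) (15 / Real.pi ^ 2) := by
  let f : ℕ → ℂ := fun n => ((unimodularPairs n).ncard : ℂ)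
  have hf : LSeriesSummable f 4 := by
    refine LSeriesSummable_of_le_const_mul_rpow (x := 3) (by norm_num) ⟨1, fun n hn => ?_⟩
    have : NeZero n := ⟨hn⟩
    rw [show (3 : ℝ) - 1 = ((2 : ℕ) : ℝ) by norm_num, Real.rpow_natCast, one_mul]
    simp only [f, Complex.norm_natCast]
    exact_mod_cast ncard_unimodularPairs_le n
  have hconv : LSeries.convolution f 1 = fun n : ℕ => if n = 0 then 0 else (n : ℂ) ^ 2 := by
    rw [LSeries.convolution_def]
    ext n
    split_ifs with h
    · simp [h]
    · simp only [f, Pi.one_apply, mul_one]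
      rw [Nat.sum_divisorsAntidiagonal (fun d _ => ((unimodularPairs d).ncard : ℂ))]
      exact_mod_cast sum_divisors_ncard_unimodularPairs h
  have h1 : LSeriesSummable 1 4 := LSeriesSummable_one_iff.2 (by norm_num)
  have h2 := LSeries_convolution' hf h1
  have h3 : LSeries (LSeries.convolution f 1) 4 = riemannZeta 2 := by
    rw [hconv, ← LSeries_one_eq_riemannZeta (by norm_num)]
    refine tsum_congr fun n => ?_
    rcases eq_or_ne n 0 with rfl | hn
    · simp
    · rw [LSeries.term_of_ne_zero hn, LSeries.term_of_ne_zero hn, if_neg hn]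
      have : (n : ℂ) ≠ 0 := by exact_mod_cast hn
      norm_cast
      rw [Pi.one_apply]
      field_simp
      push_cast
      ring
  rw [h3, LSeries_one_eq_riemannZeta (by norm_num), riemannZeta_two, riemannZeta_four] at h2
  have h4 : HasSum (fun n => LSeries.term f 4 n) (LSeries f 4) := hf.hasSum
  have hπ : (Real.pi : ℂ) ≠ 0 := by exact_mod_cast Real.pi_ne_zero
  have h5 : LSeries f 4 = ((15 / Real.pi ^ 2 : ℝ) : ℂ) := by
    push_cast
    field_simp at h2 ⊢
    linear_combination -h2 / 6
  rw [h5] at h4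
  rw [← Complex.hasSum_ofReal]
  refine h4.congr_fun fun n => ?_
  rcases eq_or_ne n 0 with rfl | hn
  · simp
  · rw [LSeries.term_of_ne_zero hn]
    norm_cast
    simp [f]

theorem torsionCount_le (n : ℕ) (f : ℤ × ℤ × ℤ × ℤ) :
    torsionCount n f ≤ n * (projReps n).card := by
  classical
  rw [torsionCount, mul_comm, ← smul_eq_mul]
  refine Finset.sum_le_card_nsmul _ _ _ fun v _ => ?_
  exact (Finset.card_filter_le _ _).trans (by rw [Finset.card_range])

theorem natAbs_tupleDisc_le {H : ℕ} {f : ℤ × ℤ × ℤ × ℤ} (hf : f ∈ coeffBox H) :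
    (tupleDisc f).natAbs ≤ 54 * H ^ 4 := by
  obtain ⟨a, b, c, d⟩ := f
  obtain ⟨ha, hb, hc, hd⟩ := mem_coeffBox.1 hf
  simp only at ha hb hc hd
  have mono : ∀ {w x y z : ℤ}, |w| ≤ H → |x| ≤ H → |y| ≤ H → |z| ≤ H →
      |w * x * y * z| ≤ (H : ℤ) ^ 4 := by
    intro w x y z hw hx hy hz
    rw [abs_mul, abs_mul, abs_mul, show (H : ℤ) ^ 4 = H * H * H * H by ring]
    gcongr
  have h1 := abs_le.1 (mono ha hb hc hd)
  have h2 := abs_le.1 (mono hb hb hb hd)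
  have h3 := abs_le.1 (mono hb hb hc hc)
  have h4 := abs_le.1 (mono ha hc hc hc)
  have h5 := abs_le.1 (mono ha ha hd hd)
  have : |tupleDisc (a, b, c, d)| ≤ 54 * (H : ℤ) ^ 4 := by
    rw [tupleDisc, cubicDisc, abs_le]
    constructor <;> linarith
  rw [Int.abs_eq_natAbs] at this
  exact_mod_cast this

theorem sum_idealGroupTwoTorsion_eq (s : ℤ) (H : ℕ) :
    ∑ f ∈ irredBox s H, idealGroupTwoTorsion (DFring f.1 f.2.1 f.2.2.1 f.2.2.2) =
      ∑ n ∈ Finset.Icc 1 (54 * H ^ 4), ∑ f ∈ irredBox s H, torsionCount n f := by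
  rw [Finset.sum_comm]
  refine Finset.sum_congr rfl fun f hf => ?_
  obtain ⟨h1, h2⟩ := mem_irredBox.1 hf
  obtain ⟨h3, h4⟩ := Finset.mem_filter.1 h1
  exact idealGroupTwoTorsion_DFring h2 (right_ne_zero_of_mul h4.ne') (natAbs_tupleDisc_le h3)

theorem tendsto_card_reducible (s : ℤ) :
    Tendsto (fun H : ℕ => ((signedBox s H \ irredBox s H).card : ℝ) / (H : ℝ) ^ 4) atTop
      (nhds 0) := by
  obtain ⟨C, hC⟩ := maxDivisors_pow_le 4 (by norm_num)
  have h1 : Tendsto (fun H : ℕ => (C : ℝ) * (H : ℝ)⁻¹) atTop (nhds 0) := by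
    simpa using (tendsto_natCast_atTop_atTop (R := ℝ)).inv_tendsto_atTop.const_mul (C : ℝ)
  have h2 := (h1.sqrt).const_mul (162 : ℝ)
  rw [Real.sqrt_zero, mul_zero] at h2
  refine squeeze_zero' (Eventually.of_forall fun H => by positivity) ?_ h2
  filter_upwards [eventually_ge_atTop 1] with H hH
  have hH' : (1 : ℝ) ≤ H := by exact_mod_cast hH
  have hr : ((signedBox s H \ irredBox s H).card : ℝ) ≤ 6 * maxDivisors H ^ 2 * (2 * H + 1) ^ 3 := by
    exact_mod_cast card_reducible_le hH
  have hD : (maxDivisors H : ℝ) ^ 4 ≤ C * H := by exact_mod_cast hC H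
  have hsq : (maxDivisors H : ℝ) ^ 2 / H ≤ √(C * (H : ℝ)⁻¹) := by
    refine Real.le_sqrt_of_sq_le ?_
    rw [div_pow, ← pow_mul, ← div_eq_mul_inv, div_le_div_iff₀ (by positivity) (by positivity)]
    calc (maxDivisors H : ℝ) ^ (2 * 2) * H ≤ C * H * H := by gcongr
      _ = _ := by ring
  calc _ ≤ 6 * (maxDivisors H : ℝ) ^ 2 * (3 * H) ^ 3 / (H : ℝ) ^ 4 := by
        gcongr
        exact hr.trans (by gcongr; linarith)
    _ = 162 * ((maxDivisors H : ℝ) ^ 2 / H) := by field_simp; ring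
    _ ≤ _ := by gcongr

theorem eventually_card_irredBox_ge {s : ℤ} (hs : s = 1 ∨ s = -1) :
    ∀ᶠ H : ℕ in atTop, (H : ℝ) ^ 4 ≤ 12800 * (irredBox s H).card := by
  have h1 := (tendsto_card_reducible s).eventually_lt_const
    (show (0 : ℝ) < 1 / 12800 by norm_num)
  filter_upwards [h1, eventually_ge_atTop 20] with H h1 h2
  have hH : (0 : ℝ) < H := by exact_mod_cast (show 0 < H by lia)
  have h3 := card_signedBox_ge hs h2
  rw [div_lt_iff₀ (by positivity)] at h1
  have h4 := Finset.card_sdiff_add_card_eq_card (irredBox_subset s H)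
  have h5 : ((signedBox s H \ irredBox s H).card : ℝ) + (irredBox s H).card =
    (signedBox s H).card := by exact_mod_cast h4
  linarith

theorem tendsto_average_torsionCount {s : ℤ} (hs : s = 1 ∨ s = -1) {n : ℕ} (hn : n ≠ 0) :
    Tendsto (fun H : ℕ => ((∑ f ∈ irredBox s H, torsionCount n f : ℕ) : ℝ) / (irredBox s H).card)
      atTop (nhds ((unimodularPairs n).ncard / (n : ℝ) ^ 4)) := by
  have : NeZero (n ^ 3) := ⟨pow_ne_zero 3 hn⟩
  obtain ⟨K, hK⟩ : ∃ K : ℕ, ∀ f, torsionCount n f ≤ K := ⟨_, torsionCount_le n⟩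
  set μ : ℝ := (unimodularPairs n).ncard / (n : ℝ) ^ 4 with hμ
  have hμ0 : 0 ≤ μ := by positivity
  have hcube : cubeSum (n ^ 3) (fun f => (torsionCount n f : ℝ)) / ((n ^ 3 : ℕ) : ℝ) ^ 4 = μ := by
    have h1 : cubeSum (n ^ 3) (fun f => (torsionCount n f : ℝ)) =
        ((cubeSum (n ^ 3) (torsionCount n) : ℕ) : ℝ) := by simp [cubeSum]
    have : (n : ℝ) ≠ 0 := by exact_mod_cast hn
    rw [h1, cubeSum_torsionCount n hn, hμ]
    push_cast
    field_simp
  have hlim : Tendsto (fun H : ℕ => 12800 * (864 * (n ^ 3 : ℕ) * (K : ℝ) * (H : ℝ)⁻¹ +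
      ((signedBox s H \ irredBox s H).card : ℝ) / (H : ℝ) ^ 4 * (K + μ))) atTop (nhds 0) := by
    have h1 := (tendsto_natCast_atTop_atTop (R := ℝ)).inv_tendsto_atTop.const_mul
      (864 * (n ^ 3 : ℕ) * (K : ℝ))
    have h2 := ((h1.add ((tendsto_card_reducible s).mul_const (K + μ))).const_mul 12800)
    simpa using h2
  rw [tendsto_iff_dist_tendsto_zero]
  refine squeeze_zero' (Eventually.of_forall fun H => dist_nonneg) ?_ hlim
  filter_upwards [eventually_card_irredBox_ge hs, eventually_ge_atTop 1] with H hc hH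
  have hH' : (1 : ℝ) ≤ H := by exact_mod_cast hH
  have hc0 : (0 : ℝ) < (irredBox s H).card := by
    have : (0 : ℝ) < (H : ℝ) ^ 4 := by positivity
    linarith
  have h1 := abs_sum_signedBox_sub_le s H (M := n ^ 3) (F := fun f => (torsionCount n f : ℝ))
    (K := K) (fun f => by rw [Nat.abs_cast]; exact_mod_cast hK f)
    (fun f g h => congrArg Nat.cast (isPeriodicMod_torsionCount n f g h))
  rw [hcube] at h1
  have h2 : ∑ f ∈ signedBox s H \ irredBox s H, (torsionCount n f : ℝ) +
      ∑ f ∈ irredBox s H, (torsionCount n f : ℝ) = ∑ f ∈ signedBox s H, (torsionCount n f : ℝ) :=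
    Finset.sum_sdiff (irredBox_subset s H)
  have h3 : ∑ f ∈ signedBox s H \ irredBox s H, (torsionCount n f : ℝ) ≤
      (signedBox s H \ irredBox s H).card * K := by
    rw [← nsmul_eq_mul]
    exact Finset.sum_le_card_nsmul _ _ _ fun f _ => by exact_mod_cast hK f
  have h3' : 0 ≤ ∑ f ∈ signedBox s H \ irredBox s H, (torsionCount n f : ℝ) :=
    Finset.sum_nonneg fun f _ => by positivity
  have h5 : ((signedBox s H \ irredBox s H).card : ℝ) + (irredBox s H).card =
    (signedBox s H).card := by
    exact_mod_cast Finset.card_sdiff_add_card_eq_card (irredBox_subset s H)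
  have h6 : (32 : ℝ) * (n ^ 3 : ℕ) * K * (2 * H + 1) ^ 3 ≤ 864 * (n ^ 3 : ℕ) * K * H ^ 3 := by
    calc (32 : ℝ) * (n ^ 3 : ℕ) * K * (2 * H + 1) ^ 3 ≤ 32 * (n ^ 3 : ℕ) * K * (3 * H) ^ 3 := by
          gcongr
          linarith
      _ = _ := by ring
  have hρ : (0 : ℝ) ≤ ((signedBox s H \ irredBox s H).card : ℝ) := Nat.cast_nonneg _
  rw [Real.dist_eq]
  push_cast at h1 h6 ⊢
  generalize ∑ f ∈ signedBox s H \ irredBox s H, (torsionCount n f : ℝ) = A at *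
  generalize ∑ f ∈ irredBox s H, (torsionCount n f : ℝ) = B at *
  generalize ((signedBox s H \ irredBox s H).card : ℝ) = ρ at *
  rw [← h2, ← h5] at h1
  generalize ((irredBox s H).card : ℝ) = c at *
  have h7 : |B - c * μ| ≤ 864 * (n : ℝ) ^ 3 * K * H ^ 3 + ρ * (K + μ) := by
    have h8 := abs_le.1 (h1.trans h6)
    have := mul_nonneg hρ hμ0
    have := mul_nonneg hρ (Nat.cast_nonneg (α := ℝ) K)
    rw [abs_le]
    constructor <;> nlinarith
  have h8 : B / c - μ = (B - c * μ) / c := by field_simp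
  rw [h8, abs_div, abs_of_pos hc0, div_le_iff₀ hc0]
  have h9 : 0 ≤ 864 * (n : ℝ) ^ 3 * K * (H : ℝ)⁻¹ + ρ / (H : ℝ) ^ 4 * (K + μ) := by
    positivity
  calc |B - c * μ| ≤ _ := h7
    _ = (864 * (n : ℝ) ^ 3 * K * (H : ℝ)⁻¹ + ρ / (H : ℝ) ^ 4 * (K + μ)) * (H : ℝ) ^ 4 := by
      field_simp
    _ ≤ (864 * (n : ℝ) ^ 3 * K * (H : ℝ)⁻¹ + ρ / (H : ℝ) ^ 4 * (K + μ)) * (12800 * c) := by gcongr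
    _ = _ := by ring

theorem sum_irredBox_torsionCount_le (s : ℤ) {n H : ℕ} (hn : n ≠ 0) (hH : n ^ 3 ≤ H) :
    n ^ 2 * ∑ f ∈ irredBox s H, torsionCount n f ≤ 81 * H ^ 4 := by
  refine le_trans ?_ (sum_torsionCount_le hn hH)
  gcongr
  exact (irredBox_subset s H).trans (Finset.filter_subset _ _)

theorem sum_torsionCount_eq_tsum (s : ℤ) (H : ℕ) (c : ℝ) :
    ((∑ n ∈ Finset.Icc 1 (54 * H ^ 4), ∑ f ∈ irredBox s H, torsionCount n f : ℕ) : ℝ) / c =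
      (∑' n : ℕ, if n ≠ 0 ∧ n ^ 3 ≤ H then
        ((∑ f ∈ irredBox s H, torsionCount n f : ℕ) : ℝ) / c else 0) +
      ((∑ n ∈ tailIndices H, ∑ f ∈ irredBox s H, torsionCount n f : ℕ) : ℝ) / c := by
  rw [tsum_eq_sum (s := (Finset.Icc 1 (54 * H ^ 4)).filter fun n => ¬ H < n ^ 3)]
  · rw [tailIndices, ← Finset.sum_filter_not_add_sum_filter (Finset.Icc 1 (54 * H ^ 4))
      (fun n => H < n ^ 3), Nat.cast_add, add_div]
    congr 1
    rw [Nat.cast_sum, Finset.sum_div]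
    refine Finset.sum_congr rfl fun n hn => ?_
    rw [Finset.mem_filter, Finset.mem_Icc] at hn
    rw [if_pos ⟨by lia, by lia⟩]
  · intro n hn
    refine if_neg fun h => hn ?_
    have h1 : n ≤ n ^ 3 := Nat.le_self_pow (by norm_num) n
    have h2 : H ≤ H ^ 4 := Nat.le_self_pow (by norm_num) H
    rw [Finset.mem_filter, Finset.mem_Icc]
    lia

theorem tendsto_average_idealGroupTwoTorsion {s : ℤ} (hs : s = 1 ∨ s = -1) :
    Tendsto (fun H : ℕ =>
      ((∑ f ∈ irredBox s H, idealGroupTwoTorsion (DFring f.1 f.2.1 f.2.2.1 f.2.2.2) : ℕ) : ℝ) /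
        (irredBox s H).card) atTop (nhds (15 / Real.pi ^ 2)) := by
  simp only [sum_idealGroupTwoTorsion_eq, sum_torsionCount_eq_tsum]
  rw [← hasSum_ncard_unimodularPairs.tsum_eq, ← add_zero (tsum _)]
  refine Tendsto.add ?_ ?_
  · refine tendsto_tsum_of_dominated_convergence
      (bound := fun n : ℕ => 1036800 * (1 / (n : ℝ) ^ 2))
      ((Real.summable_one_div_nat_pow.2 one_lt_two).mul_left _) (fun n => ?_) ?_
    · rcases eq_or_ne n 0 with rfl | hn
      · simp
      · refine (tendsto_average_torsionCount hs hn).congr' ?_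
        filter_upwards [eventually_ge_atTop (n ^ 3)] with H hH
        rw [if_pos ⟨hn, hH⟩]
    · filter_upwards [eventually_card_irredBox_ge hs, eventually_ge_atTop 1] with H hc hH n
      split_ifs with h
      · have hH' : (1 : ℝ) ≤ H := by exact_mod_cast hH
        have hn : (0 : ℝ) < n := by exact_mod_cast Nat.pos_of_ne_zero h.1
        have h1 : (n : ℝ) ^ 2 * ((∑ f ∈ irredBox s H, torsionCount n f : ℕ) : ℝ) ≤
          81 * (H : ℝ) ^ 4 := by exact_mod_cast sum_irredBox_torsionCount_le s h.1 h.2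
        have h2 : (0 : ℝ) < (H : ℝ) ^ 4 := by positivity
        rw [Real.norm_of_nonneg (by positivity), div_le_iff₀ (by linarith), mul_one_div,
          div_mul_eq_mul_div, le_div_iff₀ (by positivity)]
        linarith
      · rw [norm_zero]
        positivity
  · have h := (tendsto_tail s).const_mul 12800
    rw [mul_zero] at h
    refine squeeze_zero' (Eventually.of_forall fun H => by positivity) ?_ h
    filter_upwards [eventually_card_irredBox_ge hs, eventually_ge_atTop 1] with H hc hH
    have hH' : (1 : ℝ) ≤ H := by exact_mod_cast hH
    have h2 : (0 : ℝ) < (H : ℝ) ^ 4 := by positivity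
    rw [← mul_div_assoc, div_le_div_iff₀ (by linarith) h2]
    have h3 : (0 : ℝ) ≤
      ((∑ n ∈ tailIndices H, ∑ f ∈ irredBox s H, torsionCount n f : ℕ) : ℝ) := Nat.cast_nonneg _
    nlinarith

theorem mem_irredBox_pred_ceil_iff (pos : Bool) {X : ℝ} (hX : 0 < X) (v : ℤ × ℤ × ℤ × ℤ) :
    (IsIrredCubicForm v.1 v.2.1 v.2.2.1 v.2.2.2 ∧
      (if pos then 0 < cubicDisc v.1 v.2.1 v.2.2.1 v.2.2.2
        else cubicDisc v.1 v.2.1 v.2.2.1 v.2.2.2 < 0) ∧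
      (cubicHeight v.1 v.2.1 v.2.2.1 v.2.2.2 : ℝ) < X) ↔
    v ∈ irredBox (if pos then 1 else -1) (⌈X⌉₊ - 1) := by
  have h1 : (cubicHeight v.1 v.2.1 v.2.2.1 v.2.2.2 : ℝ) < X ↔ v ∈ coeffBox (⌈X⌉₊ - 1) := by
    have h2 : 0 < ⌈X⌉₊ := Nat.ceil_pos.2 hX
    have h3 : (⌈X⌉₊ : ℤ) = ⌈X⌉ := Int.natCast_ceil_eq_ceil hX.le
    rw [← Int.lt_ceil, mem_coeffBox, cubicHeight, ← h3, Nat.cast_sub h2]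
    simp only [max_lt_iff]
    lia
  rw [mem_irredBox, signedBox, Finset.mem_filter, h1, tupleDisc]
  cases pos <;> simp <;> tauto

/-- **Average `2`-torsion in ideal groups of Delone–Faddeev rings of binary cubic forms
enumerated by height (Theorem 1.7b).**  For each sign (`pos = true` for positive
discriminant, `pos = false` for negative), as `X → ∞` the average of `#I(R_f)[2]` over
integral binary cubic forms `f` that are irreducible over `ℚ`, have discriminant of the
given sign, and have height less than `X`, tends to `ζ(2)/ζ(4) = 15/π²`. -/
theorem average_two_torsion_ideal_group_binary_cubic_forms (pos : Bool) :
    Filter.Tendsto (fun X : ℝ =>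
        (∑' v : {v : ℤ × ℤ × ℤ × ℤ //
            IsIrredCubicForm v.1 v.2.1 v.2.2.1 v.2.2.2 ∧
            (if pos then 0 < cubicDisc v.1 v.2.1 v.2.2.1 v.2.2.2
              else cubicDisc v.1 v.2.1 v.2.2.1 v.2.2.2 < 0) ∧
            (cubicHeight v.1 v.2.1 v.2.2.1 v.2.2.2 : ℝ) < X},
          (idealGroupTwoTorsion
            (DFring (v : ℤ × ℤ × ℤ × ℤ).1 (v : ℤ × ℤ × ℤ × ℤ).2.1
              (v : ℤ × ℤ × ℤ × ℤ).2.2.1 (v : ℤ × ℤ × ℤ × ℤ).2.2.2) : ℝ)) /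
        (Nat.card {v : ℤ × ℤ × ℤ × ℤ //
            IsIrredCubicForm v.1 v.2.1 v.2.2.1 v.2.2.2 ∧
            (if pos then 0 < cubicDisc v.1 v.2.1 v.2.2.1 v.2.2.2
              else cubicDisc v.1 v.2.1 v.2.2.1 v.2.2.2 < 0) ∧
            (cubicHeight v.1 v.2.1 v.2.2.1 v.2.2.2 : ℝ) < X} : ℝ))
      Filter.atTop (nhds (15 / Real.pi ^ 2)) := by
  have hlim := (tendsto_average_idealGroupTwoTorsion
    (s := if pos then 1 else -1) (by cases pos <;> simp)).comp
    ((tendsto_sub_atTop_nat 1).comp (tendsto_nat_ceil_atTop (α := ℝ)))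
  refine hlim.congr' ?_
  filter_upwards [eventually_gt_atTop 0] with X hX
  have hset : ∀ p : ℤ × ℤ × ℤ × ℤ → Prop,
      (∀ v, p v ↔ v ∈ irredBox (if pos then 1 else -1) (⌈X⌉₊ - 1)) →
      ((∑ f ∈ irredBox (if pos then 1 else -1) (⌈X⌉₊ - 1),
        idealGroupTwoTorsion (DFring f.1 f.2.1 f.2.2.1 f.2.2.2) : ℕ) : ℝ) /
          (irredBox (if pos then 1 else -1) (⌈X⌉₊ - 1)).card =
        (∑' v : {v // p v}, (idealGroupTwoTorsion (DFring v.1.1 v.1.2.1 v.1.2.2.1 v.1.2.2.2) : ℝ)) /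
          (Nat.card {v // p v} : ℝ) := by
    intro p hp
    obtain rfl : p = fun v => v ∈ irredBox (if pos then 1 else -1) (⌈X⌉₊ - 1) :=
      funext fun v => propext (hp v)
    rw [Finset.tsum_subtype (irredBox (if pos then 1 else -1) (⌈X⌉₊ - 1))
      (fun f => (idealGroupTwoTorsion (DFring f.1 f.2.1 f.2.2.1 f.2.2.2) : ℝ)),
      Nat.card_eq_fintype_card, Fintype.card_coe, Nat.cast_sum]
  exact hset _ (mem_irredBox_pred_ceil_iff pos hX)
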